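/- arXiv:2003.02127 — 2 statements merged into one kernel-verified Lean document; each statement's English description precedes it below -/
import Mathlib

section
/- Let Σ ⊆ ℝⁿ be a closed set with 0 ∈ Σ, let r, m be positive integers, let n ≥ p ≥ 1, and let f : ℝⁿ → ℝᵖ be real analytic on a neighbourhood of 0 with f(0)=0. Then f satisfies condition I^T_r(m) if and only if f satisfies condition I^K_r(m). -/
open scoped Classical in
/-- The Kuo quantity `K_m(f,x)`. -/
noncomputable def KuoQ (n p m : ℕ)
    (f : EuclideanSpace ℝ (Fin n) → EuclideanSpace ℝ (Fin p))
    (x : EuclideanSpace ℝ (Fin n)) : ℝ :=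
  ‖x‖ ^ m *
      ∑ ι : Fin p → Fin n,
        (if StrictMono ι then
          |(Matrix.det fun j k : Fin p =>
              fderiv ℝ f x (EuclideanSpace.single (ι k) 1) j)| ^ m
        else 0)
    + ‖f x‖ ^ m

open scoped Classical in
/-- The Thom quantity `T_m(f,x)`. -/
noncomputable def ThomQ (n p m : ℕ)
    (f : EuclideanSpace ℝ (Fin n) → EuclideanSpace ℝ (Fin p))
    (x : EuclideanSpace ℝ (Fin n)) : ℝ :=
  (∑ ι : Fin (p + 1) → Fin n,
      if StrictMono ι then
        |(Matrix.det fun j k : Fin (p + 1) =>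
            if h : (j : ℕ) < p then fderiv ℝ f x (EuclideanSpace.single (ι k) 1) ⟨j, h⟩
            else 2 * x (ι k))| ^ m
      else 0)
    + ‖f x‖ ^ m

/-- `f` and `g` have the same `r`-jet relative to the closed set `S` near `0`:
all partial derivatives of `f - g` of order `≤ r` vanish at every point of
`S ∩ U` for some neighbourhood `U` of `0`. -/
def SameRelJet {n p : ℕ} (r : ℕ) (S : Set (EuclideanSpace ℝ (Fin n)))
    (f g : EuclideanSpace ℝ (Fin n) → EuclideanSpace ℝ (Fin p)) : Prop :=
  ∃ U ∈ nhds (0 : EuclideanSpace ℝ (Fin n)), ∀ k : ℕ, k ≤ r → ∀ x ∈ S ∩ U,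
    iteratedFDeriv ℝ k (fun y => f y - g y) x = 0

/-- Condition `I^T_r(m)` relative to the closed set `S`. -/
def CondIT (n p : ℕ) (r m : ℕ) (S : Set (EuclideanSpace ℝ (Fin n)))
    (f : EuclideanSpace ℝ (Fin n) → EuclideanSpace ℝ (Fin p)) : Prop :=
  ∃ c > (0 : ℝ), ∃ δ > (0 : ℝ), ∀ x : EuclideanSpace ℝ (Fin n),
    ‖x‖ < δ → c * Metric.infDist x S ^ (r * m) ≤ ThomQ n p m f x

/-- Condition `I^K_r(m)` relative to the closed set `S`. -/
def CondIK (n p : ℕ) (r m : ℕ) (S : Set (EuclideanSpace ℝ (Fin n)))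
    (f : EuclideanSpace ℝ (Fin n) → EuclideanSpace ℝ (Fin p)) : Prop :=
  ∃ c > (0 : ℝ), ∃ δ > (0 : ℝ), ∀ x : EuclideanSpace ℝ (Fin n),
    ‖x‖ < δ → c * Metric.infDist x S ^ (r * m) ≤ KuoQ n p m f x

theorem Derivation.exists_extension_of_isAlgebraic {k A K : Type*} [Field k] [CommRing A]
    [IsDomain A] [Algebra k A] [CharZero k] [Field K] [Algebra k K] [Algebra A K]
    [IsScalarTower k A K]
    [FaithfulSMul A K] [Algebra.IsAlgebraic A K] (d : Derivation k A A) :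
    ∃ D : Derivation k K K, ∀ a, D (algebraMap A K a) = algebraMap A K (d a) := by
  let F := FractionRing A
  let _ : Algebra F K := FractionRing.liftAlgebra A K
  have : IsScalarTower A F K := FractionRing.isScalarTower_liftAlgebra A K
  have : IsScalarTower k F K := IsScalarTower.of_algebraMap_eq fun x => by
    rw [IsScalarTower.algebraMap_apply k A F, ← IsScalarTower.algebraMap_apply A F K,
      ← IsScalarTower.algebraMap_apply k A K]
  have : CharZero F := charZero_of_injective_algebraMap (algebraMap k F).injective
  have : Algebra.IsAlgebraic F K := IsFractionRing.comap_isAlgebraic_iff (A := A) |>.1 inferInstance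
  have : Algebra.FormallyEtale A F := Algebra.FormallyEtale.of_isLocalization (nonZeroDivisors A)
  have : Algebra.FormallyEtale F K := Algebra.FormallyEtale.of_isSeparable F K
  have : Algebra.FormallyEtale A K := Algebra.FormallyEtale.comp A F K
  let e := KaehlerDifferential.tensorKaehlerEquivOfFormallyEtale k A K
  let d' : Derivation k A K := (Algebra.linearMap A K).compDer d
  let l : TensorProduct A K (Ω[A⁄k]) →ₗ[K] K := d'.liftKaehlerDifferential.liftBaseChange K
  refine ⟨(l ∘ₗ e.symm.toLinearMap).compDer (KaehlerDifferential.D k K), fun a => ?_⟩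
  have := KaehlerDifferential.tensorKaehlerEquivOfFormallyEtale_symm_D_algebraMap k A K a
  simp [e, l, this, d']

section LogarithmicDerivations

open Polynomial WithZero

section LogarithmicDerivation

variable {k K : Type*} [Field k] [Field K] [Algebra k K]
  (v : Valuation K (WithZero (Multiplicative ℤ))) (B : Subalgebra k K) (D : Derivation k K K)

theorem Valuation.map_algebraMap_eq_one_of_le_one (hB : ∀ b ∈ B, v b ≤ 1) {c : k} (hc : c ≠ 0) :
    v (algebraMap k K c) = 1 := by
  refine le_antisymm (hB _ (B.algebraMap_mem c)) ?_
  have h := hB _ (B.algebraMap_mem c⁻¹)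
  rw [map_inv₀, map_inv₀] at h
  have h0 : v (algebraMap k K c) ≠ 0 := by simpa using hc
  exact (inv_le_one₀ (zero_lt_iff.2 h0)).1 h

theorem Valuation.map_natCast_eq_one_of_le_one [CharZero k] (hB : ∀ b ∈ B, v b ≤ 1)
    {n : ℕ} (hn : n ≠ 0) :
    v (n : K) = 1 := by
  have := v.map_algebraMap_eq_one_of_le_one B hB (c := (n : k)) (by exact_mod_cast hn)
  simpa using this

theorem Derivation.pow_div_pow {n : ℕ} {g : K} (hg : g ≠ 0) :
    D (g ^ n) / g ^ n = n * (D g / g) := by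
  rcases n with _ | n
  · simp
  · rw [D.leibniz_pow]
    simp only [Nat.add_sub_cancel, smul_eq_mul, nsmul_eq_mul]
    field_simp
    ring

theorem Derivation.mul_div_mul {g h : K} (hg : g ≠ 0) (hh : h ≠ 0) :
    D (g * h) / (g * h) = D g / g + D h / h := by
  rw [D.leibniz]
  simp only [smul_eq_mul]
  field_simp
  ring

variable {v B D} {y : K}

/-- An element of value less than one is, up to taking powers, a power of `y` times a unit. -/
theorem Valuation.exists_pow_mul_eq_pow_mul (hy0 : y ≠ 0) (hy : v y < 1)
    (hfrac : ∀ g, v g = 1 → ∃ b ∈ B, ∃ s ∈ B, v b = 1 ∧ v s = 1 ∧ g * s = b)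
    {u : K} (hu0 : u ≠ 0) (hu : v u < 1) :
    ∃ e i : ℕ, e ≠ 0 ∧ i ≠ 0 ∧ ∃ b ∈ B, ∃ s ∈ B, v b = 1 ∧ v s = 1 ∧ u ^ e * s = y ^ i * b := by
  have key : ∀ g : K, g ≠ 0 → v g < 1 → ∃ n : ℕ, n ≠ 0 ∧ v g = exp (-(n : ℤ)) := by
    intro g hg hg1
    have h0 : v g ≠ 0 := by simpa using hg
    have h1 : log (v g) < 0 := by rw [← exp_log h0, ← exp_zero, exp_lt_exp] at hg1; exact hg1
    refine ⟨(-log (v g)).toNat, by omega, ?_⟩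
    rw [Int.toNat_of_nonneg (by omega), neg_neg, exp_log h0]
  obtain ⟨e, he, hye⟩ := key y hy0 hy
  obtain ⟨i, hi, hui⟩ := key u hu0 hu
  have h1 : v (u ^ e / y ^ i) = 1 := by
    rw [map_div₀, map_pow, map_pow, hye, hui, ← exp_nsmul, ← exp_nsmul, ← exp_sub, ← exp_zero]
    congr 1
    simp only [nsmul_eq_mul]
    ring
  obtain ⟨b, hb, s, hs, hvb, hvs, h⟩ := hfrac _ h1
  refine ⟨e, i, he, hi, b, hb, s, hs, hvb, hvs, ?_⟩
  rw [← h]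
  field_simp

theorem Derivation.mul_div_eq_of_pow_mul_eq (hDy : D y = y) (hy0 : y ≠ 0) {e i : ℕ} {u b s : K}
    (hu0 : u ≠ 0) (hb : v b = 1) (hs : v s = 1) (h : u ^ e * s = y ^ i * b) :
    (e : K) * (D u / u) = i + D b / b - D s / s := by
  have hb0 : b ≠ 0 := by rintro rfl; simp at hb
  have hs0 : s ≠ 0 := by rintro rfl; simp at hs
  have h1 := D.mul_div_mul (pow_ne_zero e hu0) hs0
  rw [h, D.mul_div_mul (pow_ne_zero i hy0) hb0, D.pow_div_pow hu0, D.pow_div_pow hy0, hDy,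
    div_self hy0] at h1
  linear_combination -h1

theorem Derivation.valuation_le_of_unit_le [CharZero k] (hB : ∀ b ∈ B, v b ≤ 1)
    (hy0 : y ≠ 0) (hy : v y < 1)
    (hDy : D y = y)
    (hfrac : ∀ g, v g = 1 → ∃ b ∈ B, ∃ s ∈ B, v b = 1 ∧ v s = 1 ∧ g * s = b)
    {M : WithZero (Multiplicative ℤ)} (hM1 : 1 ≤ M) (hM : ∀ b ∈ B, v b = 1 → v (D b) ≤ M)
    {u : K} (hu0 : u ≠ 0) (hu : v u < 1) : v (D u) ≤ v u * M := by
  obtain ⟨e, i, he, -, b, hb, s, hs, hvb, hvs, h⟩ :=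
    v.exists_pow_mul_eq_pow_mul hy0 hy hfrac hu0 hu
  have h1 := congrArg v (mul_div_eq_of_pow_mul_eq hDy hy0 hu0 hvb hvs h)
  rw [map_mul, v.map_natCast_eq_one_of_le_one B hB he, one_mul, map_div₀] at h1
  have h2 : v (i + D b / b - D s / s) ≤ M := by
    refine v.map_sub_le (v.map_add_le ?_ ?_) ?_
    · exact (hB _ (B.natCast_mem i)).trans hM1
    · rw [map_div₀, hvb, div_one]; exact hM b hb hvb
    · rw [map_div₀, hvs, div_one]; exact hM s hs hvs
  rw [← h1] at h2
  have h0 : 0 < v u := zero_lt_iff.2 (by simpa using hu0)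
  rwa [div_le_iff₀ h0, mul_comm] at h2

theorem Derivation.exists_valuation_eq_of_residue_algebraic [CharZero k] (hB : ∀ b ∈ B, v b ≤ 1)
    {b : K} (hb : b ∈ B) (halg : ∃ p : k[X], p ≠ 0 ∧ v (aeval b p) < 1) :
    ∃ u, v u < 1 ∧ v (D b) = v (D u) := by
  classical
  obtain ⟨p, ⟨hp0, hp⟩, hmin⟩ := exists_minimalFor_of_wellFoundedLT
    (fun p : k[X] => p ≠ 0 ∧ v (aeval b p) < 1) natDegree halg
  refine ⟨aeval b p, hp, ?_⟩
  have hdeg : p.natDegree ≠ 0 := by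
    intro h0
    rw [eq_C_of_natDegree_eq_zero h0] at hp hp0
    rw [aeval_C, v.map_algebraMap_eq_one_of_le_one B hB (by simpa using hp0)] at hp
    exact lt_irrefl _ hp
  have hder : v (aeval b (derivative p)) = 1 := by
    refine le_antisymm (hB _ (by simpa using (aeval (⟨b, hb⟩ : B) (derivative p)).2)) ?_
    by_contra! hlt
    have := hmin ⟨?_, hlt⟩ (natDegree_derivative_lt hdeg).le
    · exact absurd this (not_le.2 (natDegree_derivative_lt hdeg))
    · exact fun h => hdeg (Polynomial.derivative_eq_zero.1 h)
  have h := D.map_aeval p b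
  rw [h, smul_eq_mul, map_mul, hder, one_mul]

/-- A derivation of `K` over `k` that is bounded for `v` on `B` and fixes an element `y` of
positive order is logarithmic for `v`. -/
theorem Derivation.valuation_le_and_eq [CharZero k] (hB : ∀ b ∈ B, v b ≤ 1)
    (hy0 : y ≠ 0) (hy : v y < 1)
    (hDy : D y = y)
    (hfrac : ∀ g, v g = 1 → ∃ b ∈ B, ∃ s ∈ B, v b = 1 ∧ v s = 1 ∧ g * s = b)
    (halg : ∀ b ∈ B, ∃ p : k[X], p ≠ 0 ∧ v (aeval b p) < 1)
    (hbdd : ∃ N : ℕ, ∀ b ∈ B, v (D b) ≤ exp (N : ℤ)) (g : K) :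
    v (D g) ≤ v g ∧ (v g ≠ 1 → v (D g) = v g) := by
  have hstep : ∀ M : WithZero (Multiplicative ℤ), 1 ≤ M → (∀ b ∈ B, v b = 1 → v (D b) ≤ M) →
      ∀ b ∈ B, v b = 1 → v (D b) ≤ exp (-1) * M := by
    intro M hM1 hM b hb hvb
    obtain ⟨u, hu, hbu⟩ := exists_valuation_eq_of_residue_algebraic (D := D) hB hb (halg b hb)
    rcases eq_or_ne u 0 with rfl | hu0
    · simp [hbu]
    rw [hbu]
    refine (valuation_le_of_unit_le hB hy0 hy hDy hfrac hM1 hM hu0 hu).trans ?_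
    gcongr
    have h0 : v u ≠ 0 := by simpa using hu0
    rw [← exp_log h0, ← exp_zero, exp_lt_exp] at hu
    rw [← exp_log h0, exp_le_exp]
    omega
  have hunit : ∀ N : ℕ, (∀ b ∈ B, v b = 1 → v (D b) ≤ exp (N : ℤ)) →
      ∀ b ∈ B, v b = 1 → v (D b) ≤ exp (-1) := by
    intro N
    induction N with
    | zero =>
      intro h b hb hvb
      simpa using hstep 1 le_rfl (by simpa using h) b hb hvb
    | succ N ih =>
      intro h
      refine ih fun b hb hvb => (hstep _ ?_ h b hb hvb).trans ?_
      · rw [← exp_zero, exp_le_exp]; omega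
      · rw [← exp_add, exp_le_exp]; push_cast; omega
  obtain ⟨N, hN⟩ := hbdd
  have hlt : ∀ b ∈ B, v b = 1 → v (D b / b) < 1 := by
    intro b hb hvb
    rw [map_div₀, hvb, div_one]
    refine (hunit N (fun b hb _ => hN b hb) b hb hvb).trans_lt ?_
    rw [← exp_zero, exp_lt_exp]; omega
  have hsmall : ∀ u : K, u ≠ 0 → v u < 1 → v (D u / u) = 1 := by
    intro u hu0 hu
    obtain ⟨e, i, he, hi, b, hb, s, hs, hvb, hvs, h⟩ :=
      v.exists_pow_mul_eq_pow_mul hy0 hy hfrac hu0 hu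
    have h1 := congrArg v (mul_div_eq_of_pow_mul_eq hDy hy0 hu0 hvb hvs h)
    rw [map_mul, v.map_natCast_eq_one_of_le_one B hB he, one_mul] at h1
    rw [h1, add_sub_assoc]
    have hi1 := v.map_natCast_eq_one_of_le_one B hB hi
    rw [v.map_add_eq_of_lt_left, hi1]
    rw [hi1]
    exact v.map_sub_lt (hlt b hb hvb) (hlt s hs hvs)
  rcases eq_or_ne g 0 with rfl | hg0
  · simp
  have hvg : 0 < v g := zero_lt_iff.2 (by simpa using hg0)
  rcases lt_trichotomy (v g) 1 with h | h | h
  · have h1 := hsmall g hg0 h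
    rw [map_div₀, div_eq_one_iff_eq hvg.ne'] at h1
    exact ⟨h1.le, fun _ => h1⟩
  · refine ⟨?_, fun h' => absurd h h'⟩
    obtain ⟨b, hb, s, hs, hvb, hvs, hgs⟩ := hfrac g h
    have hs0 : s ≠ 0 := by rintro rfl; simp at hvs
    have h1 := D.mul_div_mul hg0 hs0
    rw [hgs] at h1
    have h2 : D g / g = D b / b - D s / s := by linear_combination -h1
    have h3 := (v.map_sub_lt (hlt b hb hvb) (hlt s hs hvs)).le
    rwa [← h2, map_div₀, div_le_one₀ hvg] at h3
  · have h1 := hsmall g⁻¹ (inv_ne_zero hg0) (by rw [map_inv₀]; exact inv_lt_one_of_one_lt₀ h)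
    have h2 : D g⁻¹ / g⁻¹ = -(D g / g) := by
      rw [D.leibniz_inv, smul_eq_mul]; field_simp
    rw [h2, Valuation.map_neg, map_div₀, div_eq_one_iff_eq hvg.ne'] at h1
    exact ⟨h1.le, fun _ => h1⟩

end LogarithmicDerivation

end LogarithmicDerivations

section LogarithmicValuation

open Polynomial WithZero

theorem Derivation.exists_valuation_of_finiteDimensional {k : Type*} (F K : Type*)
    [Field k] [CharZero k] [Field F] [Algebra (PowerSeries k) F] [IsFractionRing (PowerSeries k) F]
    [Field K] [Algebra k K] [Algebra (PowerSeries k) K] [IsScalarTower k (PowerSeries k) K]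
    [Algebra F K] [IsScalarTower (PowerSeries k) F K] [FiniteDimensional F K] :
    ∃ (D : Derivation k K K) (v : Valuation K (WithZero (Multiplicative ℤ))),
      (∀ g, v (D g) ≤ v g ∧ (v g ≠ 1 → v (D g) = v g)) ∧
      v (algebraMap (PowerSeries k) K PowerSeries.X) < 1 ∧
      ∀ g, IsIntegral (PowerSeries k) g → v g ≤ 1 := by
  have hinj : Function.Injective (algebraMap (PowerSeries k) K) := by
    rw [IsScalarTower.algebraMap_eq (PowerSeries k) F K]
    exact (algebraMap F K).injective.comp (IsFractionRing.injective _ _)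
  have hfaith : FaithfulSMul (PowerSeries k) K := (faithfulSMul_iff_algebraMap_injective _ _).2 hinj
  have halgF : Algebra.IsAlgebraic F K := inferInstance
  have halgA : Algebra.IsAlgebraic (PowerSeries k) K :=
    (IsFractionRing.comap_isAlgebraic_iff (A := PowerSeries k) (K := F) (C := K)).2 halgF
  have hcharF : CharZero F := by
    have : CharZero (PowerSeries k) :=
      charZero_of_injective_algebraMap (algebraMap k (PowerSeries k)).injective
    exact charZero_of_injective_algebraMap (IsFractionRing.injective (PowerSeries k) F)
  obtain ⟨D, hD⟩ := Derivation.exists_extension_of_isAlgebraic (K := K)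
    ((PowerSeries.X : PowerSeries k) • PowerSeries.derivative k)
  let B := integralClosure (PowerSeries k) K
  have hded : IsDedekindDomain B := integralClosure.isDedekindDomain (PowerSeries k) F K
  have hfin : Module.Finite (PowerSeries k) B := IsIntegralClosure.finite (PowerSeries k) F K B
  have hfr : IsFractionRing B K := integralClosure.isFractionRing_of_finite_extension F K
  have hXp : (Ideal.span {(PowerSeries.X : PowerSeries k)}).IsPrime :=
    PowerSeries.span_X_isPrime
  obtain ⟨P, -, hPp, hPX⟩ := Ideal.exists_ideal_over_prime_of_isIntegral
    (S := B) (Ideal.span {(PowerSeries.X : PowerSeries k)}) ⊥ (by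
      intro x hx
      rw [Ideal.mem_comap, Ideal.mem_bot] at hx
      have : x = 0 := (FaithfulSMul.algebraMap_injective (PowerSeries k) B) (by simpa using hx)
      simp [this])
  have hXP : algebraMap (PowerSeries k) B PowerSeries.X ∈ P := by
    rw [← Ideal.mem_comap, hPX]; exact Ideal.mem_span_singleton_self _
  let w : IsDedekindDomain.HeightOneSpectrum B := ⟨P, hPp, fun h => by
    rw [h, Ideal.mem_bot] at hXP
    have := (FaithfulSMul.algebraMap_injective (PowerSeries k) B) (hXP.trans (map_zero _).symm)
    exact PowerSeries.X_ne_zero this⟩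
  let v := w.valuation K
  have hv1 : ∀ g, IsIntegral (PowerSeries k) g → v g ≤ 1 := fun g hg =>
    w.valuation_le_one (K := K) (⟨g, hg⟩ : B)
  have hvX : v (algebraMap (PowerSeries k) K PowerSeries.X) < 1 := by
    rw [IsScalarTower.algebraMap_apply (PowerSeries k) B K]
    exact (w.valuation_lt_one_iff_mem _).2 hXP
  have hA1 : ∀ a : PowerSeries k, v (algebraMap (PowerSeries k) K a) ≤ 1 := fun a =>
    hv1 _ isIntegral_algebraMap
  refine ⟨D, v, ?_, hvX, hv1⟩
  refine Derivation.valuation_le_and_eq (B := B.restrictScalars k)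
    (y := algebraMap (PowerSeries k) K PowerSeries.X) (fun b hb => hv1 b hb)
    ((map_ne_zero_iff _ hinj).2 PowerSeries.X_ne_zero) hvX (by simp [hD]) ?_ ?_ ?_
  · intro g hg
    obtain ⟨b, s, h⟩ := w.exists_primeCompl_mul_eq_of_integer g hg.le
    have hs : v (algebraMap B K s) = 1 := w.valuation_eq_one_iff_notMem.2 s.2
    refine ⟨b, b.2, (s : B), (s : B).2, ?_, hs, h⟩
    have h1 := congrArg v h
    rw [map_mul, hg, hs, one_mul] at h1
    exact h1.symm
  · intro b hb
    obtain ⟨q, hq, hqb⟩ := IsIntegralClosure.isIntegral (PowerSeries k) K (⟨b, hb⟩ : B)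
    refine ⟨q.map PowerSeries.constantCoeff, (hq.map _).ne_zero, ?_⟩
    have key : (Ideal.Quotient.mk P).comp (algebraMap (PowerSeries k) B) =
        (algebraMap k (B ⧸ P)).comp PowerSeries.constantCoeff := by
      ext a
      have h1 :
          algebraMap (PowerSeries k) B (a - PowerSeries.C (PowerSeries.constantCoeff a)) ∈ P := by
        obtain ⟨c, hc⟩ := PowerSeries.X_dvd_iff
          (φ := a - PowerSeries.C (PowerSeries.constantCoeff a))
          |>.2 (by simp)
        rw [hc, map_mul]
        exact P.mul_mem_right _ hXP
      rw [map_sub, ← Ideal.Quotient.eq_zero_iff_mem, map_sub, sub_eq_zero] at h1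
      rw [RingHom.comp_apply, RingHom.comp_apply, h1, IsScalarTower.algebraMap_apply k B (B ⧸ P),
        IsScalarTower.algebraMap_apply k (PowerSeries k) B]
      rfl
    have h2 : aeval (⟨b, hb⟩ : B) (q.map PowerSeries.constantCoeff) ∈ P := by
      rw [← Ideal.Quotient.eq_zero_iff_mem, ← Ideal.Quotient.mkₐ_eq_mk k,
        ← Polynomial.aeval_algHom_apply, aeval_def, eval₂_map, ← key, Ideal.Quotient.mkₐ_eq_mk,
        ← hom_eval₂, hqb, map_zero]
    have h3 := (w.valuation_lt_one_iff_mem (K := K) _).2 h2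
    have h4 := Polynomial.aeval_algHom_apply (B.val.restrictScalars k) ⟨b, hb⟩
      (q.map PowerSeries.constantCoeff)
    exact (congrArg v h4).trans_lt h3
  · obtain ⟨s, hs⟩ := hfin.fg_top
    obtain ⟨N, hN⟩ : ∃ N : ℕ, ∀ b ∈ s, v (D b) ≤ exp (N : ℤ) := by
      choose f hf using fun x : K => (show ∃ N : ℕ, v x ≤ exp (N : ℤ) by
        rcases eq_or_ne (v x) 0 with h | h
        · exact ⟨0, by simp [h]⟩
        · refine ⟨(log (v x)).toNat, ?_⟩
          rw [← exp_log h, exp_le_exp, log_exp]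
          exact Int.self_le_toNat _)
      refine ⟨s.sup fun b => f (D b), fun b hb => (hf _).trans ?_⟩
      rw [exp_le_exp]
      exact_mod_cast Finset.le_sup (f := fun b : B => f (D b)) hb
    refine ⟨N, fun b hb => ?_⟩
    have h1 : (1 : WithZero (Multiplicative ℤ)) ≤ exp (N : ℤ) := by
      rw [← exp_zero, exp_le_exp]; omega
    have hb' : (⟨b, hb⟩ : B) ∈ Submodule.span (PowerSeries k) (s : Set B) := hs ▸ Submodule.mem_top
    suffices ∀ x ∈ Submodule.span (PowerSeries k) (s : Set B), v (D (x : K)) ≤ exp (N : ℤ) from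
      this _ hb'
    intro x hx
    induction hx using Submodule.span_induction with
    | mem x hx => exact hN x hx
    | zero => simp
    | add x y _ _ hx hy =>
      rw [B.coe_add, map_add]
      exact v.map_add_le hx hy
    | smul a x _ hx =>
      rw [B.coe_smul, Algebra.smul_def, D.leibniz, hD, smul_eq_mul, smul_eq_mul]
      refine v.map_add_le ?_ ?_
      · rw [map_mul]
        exact (mul_le_of_le_one_left' (hA1 a)).trans hx
      · rw [map_mul]
        exact (mul_le_one' (hv1 _ x.2) (hA1 _)).trans h1

end LogarithmicValuation

theorem MvPowerSeries.exists_eq_C_add_sum_X_mul {σ k : Type*} [Fintype σ] [CommRing k]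
    (f : MvPowerSeries σ k) :
    ∃ g : σ → MvPowerSeries σ k,
      f = MvPowerSeries.C (MvPowerSeries.constantCoeff f) + ∑ i, MvPowerSeries.X i * g i := by
  classical
  rcases isEmpty_or_nonempty σ with _ | _
  · refine ⟨0, ?_⟩
    ext d
    simp [Subsingleton.elim d 0]
  have hex : ∀ d : σ →₀ ℕ, d ≠ 0 → ∃ i, d i ≠ 0 := fun d hd => by
    by_contra! h
    exact hd (Finsupp.ext h)
  choose! c hc using hex
  let g : σ → MvPowerSeries σ k := fun i d => if c (d + Finsupp.single i 1) = i then
    MvPowerSeries.coeff (d + Finsupp.single i 1) f else 0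
  have hg : ∀ i d, MvPowerSeries.coeff d (g i) = if c (d + Finsupp.single i 1) = i then
    MvPowerSeries.coeff (d + Finsupp.single i 1) f else 0 := fun i d => rfl
  refine ⟨g, ?_⟩
  ext d
  rw [map_add, map_sum]
  have h1 : ∀ i : σ, MvPowerSeries.coeff d (MvPowerSeries.X i * g i) =
      if Finsupp.single i 1 ≤ d then MvPowerSeries.coeff (d - Finsupp.single i 1) (g i) else 0 := by
    intro i
    rw [MvPowerSeries.X, MvPowerSeries.coeff_monomial_mul]
    simp
  simp_rw [h1, hg]
  rcases eq_or_ne d 0 with rfl | hd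
  · simp
  · rw [MvPowerSeries.coeff_C, if_neg hd, zero_add, Finset.sum_eq_single (c d)]
    · have h2 : Finsupp.single (c d) 1 ≤ d := by
        rw [Finsupp.single_le_iff]
        exact Nat.one_le_iff_ne_zero.2 (hc d hd)
      rw [if_pos h2, tsub_add_cancel_of_le h2, if_pos rfl]
    · intro i _ hi
      split_ifs with h2 h3
      · rw [tsub_add_cancel_of_le h2] at h3
        exact absurd h3 hi.symm
      · rfl
      · rfl
    · simp

theorem MvPowerSeries.exists_fg_forall_sub_mem_pow (σ k : Type*) [Finite σ] [CommRing k] (N : ℕ) :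
    ∃ W : Submodule k (MvPowerSeries σ k), W.FG ∧
      W ≤ Subalgebra.toSubmodule (Algebra.adjoin k (Set.range MvPowerSeries.X)) ∧
      ∀ f, ∃ w ∈ W, f - w ∈
        Ideal.span (Set.range (MvPowerSeries.X : σ → MvPowerSeries σ k)) ^ N := by
  have := Fintype.ofFinite σ
  induction N with
  | zero => exact ⟨⊥, Submodule.fg_bot, bot_le, fun f => ⟨0, Submodule.zero_mem _, by simp⟩⟩
  | succ N ih =>
    obtain ⟨W, hW, hWX, h⟩ := ih
    refine ⟨Submodule.span k {1} ⊔ ⨆ i, W.map (LinearMap.mulLeft k (MvPowerSeries.X i)),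
      ?_, ?_, ?_⟩
    · exact (Submodule.fg_span_singleton _).sup (Submodule.fg_iSup _ fun i => hW.map _)
    · refine sup_le ?_ (iSup_le fun i => ?_)
      · rw [Submodule.span_le, Set.singleton_subset_iff]
        exact one_mem (Algebra.adjoin k (Set.range MvPowerSeries.X))
      · rintro _ ⟨w, hw, rfl⟩
        exact Subalgebra.mul_mem _ (Algebra.subset_adjoin ⟨i, rfl⟩) (hWX hw)
    · intro f
      obtain ⟨g, hg⟩ := f.exists_eq_C_add_sum_X_mul
      choose w hw hgw using fun i => h (g i)
      refine ⟨MvPowerSeries.C (MvPowerSeries.constantCoeff f) + ∑ i, MvPowerSeries.X i * w i,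
        ?_, ?_⟩
      · refine add_mem (Submodule.mem_sup_left ?_) (Submodule.mem_sup_right ?_)
        · rw [Submodule.mem_span_singleton]
          exact ⟨_, (Algebra.algebraMap_eq_smul_one _).symm⟩
        · exact sum_mem fun i _ => Submodule.mem_iSup_of_mem i ⟨w i, hw i, rfl⟩
      · nth_rw 1 [hg]
        rw [add_sub_add_left_eq_sub, ← Finset.sum_sub_distrib]
        refine Ideal.sum_mem _ fun i _ => ?_
        rw [← mul_sub, pow_succ']
        exact Ideal.mul_mem_mul (Ideal.subset_span ⟨i, rfl⟩) (hgw i)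

/-- Nakayama's lemma over a complete base, for power series acting on a domain. -/
theorem PowerSeries.module_finite_of_forall_exists_add_mul {k C : Type*} [Field k] [CommRing C]
    [IsDomain C] [IsNoetherianRing C] [Algebra k C] [Algebra (PowerSeries k) C]
    [IsScalarTower k (PowerSeries k) C]
    (hX : ¬ IsUnit (algebraMap (PowerSeries k) C PowerSeries.X)) (W : Submodule k C) (hW : W.FG)
    (h : ∀ c : C, ∃ w ∈ W, ∃ c', c = w + algebraMap (PowerSeries k) C PowerSeries.X * c') :
    Module.Finite (PowerSeries k) C := by
  classical
  obtain ⟨s, rfl⟩ := hW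
  refine ⟨s, eq_top_iff.2 fun c _ => ?_⟩
  set z := algebraMap (PowerSeries k) C PowerSeries.X with hz
  have h' : ∀ c : C, ∃ (u : C → k) (c' : C), c = ∑ x ∈ s, u x • x + z * c' := by
    intro c
    obtain ⟨w, hw, c', hc⟩ := h c
    obtain ⟨u, -, rfl⟩ := Submodule.mem_span_finset.1 hw
    exact ⟨u, c', hc⟩
  choose u t hut using h'
  let a : C → PowerSeries k := fun x => PowerSeries.mk fun j => u (t^[j] c) x
  have hiter : ∀ J : ℕ, c = ∑ j ∈ Finset.range J, z ^ j * ∑ x ∈ s, u (t^[j] c) x • x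
      + z ^ J * t^[J] c := by
    intro J
    induction J with
    | zero => simp
    | succ J ih =>
      rw [Finset.sum_range_succ, Function.iterate_succ_apply']
      nth_rw 1 [ih, hut (t^[J] c)]
      ring
  have htr : ∀ J x, ∃ e, a x =
      ∑ j ∈ Finset.range J, PowerSeries.C (u (t^[j] c) x) * PowerSeries.X ^ j
      + PowerSeries.X ^ J * e := by
    intro J x
    have : PowerSeries.X ^ J ∣ a x -
        ∑ j ∈ Finset.range J, PowerSeries.C (u (t^[j] c) x) * PowerSeries.X ^ j := by
      rw [PowerSeries.X_pow_dvd_iff]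
      intro m hm
      simp [a, PowerSeries.coeff_X_pow, hm]
    obtain ⟨e, he⟩ := this
    exact ⟨e, by rw [← he]; ring⟩
  have hmem : c = ∑ x ∈ s, a x • x := by
    have hH : IsHausdorff (Ideal.span {z}) C := IsHausdorff.of_isDomain _ (by
      rwa [Ne, Ideal.span_singleton_eq_top])
    rw [← sub_eq_zero]
    refine hH.haus _ fun J => ?_
    rw [SModEq.zero, smul_eq_mul, Ideal.mul_top, Ideal.span_singleton_pow,
      Ideal.mem_span_singleton]
    choose e he using htr J
    refine ⟨t^[J] c - ∑ x ∈ s, algebraMap (PowerSeries k) C (e x) * x, ?_⟩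
    have h2 : ∀ x, a x • x = ∑ j ∈ Finset.range J, z ^ j * u (t^[j] c) x • x
        + z ^ J * (algebraMap (PowerSeries k) C (e x) * x) := by
      intro x
      rw [he x, add_smul, Finset.sum_smul, Algebra.smul_def _ x, map_mul, map_pow, ← hz, mul_assoc]
      congr 1
      refine Finset.sum_congr rfl fun j _ => ?_
      rw [Algebra.smul_def, map_mul, map_pow, ← hz, Algebra.smul_def,
        IsScalarTower.algebraMap_apply k (PowerSeries k) C]
      simp only [PowerSeries.algebraMap_apply, Algebra.algebraMap_self, RingHom.id_apply]
      ring
    simp_rw [h2]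
    rw [Finset.sum_add_distrib, Finset.sum_comm, ← Finset.mul_sum]
    nth_rw 1 [hiter J]
    simp_rw [← Finset.mul_sum]
    ring
  rw [hmem]
  exact Submodule.sum_mem _ fun x hx => Submodule.smul_mem _ _ (Submodule.subset_span hx)

/-- In a Noetherian local domain, an element lying in every nonzero prime ideal generates an ideal
primary to the maximal ideal. -/
theorem IsLocalRing.exists_maximalIdeal_pow_le_span {C : Type*} [CommRing C] [IsDomain C]
    [IsNoetherianRing C] [IsLocalRing C] {z : C} (hz0 : z ≠ 0)
    (hz : ∀ P : Ideal C, P.IsPrime → P ≠ ⊥ → z ∈ P) :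
    ∃ M : ℕ, maximalIdeal C ^ M ≤ Ideal.span {z} := by
  refine Ideal.exists_pow_le_of_le_radical_of_fg ?_ (IsNoetherian.noetherian _)
  by_contra hcon
  have hP : ∀ P ∈ (Ideal.span {z}).minimalPrimes, ¬ maximalIdeal C ≤ P := by
    intro P hP hle
    refine hcon ?_
    have hPm : P = maximalIdeal C := le_antisymm (le_maximalIdeal hP.1.1.ne_top) hle
    rw [Ideal.radical_eq_sInf]
    refine le_sInf ?_
    rintro Q ⟨hQz, hQ⟩
    have := hP.2 ⟨hQ, hQz⟩ (hPm ▸ le_maximalIdeal hQ.ne_top)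
    exact hle.trans this
  have hfin := Ideal.finite_minimalPrimes_of_isNoetherianRing C (Ideal.span {z})
  have hav := (Ideal.subset_union_prime_finite hfin (f := id) ⊤ ⊤
    (fun P hP _ _ => hP.1.1) (I := maximalIdeal C)).not.2 (by
      rintro ⟨P, hPm, hle⟩; exact hP P hPm hle)
  obtain ⟨y, hym, hy⟩ := Set.not_subset.1 hav
  simp only [id, Set.mem_iUnion, not_exists] at hy
  have hy0 : y ≠ 0 := by
    rintro rfl
    obtain ⟨P, hPm⟩ := (Ideal.span {z}).nonempty_minimalPrimes (by
      intro h
      refine hcon ?_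
      rw [h, Ideal.radical_top]; exact le_top)
    exact hy P hPm P.zero_mem
  obtain ⟨Q, hQ⟩ := (Ideal.span {y}).nonempty_minimalPrimes (by
    rw [Ne, Ideal.span_singleton_eq_top]; exact hym)
  have hQp := hQ.1.1
  have hyQ : y ∈ Q := hQ.1.2 (Ideal.mem_span_singleton_self y)
  have hzQ : z ∈ Q := hz Q hQp (by rintro rfl; exact hy0 (by simpa using hyQ))
  obtain ⟨P, hPm, hPQ⟩ := Ideal.exists_minimalPrimes_le
    ((Ideal.span_singleton_le_iff_mem Q).2 hzQ)
  have hPp := hPm.1.1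
  have hlt : P < Q := lt_of_le_of_ne hPQ (by rintro rfl; exact hy P hPm hyQ)
  have h0P : (⊥ : Ideal C) < P := bot_lt_iff_ne_bot.2 (by
    rintro rfl
    exact hz0 (by simpa using hPm.1.2 (Ideal.mem_span_singleton_self z)))
  have h1 := Ideal.height_add_one_le_of_lt_of_isPrime hlt
  have h2 := Ideal.height_add_one_le_of_lt_of_isPrime h0P
  have h3 := Ideal.height_le_one_of_isPrincipal_of_mem_minimalPrimes _ _ hQ
  rw [Ideal.height_bot, zero_add] at h2
  have h4 : (1 : ℕ∞) + 1 ≤ 1 := (add_le_add_left h2 1).trans (h1.trans h3)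
  exact absurd h4 (by decide)

section FormalRadical

open WithZero

theorem IsNoetherianRing.exists_isPrime_maximal_notMem {R : Type*} [CommRing R] [IsNoetherianRing R]
    {I : Ideal R} {Z : R} (hZ : Z ∉ I.radical) :
    ∃ q : Ideal R, q.IsPrime ∧ I ≤ q ∧ Z ∉ q ∧
      ∀ P : Ideal R, P.IsPrime → q < P → Z ∈ P := by
  have hne : {P : Ideal R | P.IsPrime ∧ I ≤ P ∧ Z ∉ P}.Nonempty := by
    by_contra hcon
    refine hZ ?_
    rw [Ideal.radical_eq_sInf, Submodule.mem_sInf]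
    rintro P ⟨hIP, hP⟩
    by_contra hZP
    exact hcon ⟨P, hP, hIP, hZP⟩
  obtain ⟨q, ⟨hq, hIq, hZq⟩, hmax⟩ := set_has_maximal_iff_noetherian.2 ‹_› _ hne
  refine ⟨q, hq, hIq, hZq, fun P hP hqP => ?_⟩
  by_contra hZP
  exact hmax P ⟨hP, hIq.trans hqP.le, hZP⟩ hqP

universe u₁ u₂

theorem MvPowerSeries.exists_valuation_of_notMem_radical {σ : Type u₁} {k : Type u₂} [Finite σ]
    [Field k] [CharZero k]
    {I : Ideal (MvPowerSeries σ k)} {Z : MvPowerSeries σ k}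
    (hZ0 : MvPowerSeries.constantCoeff Z = 0) (hZ : Z ∉ I.radical) :
    ∃ (K : Type (max u₁ u₂)) (_ : Field K) (_ : Algebra k K) (φ : MvPowerSeries σ k →ₐ[k] K)
      (D : Derivation k K K) (v : Valuation K (WithZero (Multiplicative ℤ))),
      (∀ r ∈ I, φ r = 0) ∧ φ Z ≠ 0 ∧ (∀ r, v (φ r) ≤ 1) ∧
      (∀ r, MvPowerSeries.constantCoeff r = 0 → v (φ r) < 1) ∧
      ∀ g, v (D g) ≤ v g ∧ (v g ≠ 1 → v (D g) = v g) := by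
  obtain ⟨q, hq, hIq, hZq, hmax⟩ := IsNoetherianRing.exists_isPrime_maximal_notMem hZ
  let mk := Ideal.Quotient.mkₐ k q
  have hmk : Function.Surjective mk := Ideal.Quotient.mkₐ_surjective k q
  have hmk0 : ∀ r, mk r = 0 ↔ r ∈ q := fun r => Ideal.Quotient.eq_zero_iff_mem
  have hloc : IsLocalRing (MvPowerSeries σ k ⧸ q) :=
    .of_surjective' (Ideal.Quotient.mk q) Ideal.Quotient.mk_surjective
  have hnu : ∀ r, MvPowerSeries.constantCoeff r = 0 → ¬ IsUnit (mk r) := by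
    intro r hr hu
    obtain ⟨c, hc⟩ := hu.exists_right_inv
    obtain ⟨c, rfl⟩ := hmk c
    rw [← map_mul, ← sub_eq_zero, ← map_one mk, ← map_sub, hmk0] at hc
    refine hq.ne_top (Ideal.eq_top_of_isUnit_mem _ hc ?_)
    rw [MvPowerSeries.isUnit_iff_constantCoeff]
    simp [hr]
  have hz0 : mk Z ≠ 0 := fun h => hZq ((hmk0 _).1 h)
  obtain ⟨M, hM⟩ := IsLocalRing.exists_maximalIdeal_pow_le_span hz0 (by
    intro P hP hP0
    refine hmax (P.comap mk) (hP.comap _) ?_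
    refine lt_of_le_of_ne (fun r hr => ?_) ?_
    · rw [Ideal.mem_comap, (hmk0 r).2 hr]; exact P.zero_mem
    · intro h
      refine hP0 (eq_bot_iff.2 fun c hc => ?_)
      obtain ⟨c, rfl⟩ := hmk c
      have : c ∈ q := by rw [h]; exact hc
      exact (hmk0 c).2 this)
  have hmem : ∀ r, MvPowerSeries.constantCoeff r = 0 →
      mk r ∈ IsLocalRing.maximalIdeal (MvPowerSeries σ k ⧸ q) := hnu
  have hsub := PowerSeries.HasSubst.of_constantCoeff_zero hZ0
  let ψ := mk.comp (PowerSeries.substAlgHom (R := k) hsub)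
  have hψX : ψ PowerSeries.X = mk Z := by
    simp only [ψ, AlgHom.comp_apply, PowerSeries.coe_substAlgHom, PowerSeries.subst_X hsub]
  let : Algebra (PowerSeries k) (MvPowerSeries σ k ⧸ q) := ψ.toRingHom.toAlgebra
  have htow : IsScalarTower k (PowerSeries k) (MvPowerSeries σ k ⧸ q) :=
    .of_algebraMap_eq fun c => (ψ.commutes c).symm
  have hX : algebraMap (PowerSeries k) (MvPowerSeries σ k ⧸ q) PowerSeries.X = mk Z := hψX
  have hfin : Module.Finite (PowerSeries k) (MvPowerSeries σ k ⧸ q) := by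
    obtain ⟨W, hW, -, h⟩ := MvPowerSeries.exists_fg_forall_sub_mem_pow σ k M
    refine PowerSeries.module_finite_of_forall_exists_add_mul (by rw [hX]; exact hnu Z hZ0)
      (W.map mk.toLinearMap) (hW.map _) fun c => ?_
    obtain ⟨c, rfl⟩ := hmk c
    obtain ⟨w, hw, hcw⟩ := h c
    have h1 : mk (c - w) ∈ Ideal.span {mk Z} := by
      refine hM ?_
      have h2 := Ideal.mem_map_of_mem mk hcw
      rw [Ideal.map_pow] at h2
      refine Ideal.pow_right_mono ?_ M h2
      rw [Ideal.map_span, Ideal.span_le]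
      rintro _ ⟨_, ⟨i, rfl⟩, rfl⟩
      exact hmem _ (MvPowerSeries.constantCoeff_X i)
    obtain ⟨c', hc'⟩ := Ideal.mem_span_singleton.1 h1
    refine ⟨mk w, ⟨w, hw, rfl⟩, c', ?_⟩
    rw [hX, ← hc', map_sub]; ring
  have hinj : Function.Injective (algebraMap (PowerSeries k) (MvPowerSeries σ k ⧸ q)) := by
    rw [injective_iff_map_eq_zero]
    intro a ha
    by_contra ha0
    rw [← PowerSeries.X_pow_order_mul_divXPowOrder (f := a), map_mul, map_pow, hX] at ha
    rcases mul_eq_zero.1 ha with h | h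
    · exact hz0 (eq_zero_of_pow_eq_zero h)
    · exact ((PowerSeries.isUnit_divided_by_X_pow_order ha0).map
        (algebraMap (PowerSeries k) (MvPowerSeries σ k ⧸ q))).ne_zero h
  have hfs : FaithfulSMul (PowerSeries k) (MvPowerSeries σ k ⧸ q) :=
    (faithfulSMul_iff_algebraMap_injective _ _).2 hinj
  let K := FractionRing (MvPowerSeries σ k ⧸ q)
  let : Algebra (FractionRing (PowerSeries k)) K := FractionRing.liftAlgebra (PowerSeries k) K
  obtain ⟨D, v, hDv, hvX, hv1⟩ := Derivation.exists_valuation_of_finiteDimensional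
    (k := k) (FractionRing (PowerSeries k)) K
  let φ : MvPowerSeries σ k →ₐ[k] K := (IsScalarTower.toAlgHom k (MvPowerSeries σ k ⧸ q) K).comp mk
  have hφ : ∀ r, φ r = algebraMap (MvPowerSeries σ k ⧸ q) K (mk r) := fun r => rfl
  have hle : ∀ r, v (φ r) ≤ 1 := fun r => by
    refine hv1 _ ?_
    rw [hφ]
    exact (Algebra.IsIntegral.isIntegral (R := PowerSeries k) (mk r)).algebraMap
  refine ⟨K, inferInstance, inferInstance, φ, D, v, ?_, ?_, hle, ?_, hDv⟩
  · intro r hr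
    rw [hφ, (hmk0 r).2 (hIq hr), map_zero]
  · rw [hφ]
    exact (map_ne_zero_iff _ (IsFractionRing.injective _ K)).2 hz0
  · intro r hr
    obtain ⟨c, hc⟩ := Ideal.mem_span_singleton.1 (hM (Ideal.pow_mem_pow (hmem r hr) M))
    obtain ⟨c, rfl⟩ := hmk c
    have h1 : φ r ^ M = φ Z * φ c := by
      rw [hφ, hφ, hφ, ← map_pow, hc, map_mul]
    rw [IsScalarTower.algebraMap_apply (PowerSeries k) (MvPowerSeries σ k ⧸ q) K, hX, ← hφ] at hvX
    have h2 : v (φ r) ^ M < 1 := by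
      rw [← map_pow, h1, map_mul]
      exact (mul_le_of_le_one_right' (hle c)).trans_lt hvX
    by_contra! h3
    exact absurd h2 (not_lt.2 (one_le_pow_of_one_le' h3 M))

theorem MvPowerSeries.derivation_apply_eq_sum_pderiv {σ k K : Type*} [Fintype σ] [Field k]
    [Field K] [Algebra k K] (φ : MvPowerSeries σ k →ₐ[k] K)
    (D : Derivation k K K) (v : Valuation K (WithZero (Multiplicative ℤ)))
    (hle : ∀ r, v (φ r) ≤ 1) (hlt : ∀ r, MvPowerSeries.constantCoeff r = 0 → v (φ r) < 1)
    (hD : ∀ g, v (D g) ≤ v g) (f : MvPowerSeries σ k) :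
    D (φ f) = ∑ i, φ (MvPowerSeries.pderiv k i f) * D (φ (MvPowerSeries.X i)) := by
  classical
  let E : MvPowerSeries σ k →ₗ[k] K := D.toLinearMap ∘ₗ φ.toLinearMap -
    ∑ i, (LinearMap.mulRight k (D (φ (MvPowerSeries.X i)))) ∘ₗ φ.toLinearMap ∘ₗ
      (MvPowerSeries.pderiv k i).toLinearMap
  have hE : ∀ r,
      E r = D (φ r) - ∑ i, φ (MvPowerSeries.pderiv k i r) * D (φ (MvPowerSeries.X i)) := by
    intro r
    simp [E]
  have hmul : ∀ r s, E (r * s) = φ r * E s + φ s * E r := by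
    intro r s
    simp only [hE, map_mul, Derivation.leibniz, smul_eq_mul, map_add, mul_sub, Finset.mul_sum,
      add_mul, Finset.sum_add_distrib]
    simp only [mul_assoc]
    ring
  have hadj : ∀ w ∈ Algebra.adjoin k (Set.range (MvPowerSeries.X : σ → MvPowerSeries σ k)),
      E w = 0 := by
    intro w hw
    induction hw using Algebra.adjoin_induction with
    | mem x hx =>
      obtain ⟨j, rfl⟩ := hx
      rw [hE, Finset.sum_eq_single j]
      · simp [MvPowerSeries.pderiv_X_self]
      · intro i _ hi
        rw [MvPowerSeries.pderiv_X_of_ne hi.symm]; simp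
      · simp
    | algebraMap r => simp [hE]
    | add x y _ _ hx hy => rw [map_add, hx, hy, add_zero]
    | mul x y _ _ hx hy => rw [hmul, hx, hy]; simp
  let m := Ideal.span (Set.range (MvPowerSeries.X : σ → MvPowerSeries σ k))
  have hexp : ∀ g, v g < 1 → v g ≤ exp (-1) := by
    intro g hg
    rcases eq_or_ne (v g) 0 with h0 | h0
    · simp [h0]
    rw [← exp_log h0, ← exp_zero, exp_lt_exp] at hg
    rw [← exp_log h0, exp_le_exp]
    omega
  have hm : ∀ r ∈ m, v (φ r) ≤ exp (-1) := by
    intro r hr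
    refine hexp _ (hlt r ?_)
    have : m ≤ RingHom.ker (MvPowerSeries.constantCoeff (σ := σ) (R := k)) := by
      rw [Ideal.span_le]
      rintro _ ⟨i, rfl⟩
      exact MvPowerSeries.constantCoeff_X i
    exact this hr
  have hE1 : ∀ r, v (E r) ≤ 1 := by
    intro r
    rw [hE]
    refine v.map_sub_le ((hD _).trans (hle _)) (v.map_sum_le fun i _ => ?_)
    rw [map_mul]
    exact mul_le_one' (hle _) ((hD _).trans (hle _))
  have hpow : ∀ N : ℕ, ∀ r ∈ m ^ N, v (φ r) ≤ exp (-(N : ℤ)) ∧ v (E r) ≤ exp (1 - (N : ℤ)) := by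
    intro N
    induction N with
    | zero =>
      intro r _
      refine ⟨by simpa using hle r, (hE1 r).trans ?_⟩
      rw [← exp_zero, exp_le_exp]; simp
    | succ N ih =>
      intro r hr
      rw [pow_succ] at hr
      induction hr using Submodule.mul_induction_on' with
      | mem_mul_mem r hr s hs =>
        constructor
        · rw [map_mul, map_mul]
          refine (mul_le_mul' (ih r hr).1 (hm s hs)).trans ?_
          rw [← exp_add, exp_le_exp]; push_cast; omega
        · rw [hmul]
          refine v.map_add_le ?_ ?_
          · rw [map_mul]
            refine (mul_le_mul' (ih r hr).1 (hE1 s)).trans ?_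
            rw [mul_one, exp_le_exp]; push_cast; omega
          · rw [map_mul]
            refine (mul_le_mul' (hm s hs) (ih r hr).2).trans ?_
            rw [← exp_add, exp_le_exp]; push_cast; omega
      | add x _ y _ hx hy =>
        rw [map_add φ, map_add E]
        exact ⟨v.map_add_le hx.1 hy.1, v.map_add_le hx.2 hy.2⟩
  have hEf : E f = 0 := by
    by_contra h0
    have h0 : v (E f) ≠ 0 := by simpa using h0
    obtain ⟨W, -, hWX, hW⟩ := MvPowerSeries.exists_fg_forall_sub_mem_pow σ k
      (2 + (-log (v (E f))).toNat)
    obtain ⟨w, hw, hfw⟩ := hW f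
    have h1 := (hpow _ _ hfw).2
    rw [map_sub, hadj w (hWX hw), sub_zero, ← exp_log h0, exp_le_exp, exp_log h0] at h1
    push_cast at h1
    omega
  rw [hE, sub_eq_zero] at hEf
  exact hEf

theorem MvPowerSeries.mul_mem_radical_of_mul_pderiv_eq {σ κ k : Type*} [Finite σ] [Fintype κ]
    [Field k] [CharZero k] {a₀ b₀ : MvPowerSeries σ k} {a b s : κ → MvPowerSeries σ k}
    (hb : MvPowerSeries.constantCoeff b₀ = 0) (hs : ∀ l, MvPowerSeries.constantCoeff (s l) = 0)
    (h : ∀ i, a₀ * MvPowerSeries.pderiv k i b₀ = ∑ l, a l * MvPowerSeries.pderiv k i (b l)) :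
    a₀ * b₀ ∈ (Ideal.span (Set.range fun l => a₀ * b₀ * s l - a l * b l)).radical := by
  have := Fintype.ofFinite σ
  by_contra hcon
  obtain ⟨K, _, _, φ, D, v, hI, hZ, hle, hlt, hD⟩ :=
    MvPowerSeries.exists_valuation_of_notMem_radical (by rw [map_mul, hb, mul_zero]) hcon
  have hch := MvPowerSeries.derivation_apply_eq_sum_pderiv φ D v hle hlt fun g => (hD g).1
  have h1 : φ a₀ * D (φ b₀) = ∑ l, φ (a l) * D (φ (b l)) := by
    have h0 : ∀ l ∈ Finset.univ, φ (a l) * D (φ (b l)) =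
        ∑ i, φ (a l) * (φ (MvPowerSeries.pderiv k i (b l)) * D (φ (MvPowerSeries.X i))) :=
      fun l _ => by rw [hch (b l), Finset.mul_sum]
    rw [hch b₀, Finset.sum_congr rfl h0, Finset.sum_comm, Finset.mul_sum]
    refine Finset.sum_congr rfl fun i _ => ?_
    rw [← mul_assoc, ← map_mul, h i, map_sum, Finset.sum_mul]
    exact Finset.sum_congr rfl fun l _ => by rw [map_mul, mul_assoc]
  have h2 : v (φ a₀ * D (φ b₀)) = v (φ (a₀ * b₀)) := by
    rw [map_mul, (hD _).2 (hlt _ hb).ne, ← map_mul, map_mul φ]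
  have hvZ : v (φ (a₀ * b₀)) ≠ 0 := (v.ne_zero_iff).2 hZ
  refine (lt_irrefl (v (φ (a₀ * b₀)))) ?_
  nth_rw 1 [← h2, h1]
  refine v.map_sum_lt hvZ fun l _ => ?_
  have h3 := hI _ (Ideal.subset_span ⟨l, rfl⟩)
  rw [map_sub, sub_eq_zero] at h3
  calc v (φ (a l) * D (φ (b l))) ≤ v (φ (a l) * φ (b l)) := by
        rw [map_mul, map_mul]; exact mul_le_mul_right (hD _).1 _
    _ = v (φ (a₀ * b₀)) * v (φ (s l)) := by rw [← map_mul φ, ← h3, map_mul φ, map_mul v]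
    _ < v (φ (a₀ * b₀)) * 1 := by
        exact mul_lt_mul_of_pos_left (hlt _ (hs l)) (zero_lt_iff.2 hvZ)
    _ = _ := mul_one _

end FormalRadical

section WeightedNorm

open scoped ENNReal

namespace MvPowerSeries

/-- The `ℓ¹` norm of a power series, in which the monomial `X ^ α` has norm `(ν α) ^ (-s)`. -/
noncomputable def wNorm {σ : Type*} (ν : (σ →₀ ℕ) → ℕ) (s : ℕ) (f : MvPowerSeries σ ℝ) : ℝ≥0∞ :=
  ∑' α, ‖coeff α f‖ₑ * ((ν α : ℝ≥0∞)⁻¹) ^ s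

section wNorm

variable {σ : Type*} {ν : (σ →₀ ℕ) → ℕ}

theorem wNorm_zero (s : ℕ) : wNorm ν s (0 : MvPowerSeries σ ℝ) = 0 := by
  simp [wNorm]

theorem wNorm_add_le (s : ℕ) (f g : MvPowerSeries σ ℝ) :
    wNorm ν s (f + g) ≤ wNorm ν s f + wNorm ν s g := by
  rw [wNorm, wNorm, wNorm, ← ENNReal.tsum_add]
  refine ENNReal.tsum_le_tsum fun α => ?_
  rw [map_add, ← add_mul]
  gcongr
  exact enorm_add_le _ _

theorem wNorm_sum_le {ι : Type*} (s : ℕ) (t : Finset ι) (f : ι → MvPowerSeries σ ℝ) :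
    wNorm ν s (∑ i ∈ t, f i) ≤ ∑ i ∈ t, wNorm ν s (f i) := by
  classical
  induction t using Finset.induction_on with
  | empty => simp [wNorm_zero]
  | insert a t ha ih =>
    rw [Finset.sum_insert ha, Finset.sum_insert ha]
    exact (wNorm_add_le _ _ _).trans (by gcongr)

theorem wNorm_neg (s : ℕ) (f : MvPowerSeries σ ℝ) : wNorm ν s (-f) = wNorm ν s f := by
  simp [wNorm]

theorem wNorm_anti (hpos : ∀ α, 0 < ν α) {s s' : ℕ} (h : s ≤ s') (f : MvPowerSeries σ ℝ) :
    wNorm ν s' f ≤ wNorm ν s f := by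
  refine ENNReal.tsum_le_tsum fun α => ?_
  have h1 : (ν α : ℝ≥0∞)⁻¹ ≤ 1 := by
    rw [ENNReal.inv_le_one]
    exact_mod_cast hpos α
  exact mul_le_mul_right (pow_le_pow_right_of_le_one' h1 h) _

theorem wNorm_mul_le (hν : ∀ α β, ν (α + β) = ν α * ν β) (s : ℕ)
    (f g : MvPowerSeries σ ℝ) : wNorm ν s (f * g) ≤ wNorm ν s f * wNorm ν s g := by
  classical
  let F : (σ →₀ ℕ) → ℝ≥0∞ := fun α => ‖coeff α f‖ₑ * ((ν α : ℝ≥0∞)⁻¹) ^ s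
  let G : (σ →₀ ℕ) → ℝ≥0∞ := fun α => ‖coeff α g‖ₑ * ((ν α : ℝ≥0∞)⁻¹) ^ s
  calc wNorm ν s (f * g)
      ≤ ∑' α, ∑ x ∈ Finset.HasAntidiagonal.antidiagonal α, F x.1 * G x.2 := by
        refine ENNReal.tsum_le_tsum fun α => ?_
        rw [coeff_mul]
        refine (mul_le_mul_left (enorm_sum_le _ _) _).trans ?_
        rw [Finset.sum_mul]
        refine Finset.sum_le_sum fun x hx => le_of_eq ?_
        rw [← Finset.HasAntidiagonal.mem_antidiagonal.1 hx, hν, enorm_mul, Nat.cast_mul,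
          ENNReal.mul_inv (Or.inr (ENNReal.natCast_ne_top _)) (Or.inl (ENNReal.natCast_ne_top _)),
          mul_pow]
        ring
    _ = ∑' α, ∑' x : Finset.HasAntidiagonal.antidiagonal α, F x.1.1 * G x.1.2 := by
        simp_rw [Finset.tsum_subtype (Finset.HasAntidiagonal.antidiagonal _)
          (fun x => F x.1 * G x.2)]
    _ = ∑' x : (σ →₀ ℕ) × (σ →₀ ℕ), F x.1 * G x.2 := by
        rw [← ENNReal.tsum_sigma' (fun x : (Σ α : σ →₀ ℕ, Finset.HasAntidiagonal.antidiagonal α) =>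
          F x.2.1.1 * G x.2.1.2)]
        exact (Finset.HasAntidiagonal.sigmaAntidiagonalEquivProd (A := σ →₀ ℕ)).tsum_eq
          (fun x => F x.1 * G x.2)
    _ = wNorm ν s f * wNorm ν s g := by
        rw [ENNReal.tsum_prod']
        simp_rw [ENNReal.tsum_mul_left, ENNReal.tsum_mul_right]
        rfl

theorem wNorm_monomial (s : ℕ) (β : σ →₀ ℕ) (c : ℝ) :
    wNorm ν s (monomial β c) = ‖c‖ₑ * ((ν β : ℝ≥0∞)⁻¹) ^ s := by
  classical
  rw [wNorm, tsum_eq_single β]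
  · rw [coeff_monomial_same]
  · intro α hα
    rw [coeff_monomial_ne hα]; simp

/-- The power series with finite `ℓ¹` norm for some choice of radii. -/
def convergent (ν : (σ →₀ ℕ) → ℕ) (hν : ∀ α β, ν (α + β) = ν α * ν β) (hpos : ∀ α, 0 < ν α) :
    Subalgebra ℝ (MvPowerSeries σ ℝ) where
  carrier := {f | ∃ s, wNorm ν s f ≠ ∞}
  mul_mem' := by
    rintro f g ⟨s, hs⟩ ⟨s', hs'⟩
    refine ⟨max s s', ne_top_of_le_ne_top (ENNReal.mul_ne_top ?_ ?_) (wNorm_mul_le hν _ f g)⟩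
    · exact ne_top_of_le_ne_top hs (wNorm_anti hpos (le_max_left _ _) f)
    · exact ne_top_of_le_ne_top hs' (wNorm_anti hpos (le_max_right _ _) g)
  add_mem' := by
    rintro f g ⟨s, hs⟩ ⟨s', hs'⟩
    refine ⟨max s s', ne_top_of_le_ne_top (ENNReal.add_ne_top.2 ⟨?_, ?_⟩) (wNorm_add_le _ f g)⟩
    · exact ne_top_of_le_ne_top hs (wNorm_anti hpos (le_max_left _ _) f)
    · exact ne_top_of_le_ne_top hs' (wNorm_anti hpos (le_max_right _ _) g)
  algebraMap_mem' c := by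
    refine ⟨0, ?_⟩
    have : algebraMap ℝ (MvPowerSeries σ ℝ) c = monomial 0 c := rfl
    rw [this, wNorm_monomial]
    simp

theorem monomial_mem_convergent (hν : ∀ α β, ν (α + β) = ν α * ν β) (hpos : ∀ α, 0 < ν α)
    (β : σ →₀ ℕ) (c : ℝ) : monomial β c ∈ convergent ν hν hpos := by
  refine ⟨0, ?_⟩
  rw [wNorm_monomial]
  simp

theorem wNorm_shift_le (hν : ∀ α β, ν (α + β) = ν α * ν β) (s : ℕ) (α : σ →₀ ℕ)
    {f g : MvPowerSeries σ ℝ} (h : ∀ δ, coeff δ g = coeff (δ + α) f ∨ coeff δ g = 0) :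
    wNorm ν s g * ((ν α : ℝ≥0∞)⁻¹) ^ s ≤ wNorm ν s f := by
  rw [wNorm, ← ENNReal.tsum_mul_right]
  refine le_trans (ENNReal.tsum_le_tsum fun δ => ?_)
    (ENNReal.tsum_comp_le_tsum_of_injective (add_left_injective α)
      (fun β => ‖coeff β f‖ₑ * ((ν β : ℝ≥0∞)⁻¹) ^ s))
  rcases h δ with h | h
  · rw [h, hν, Nat.cast_mul, ENNReal.mul_inv (Or.inr (ENNReal.natCast_ne_top _))
      (Or.inl (ENNReal.natCast_ne_top _)), mul_pow, mul_assoc]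
  · simp [h]

/-- If every exponent of `e` comes strictly after `α`, then the norm of `e` becomes negligible
with respect to that of `X ^ α` as the radii shrink. -/
theorem exists_forall_wNorm_le (hpos : ∀ α, 0 < ν α) {e : MvPowerSeries σ ℝ} {α : σ →₀ ℕ}
    (he : ∀ β, coeff β e ≠ 0 → ν α < ν β) {s₀ : ℕ} (hs₀ : wNorm ν s₀ e ≠ ∞) {ε : ℝ≥0∞}
    (hε : ε ≠ 0) : ∃ s₁, ∀ s ≥ s₁, wNorm ν s e ≤ ε * ((ν α : ℝ≥0∞)⁻¹) ^ s := by
  have hα0 : (ν α : ℝ≥0∞) ≠ 0 := by exact_mod_cast (hpos α).ne'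
  have hαt : (ν α : ℝ≥0∞) ≠ ∞ := ENNReal.natCast_ne_top _
  have hb : ∀ j, wNorm ν (s₀ + j) e ≤ wNorm ν s₀ e * (((ν α + 1 : ℕ) : ℝ≥0∞)⁻¹) ^ j := by
    intro j
    rw [wNorm, wNorm, ← ENNReal.tsum_mul_right]
    refine ENNReal.tsum_le_tsum fun β => ?_
    by_cases hβ : coeff β e = 0
    · simp [hβ]
    · rw [pow_add, ← mul_assoc]
      gcongr
      exact he β hβ
  have hr : ((ν α : ℝ≥0∞) * ((ν α + 1 : ℕ) : ℝ≥0∞)⁻¹) < 1 := by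
    rw [← div_eq_mul_inv, ENNReal.div_lt_iff (by simp) (by simp), one_mul]
    exact_mod_cast Nat.lt_succ_self _
  have ht := ENNReal.Tendsto.const_mul (a := wNorm ν s₀ e * (ν α : ℝ≥0∞) ^ s₀)
    (ENNReal.tendsto_pow_atTop_nhds_zero_of_lt_one hr)
    (Or.inr (ENNReal.mul_ne_top hs₀ (ENNReal.pow_ne_top hαt)))
  rw [mul_zero] at ht
  obtain ⟨j₁, hj₁⟩ := Filter.eventually_atTop.1 (ht.eventually_le_const (pos_iff_ne_zero.2 hε))
  refine ⟨s₀ + j₁, fun s hs => ?_⟩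
  obtain ⟨j, rfl⟩ := Nat.exists_eq_add_of_le ((Nat.le_add_right _ _).trans hs)
  have h1 := hj₁ j (by omega)
  refine (hb j).trans ?_
  calc wNorm ν s₀ e * (((ν α + 1 : ℕ) : ℝ≥0∞)⁻¹) ^ j
      = (wNorm ν s₀ e * (ν α : ℝ≥0∞) ^ s₀ * ((ν α : ℝ≥0∞) * ((ν α + 1 : ℕ) : ℝ≥0∞)⁻¹) ^ j) *
          ((ν α : ℝ≥0∞)⁻¹) ^ (s₀ + j) := by
        have h2 : ∀ i : ℕ, (ν α : ℝ≥0∞) ^ i * ((ν α : ℝ≥0∞)⁻¹) ^ i = 1 := fun i => by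
          rw [← mul_pow, ENNReal.mul_inv_cancel hα0 hαt, one_pow]
        rw [mul_pow, pow_add]
        calc _ = wNorm ν s₀ e * (((ν α + 1 : ℕ) : ℝ≥0∞)⁻¹) ^ j *
              ((ν α : ℝ≥0∞) ^ s₀ * ((ν α : ℝ≥0∞)⁻¹) ^ s₀) *
              ((ν α : ℝ≥0∞) ^ j * ((ν α : ℝ≥0∞)⁻¹) ^ j) := by rw [h2, h2, mul_one, mul_one]
          _ = _ := by ring
    _ ≤ _ := by gcongr

end wNorm

end MvPowerSeries

end WeightedNorm

section WeightedDivision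

open scoped ENNReal

namespace MvPowerSeries

section Division

variable {σ : Type*} {ν : (σ →₀ ℕ) → ℕ}

theorem exists_hasSum_coeff_of_tsum_wNorm {s : ℕ}
    {u : ℕ → MvPowerSeries σ ℝ} (hu : ∑' n, wNorm ν s (u n) ≠ ∞) :
    ∃ U : MvPowerSeries σ ℝ, wNorm ν s U ≠ ∞ ∧
      ∀ β, HasSum (fun n => coeff β (u n)) (coeff β U) := by
  have hW : ∀ β, ((ν β : ℝ≥0∞)⁻¹) ^ s ≠ 0 := fun β =>
    pow_ne_zero _ (ENNReal.inv_ne_zero.2 (ENNReal.natCast_ne_top _))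
  have hle : ∀ β, (∑' n, ‖coeff β (u n)‖ₑ) * ((ν β : ℝ≥0∞)⁻¹) ^ s ≤ ∑' n, wNorm ν s (u n) :=
    fun β => by
      rw [← ENNReal.tsum_mul_right]
      exact ENNReal.tsum_le_tsum fun n =>
        ENNReal.le_tsum (f := fun α => ‖coeff α (u n)‖ₑ * ((ν α : ℝ≥0∞)⁻¹) ^ s) β
  have hfin : ∀ β, ∑' n, ‖coeff β (u n)‖ₑ ≠ ∞ := fun β h => by
    refine hu (top_le_iff.1 ((hle β).trans' ?_))
    rw [h, ENNReal.top_mul (hW β)]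
  have hsum : ∀ β, Summable fun n => coeff β (u n) := fun β =>
    Summable.of_enorm (hfin β)
  refine ⟨fun β => ∑' n, coeff β (u n), ne_top_of_le_ne_top hu ?_, fun β => (hsum β).hasSum⟩
  calc ∑' β, ‖∑' n, coeff β (u n)‖ₑ * ((ν β : ℝ≥0∞)⁻¹) ^ s
      ≤ ∑' β, ∑' n, ‖coeff β (u n)‖ₑ * ((ν β : ℝ≥0∞)⁻¹) ^ s := by
        refine ENNReal.tsum_le_tsum fun β => ?_
        rw [ENNReal.tsum_mul_right]
        gcongr
        exact enorm_tsum_le_tsum_enorm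
    _ = ∑' n, wNorm ν s (u n) := ENNReal.tsum_comm

open scoped Classical in
/-- Division of a convergent power series by perturbed monomials. -/
theorem exists_eq_sum_mul_monomial_add (hν : ∀ α β, ν (α + β) = ν α * ν β)
    {s : ℕ} {E : Set (σ →₀ ℕ)} {F : Finset (σ →₀ ℕ)}
    (hF : ∀ β ∈ E, ∃ α ∈ F, α ≤ β) {e : (σ →₀ ℕ) → MvPowerSeries σ ℝ} {ε : ℝ≥0∞}
    (he : ∀ α ∈ F, wNorm ν s (e α) ≤ ε * ((ν α : ℝ≥0∞)⁻¹) ^ s) (hε : F.card * ε ≤ 2⁻¹)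
    {h : MvPowerSeries σ ℝ} (hh : wNorm ν s h ≠ ∞) :
    ∃ (q : (σ →₀ ℕ) → MvPowerSeries σ ℝ) (r : MvPowerSeries σ ℝ),
      (∀ α ∈ F, wNorm ν s (q α) ≠ ∞) ∧ (∀ β ∈ E, coeff β r = 0) ∧
        h = ∑ α ∈ F, q α * (monomial α 1 + e α) + r := by
  choose! c hcF hc using hF
  let Q : (σ →₀ ℕ) → MvPowerSeries σ ℝ → MvPowerSeries σ ℝ := fun α u δ =>
    if δ + α ∈ E ∧ c (δ + α) = α then coeff (δ + α) u else 0
  have hQ : ∀ α u δ, coeff δ (Q α u) =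
      if δ + α ∈ E ∧ c (δ + α) = α then coeff (δ + α) u else 0 := fun _ _ _ => rfl
  have hQW : ∀ α u, wNorm ν s (Q α u) * ((ν α : ℝ≥0∞)⁻¹) ^ s ≤ wNorm ν s u := fun α u =>
    wNorm_shift_le hν s α fun δ => by
      rw [hQ]
      split_ifs
      exacts [Or.inl rfl, Or.inr rfl]
  let S : MvPowerSeries σ ℝ → MvPowerSeries σ ℝ := fun u => -∑ α ∈ F, Q α u * e α
  have hS : ∀ u, wNorm ν s (S u) ≤ 2⁻¹ * wNorm ν s u := fun u => by
    calc wNorm ν s (S u) ≤ ∑ α ∈ F, wNorm ν s (Q α u * e α) := by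
          rw [wNorm_neg]
          exact wNorm_sum_le _ _ _
      _ ≤ ∑ α ∈ F, ε * wNorm ν s u := by
          refine Finset.sum_le_sum fun α hα => (wNorm_mul_le hν s _ _).trans ?_
          calc wNorm ν s (Q α u) * wNorm ν s (e α)
              ≤ wNorm ν s (Q α u) * (ε * ((ν α : ℝ≥0∞)⁻¹) ^ s) := by gcongr; exact he α hα
            _ = ε * (wNorm ν s (Q α u) * ((ν α : ℝ≥0∞)⁻¹) ^ s) := by ring
            _ ≤ _ := by gcongr; exact hQW α u
      _ = (F.card * ε) * wNorm ν s u := by rw [Finset.sum_const, nsmul_eq_mul, mul_assoc]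
      _ ≤ _ := by gcongr
  have hu : ∀ n : ℕ, wNorm ν s (S^[n] h) ≤ 2⁻¹ ^ n * wNorm ν s h := fun n => by
    induction n with
    | zero => simp
    | succ n ih =>
      rw [Function.iterate_succ_apply']
      calc _ ≤ 2⁻¹ * (2⁻¹ ^ n * wNorm ν s h) := (hS _).trans (by gcongr)
        _ = _ := by ring
  have hsum : ∑' n, wNorm ν s (S^[n] h) ≠ ∞ := by
    refine ne_top_of_le_ne_top ?_ (ENNReal.tsum_le_tsum hu)
    rw [ENNReal.tsum_mul_right, ENNReal.tsum_geometric, ENNReal.one_sub_inv_two, inv_inv]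
    exact ENNReal.mul_ne_top (by simp) hh
  obtain ⟨U, hU, hUc⟩ := exists_hasSum_coeff_of_tsum_wNorm hsum
  have hSc : ∀ u γ, coeff γ (S u) = -∑ α ∈ F, ∑ x ∈ Finset.HasAntidiagonal.antidiagonal γ,
      coeff x.1 (Q α u) * coeff x.2 (e α) := fun u γ => by
    simp only [S, map_neg, map_sum, coeff_mul]
  have hQs : ∀ α δ, HasSum (fun n => coeff δ (Q α (S^[n] h))) (coeff δ (Q α U)) := fun α δ => by
    simp only [hQ]
    split_ifs
    exacts [hUc _, hasSum_zero]
  have hSU : U = h + S U := by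
    ext γ
    have h1 : HasSum (fun n => coeff γ (S (S^[n] h))) (coeff γ (S U)) := by
      simp only [hSc]
      exact (hasSum_sum fun α _ => hasSum_sum fun x _ => (hQs α x.1).mul_right _).neg
    have h2 := (hasSum_nat_add_iff' 1).2 (hUc γ)
    simp only [Function.iterate_succ_apply'] at h2
    rw [map_add, h1.unique h2, Finset.sum_range_one, Function.iterate_zero_apply,
      add_sub_cancel]
  obtain ⟨r, hr⟩ : ∃ r : MvPowerSeries σ ℝ, ∀ β, coeff β r = if β ∈ E then 0 else coeff β U :=
    ⟨fun β => if β ∈ E then 0 else coeff β U, fun _ => rfl⟩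
  have hdec : U = ∑ α ∈ F, Q α U * monomial α 1 + r := by
    ext β
    have h1 : ∀ α, coeff β (Q α U * monomial α 1) =
        if β ∈ E ∧ c β = α then coeff β U else 0 := fun α => by
      rw [coeff_mul_monomial]
      split_ifs with h2 h3 h3
      · rw [hQ, tsub_add_cancel_of_le h2, if_pos h3, mul_one]
      · rw [hQ, tsub_add_cancel_of_le h2, if_neg h3, zero_mul]
      · exact absurd (h3.2 ▸ hc β h3.1) h2
      · rfl
    rw [map_add, map_sum]
    simp_rw [h1, hr]
    by_cases hβ : β ∈ E
    · simp [hβ, hcF β hβ]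
    · simp [hβ]
  refine ⟨fun α => Q α U, r, fun α _ hα => ?_, fun β hβ => (hr β).trans (if_pos hβ), ?_⟩
  · have := hQW α U
    rw [hα, ENNReal.top_mul (pow_ne_zero _ (ENNReal.inv_ne_zero.2 (ENNReal.natCast_ne_top _))),
      top_le_iff] at this
    exact hU this
  · have h1 : h = U - S U := by rw [eq_sub_iff_add_eq, ← hSU]
    rw [h1]
    nth_rw 1 [hdec]
    simp only [S, mul_add, Finset.sum_add_distrib]
    ring

end Division

end MvPowerSeries

end WeightedDivision

section ConvergentSeries

open scoped ENNReal

namespace MvPowerSeries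

section Descent

variable {σ : Type*} {ν : (σ →₀ ℕ) → ℕ}

theorem exists_forall_le_of_ne_zero (ν : (σ →₀ ℕ) → ℕ) {f : MvPowerSeries σ ℝ} (hf : f ≠ 0) :
    ∃ α, coeff α f ≠ 0 ∧ ∀ β, coeff β f ≠ 0 → ν α ≤ ν β := by
  obtain ⟨β, hβ⟩ := (MvPowerSeries.ne_zero_iff_exists_coeff_ne_zero f).1 hf
  obtain ⟨α, hα, hmin⟩ := (InvImage.wf ν wellFounded_lt).has_min {α | coeff α f ≠ 0} ⟨β, hβ⟩
  exact ⟨α, hα, fun β hβ => not_lt.1 (hmin β hβ)⟩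

/-- A convergent power series lying in the ideal generated by finitely many convergent power series
in the ring of formal power series is a combination of them with convergent coefficients. -/
theorem mem_span_convergent [Finite σ] {ι : Type*} [Fintype ι]
    (hν : ∀ α β, ν (α + β) = ν α * ν β) (hpos : ∀ α, 0 < ν α) (hinj : Function.Injective ν)
    {g : ι → MvPowerSeries σ ℝ} (hg : ∀ i, g i ∈ convergent ν hν hpos) {h : MvPowerSeries σ ℝ}
    (hh : h ∈ convergent ν hν hpos) (hmem : h ∈ Ideal.span (Set.range g)) :
    h ∈ Submodule.span (convergent ν hν hpos) (Set.range g) := by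
  classical
  set 𝔞 := Submodule.span (convergent ν hν hpos) (Set.range g) with h𝔞
  have h𝔞c : ∀ f ∈ 𝔞, f ∈ convergent ν hν hpos := fun f hf => by
    induction hf using Submodule.span_induction with
    | mem f hf => obtain ⟨i, rfl⟩ := hf; exact hg i
    | zero => exact zero_mem _
    | add f g _ _ hf hg => exact add_mem hf hg
    | smul c f _ hf => exact mul_mem c.2 hf
  have h𝔞I : ∀ f ∈ 𝔞, f ∈ Ideal.span (Set.range g) := fun f hf => by
    induction hf using Submodule.span_induction with
    | mem f hf => exact Ideal.subset_span hf
    | zero => exact zero_mem _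
    | add f g _ _ hf hg => exact add_mem hf hg
    | smul c f _ hf => exact Ideal.mul_mem_left _ _ hf
  have hsmul : ∀ f ∈ 𝔞, ∀ q ∈ convergent ν hν hpos, q * f ∈ 𝔞 := fun f hf q hq =>
    𝔞.smul_mem (⟨q, hq⟩ : convergent ν hν hpos) hf
  let E : Set (σ →₀ ℕ) := {α | ∃ f ∈ 𝔞, coeff α f ≠ 0 ∧ ∀ β, coeff β f ≠ 0 → ν α ≤ ν β}
  have hE : E.IsPWO := Set.isPWO_of_wellQuasiOrderedLE E
  have hFfin : {α | Minimal (· ∈ E) α}.Finite :=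
    (setOfPred_minimal_antichain _).finite_of_partiallyWellOrderedOn
      (hE.mono (setOfPred_minimal_subset _))
  let F : Finset (σ →₀ ℕ) := hFfin.toFinset
  have hF : ∀ β ∈ E, ∃ α ∈ F, α ≤ β := fun β hβ => by
    obtain ⟨α, hα, hα'⟩ := hE.exists_le_minimal hβ
    exact ⟨α, hFfin.mem_toFinset.2 hα', hα⟩
  have hFE : ∀ α ∈ F, ∃ f ∈ 𝔞, ∀ β, coeff β (f - monomial α 1) ≠ 0 → ν α < ν β := fun α hα => by
    obtain ⟨f, hf, hfα, hmin⟩ := ((hFfin.mem_toFinset.1 hα : Minimal (· ∈ E) α)).1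
    refine ⟨monomial 0 (coeff α f)⁻¹ * f,
      hsmul _ hf _ (monomial_mem_convergent hν hpos 0 _), fun β hβ => ?_⟩
    rw [map_sub, ← zero_add β, coeff_add_monomial_mul, zero_add] at hβ
    rcases eq_or_ne β α with rfl | hβα
    · simp [inv_mul_cancel₀ hfα] at hβ
    · rw [coeff_monomial_ne hβα, sub_zero] at hβ
      exact (hmin β (right_ne_zero_of_mul hβ)).lt_of_ne (hinj.ne hβα.symm)
  choose! f hf𝔞 hf using hFE
  let ε : ℝ≥0∞ := 2⁻¹ * (F.card : ℝ≥0∞)⁻¹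
  have hε0 : ε ≠ 0 := mul_ne_zero (by simp) (by simp)
  have hε : F.card * ε ≤ 2⁻¹ := by
    rw [mul_left_comm]
    exact mul_le_of_le_one_right' (ENNReal.mul_inv_le_one _)
  have hs : ∀ α ∈ F, ∃ s₁, ∀ s ≥ s₁,
      wNorm ν s (f α - monomial α 1) ≤ ε * ((ν α : ℝ≥0∞)⁻¹) ^ s := fun α hα => by
    obtain ⟨s₀, hs₀⟩ := sub_mem (h𝔞c _ (hf𝔞 α hα)) (monomial_mem_convergent hν hpos α 1)
    exact exists_forall_wNorm_le hpos (hf α hα) hs₀ hε0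
  choose! s₁ hs₁ using hs
  obtain ⟨s₀, hs₀⟩ := hh
  let s := max s₀ (F.sup s₁)
  obtain ⟨q, r, hq, hr, hqr⟩ := exists_eq_sum_mul_monomial_add hν (s := s) hF
    (e := fun α => f α - monomial α 1)
    (fun α hα => hs₁ α hα s ((Finset.le_sup hα).trans (le_max_right _ _))) hε
    (ne_top_of_le_ne_top hs₀ (wNorm_anti hpos (le_max_left _ _) h))
  simp only [add_sub_cancel] at hqr
  have hsum : ∑ α ∈ F, q α * f α ∈ 𝔞 :=
    sum_mem fun α hα => hsmul _ (hf𝔞 α hα) _ ⟨s, hq α hα⟩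
  suffices h0 : r = 0 by rw [hqr, h0, add_zero]; exact hsum
  by_contra hr0
  obtain ⟨γ, hγ, hmin⟩ := exists_forall_le_of_ne_zero ν hr0
  have hrI : r ∈ Ideal.span (Set.range g) := by
    rw [← sub_eq_iff_eq_add'.2 hqr]
    exact sub_mem hmem (h𝔞I _ hsum)
  obtain ⟨a, ha⟩ := Ideal.mem_span_range_iff_exists_fun.1 hrI
  have hT : {β | ν β ≤ ν γ}.Finite := (Set.finite_Iic (ν γ)).preimage hinj.injOn
  let a' : ι → MvPowerSeries σ ℝ := fun i => ∑ β ∈ hT.toFinset, monomial β (coeff β (a i))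
  have ha' : ∀ i β, ν β ≤ ν γ → coeff β (a' i) = coeff β (a i) := fun i β hβ => by
    simp only [a', map_sum, coeff_monomial]
    rw [Finset.sum_ite_eq, if_pos (by simpa using hβ)]
  have hr' : ∑ i, a' i * g i ∈ 𝔞 := sum_mem fun i _ =>
    hsmul _ (Submodule.subset_span ⟨i, rfl⟩) _
      (sum_mem fun β _ => monomial_mem_convergent hν hpos β _)
  have hcoeff : ∀ β, ν β ≤ ν γ → coeff β (∑ i, a' i * g i) = coeff β r := fun β hβ => by
    rw [← ha]
    simp only [map_sum, coeff_mul]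
    refine Finset.sum_congr rfl fun i _ => Finset.sum_congr rfl fun x hx => ?_
    rw [ha']
    refine le_trans ?_ hβ
    rw [← Finset.HasAntidiagonal.mem_antidiagonal.1 hx, hν]
    exact Nat.le_mul_of_pos_right _ (hpos _)
  refine hγ (hr γ ⟨_, hr', by rwa [hcoeff γ le_rfl], fun β hβ => ?_⟩)
  by_contra! hlt
  rw [hcoeff β hlt.le] at hβ
  exact hlt.not_ge (hmin β hβ)

end Descent

end MvPowerSeries

end ConvergentSeries

section SumOfSeries

open scoped ENNReal Topology

namespace MvPowerSeries

section Evaluation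

variable {σ : Type*} [Fintype σ]

/-- The multiplicative weight of exponents determined by the weights of the variables. -/
def expWeight (p : σ → ℕ) (α : σ →₀ ℕ) : ℕ := ∏ i, p i ^ α i

variable {p : σ → ℕ}

theorem expWeight_add (α β : σ →₀ ℕ) :
    expWeight p (α + β) = expWeight p α * expWeight p β := by
  simp [expWeight, pow_add, Finset.prod_mul_distrib]

theorem expWeight_pos (hp : ∀ i, (p i).Prime) (α : σ →₀ ℕ) : 0 < expWeight p α :=
  Finset.prod_pos fun i _ => pow_pos (hp i).pos _

theorem expWeight_single (i : σ) : expWeight p (Finsupp.single i 1) = p i := by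
  classical
  simp [expWeight, Finsupp.single_apply, Finset.prod_ite_eq]

theorem expWeight_injective (hp : ∀ i, (p i).Prime) (hinj : Function.Injective p) :
    Function.Injective (expWeight p) := by
  have h : ∀ α, expWeight p α = (α.mapDomain p).prod fun x k => x ^ k := fun α => by
    rw [Finsupp.prod_mapDomain_index_inj hinj, Finsupp.prod_fintype _ _ fun i => pow_zero _]
    rfl
  have hs : ∀ α : σ →₀ ℕ, ∀ x ∈ (α.mapDomain p).support, x.Prime := fun α x hx => by
    classical
    obtain ⟨i, -, rfl⟩ := Finset.mem_image.1 (Finsupp.mapDomain_support hx)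
    exact hp i
  intro α β hαβ
  apply Finsupp.mapDomain_injective hinj
  rw [← Nat.prod_pow_factorization_eq_self (hs α), ← Nat.prod_pow_factorization_eq_self (hs β),
    ← h, ← h, hαβ]

theorem lt_expWeight (hp : ∀ i, (p i).Prime) (i : σ) (α : σ →₀ ℕ) : α i < expWeight p α :=
  calc α i < p i ^ α i := Nat.lt_pow_self (hp i).one_lt
    _ ≤ expWeight p α := Nat.le_of_dvd (expWeight_pos hp α)
      (Finset.dvd_prod_of_mem (fun i => p i ^ α i) (Finset.mem_univ i))

/-- The value at `x` of the sum of a power series in finitely many variables. -/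
noncomputable def sumAt (x : σ → ℝ) (f : MvPowerSeries σ ℝ) : ℝ :=
  ∑' α, coeff α f * ∏ i, x i ^ α i

/-- The polydisc on which the power series with finite norm of index `s` converge. -/
def polydisc (p : σ → ℕ) (s : ℕ) : Set (σ → ℝ) := {x | ∀ i, ‖x i‖ₑ ≤ ((p i : ℝ≥0∞)⁻¹) ^ s}

theorem polydisc_mem_nhds (p : σ → ℕ) (s : ℕ) : polydisc p s ∈ 𝓝 0 := by
  refine Filter.eventually_all.2 fun i => ?_
  have h : Filter.Tendsto (fun x : σ → ℝ => ‖x i‖ₑ) (𝓝 0) (𝓝 ‖(0 : σ → ℝ) i‖ₑ) :=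
    ((continuous_apply i).enorm).tendsto 0
  refine h.eventually_le_const ?_
  simp only [Pi.zero_apply, enorm_zero]
  exact ENNReal.pow_pos (ENNReal.inv_pos.2 (ENNReal.natCast_ne_top _)) s

theorem enorm_prod_pow_le {s : ℕ} {x : σ → ℝ} (hx : x ∈ polydisc p s) (α : σ →₀ ℕ) :
    ‖∏ i, x i ^ α i‖ₑ ≤ ((expWeight p α : ℝ≥0∞)⁻¹) ^ s := by
  have h1 : ((expWeight p α : ℝ≥0∞)⁻¹) ^ s = ∏ i, (((p i : ℝ≥0∞)⁻¹) ^ s) ^ α i := by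
    rw [expWeight, Nat.cast_prod, ENNReal.prod_inv_distrib, ← Finset.prod_pow]
    · refine Finset.prod_congr rfl fun i _ => ?_
      rw [Nat.cast_pow, ENNReal.inv_pow, ← pow_mul, ← pow_mul, mul_comm]
    · intro i _ j _ _
      exact Or.inr (ENNReal.natCast_ne_top _)
  have h2 : ‖∏ i, x i ^ α i‖ₑ = ∏ i, ‖x i‖ₑ ^ α i := by
    simp only [← ofReal_norm, norm_prod, norm_pow]
    rw [ENNReal.ofReal_prod_of_nonneg fun i _ => by positivity]
    exact Finset.prod_congr rfl fun i _ => ENNReal.ofReal_pow (norm_nonneg _) _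
  rw [h1, h2]
  exact Finset.prod_le_prod' fun i _ => pow_le_pow_left' (hx i) _

theorem enorm_coeff_mul_le {s : ℕ} {x : σ → ℝ} (hx : x ∈ polydisc p s) (f : MvPowerSeries σ ℝ)
    (α : σ →₀ ℕ) :
    ‖coeff α f * ∏ i, x i ^ α i‖ₑ ≤ ‖coeff α f‖ₑ * ((expWeight p α : ℝ≥0∞)⁻¹) ^ s := by
  rw [enorm_mul]
  gcongr
  exact enorm_prod_pow_le hx α

theorem summable_norm_coeff_mul {s : ℕ} {x : σ → ℝ} (hx : x ∈ polydisc p s)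
    {f : MvPowerSeries σ ℝ} (hf : wNorm (expWeight p) s f ≠ ∞) :
    Summable fun α => ‖coeff α f * ∏ i, x i ^ α i‖ :=
  tsum_enorm_ne_top_iff_summable_norm.1
    (ne_top_of_le_ne_top hf (ENNReal.tsum_le_tsum (enorm_coeff_mul_le hx f)))

theorem enorm_sumAt_le {s : ℕ} {x : σ → ℝ} (hx : x ∈ polydisc p s) (f : MvPowerSeries σ ℝ) :
    ‖sumAt x f‖ₑ ≤ wNorm (expWeight p) s f :=
  enorm_tsum_le_tsum_enorm.trans (ENNReal.tsum_le_tsum (enorm_coeff_mul_le hx f))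

theorem sumAt_add {s : ℕ} {x : σ → ℝ} (hx : x ∈ polydisc p s) {f g : MvPowerSeries σ ℝ}
    (hf : wNorm (expWeight p) s f ≠ ∞) (hg : wNorm (expWeight p) s g ≠ ∞) :
    sumAt x (f + g) = sumAt x f + sumAt x g := by
  rw [sumAt, sumAt, sumAt, ← (summable_norm_coeff_mul hx hf).of_norm.tsum_add
    (summable_norm_coeff_mul hx hg).of_norm]
  simp_rw [map_add, add_mul]

theorem sumAt_mul {s : ℕ} {x : σ → ℝ} (hx : x ∈ polydisc p s) {f g : MvPowerSeries σ ℝ}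
    (hf : wNorm (expWeight p) s f ≠ ∞) (hg : wNorm (expWeight p) s g ≠ ∞) :
    sumAt x (f * g) = sumAt x f * sumAt x g := by
  classical
  have hf' := summable_norm_coeff_mul hx hf
  have hg' := summable_norm_coeff_mul hx hg
  rw [sumAt, sumAt, sumAt, hf'.of_norm.tsum_mul_tsum_eq_tsum_sum_antidiagonal hg'.of_norm
    (summable_mul_of_summable_norm hf' hg')]
  refine tsum_congr fun α => ?_
  rw [coeff_mul, Finset.sum_mul]
  refine Finset.sum_congr rfl fun y hy => ?_
  rw [← Finset.HasAntidiagonal.mem_antidiagonal.1 hy]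
  simp only [Finsupp.add_apply, pow_add, Finset.prod_mul_distrib]
  ring

theorem sumAt_monomial (x : σ → ℝ) (β : σ →₀ ℕ) (c : ℝ) :
    sumAt x (monomial β c) = c * ∏ i, x i ^ β i := by
  classical
  rw [sumAt, tsum_eq_single β]
  · rw [coeff_monomial_same]
  · intro α hα
    rw [coeff_monomial_ne hα, zero_mul]

theorem succ_mul_expWeight_inv_pow_le (hp : ∀ i, (p i).Prime) (s : ℕ) (i : σ) (β : σ →₀ ℕ) :
    ((β i + 1 : ℕ) : ℝ≥0∞) * ((expWeight p β : ℝ≥0∞)⁻¹) ^ (s + 1) ≤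
      ((expWeight p (β + Finsupp.single i 1) : ℝ≥0∞)⁻¹) ^ s * (p i : ℝ≥0∞) ^ s := by
  have hi : (p i : ℝ≥0∞) ≠ 0 := by exact_mod_cast (hp i).ne_zero
  have hβ : (expWeight p β : ℝ≥0∞) ≠ 0 := by exact_mod_cast (expWeight_pos hp β).ne'
  rw [expWeight_add, expWeight_single, Nat.cast_mul,
    ENNReal.mul_inv (Or.inr (ENNReal.natCast_ne_top _)) (Or.inl (ENNReal.natCast_ne_top _)),
    mul_pow, mul_assoc, ← mul_pow (p i : ℝ≥0∞)⁻¹,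
    ENNReal.inv_mul_cancel hi (ENNReal.natCast_ne_top _), one_pow, mul_one, pow_succ',
    ← mul_assoc]
  refine mul_le_of_le_one_left' ?_
  rw [← div_eq_mul_inv]
  refine ENNReal.div_le_of_le_mul ?_
  rw [one_mul]
  exact_mod_cast lt_expWeight hp i β

theorem wNorm_pderiv_le (hp : ∀ i, (p i).Prime) (s : ℕ) (i : σ) (f : MvPowerSeries σ ℝ) :
    wNorm (expWeight p) (s + 1) (pderiv ℝ i f) ≤
      wNorm (expWeight p) s f * (p i : ℝ≥0∞) ^ s := by
  rw [wNorm, wNorm, ← ENNReal.tsum_mul_right]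
  refine le_trans (ENNReal.tsum_le_tsum fun β => ?_)
    (ENNReal.tsum_comp_le_tsum_of_injective (add_left_injective (Finsupp.single i 1))
      (fun α => ‖coeff α f‖ₑ * ((expWeight p α : ℝ≥0∞)⁻¹) ^ s * (p i : ℝ≥0∞) ^ s))
  have h : ‖(β i + 1 : ℝ)‖ₑ = ((β i + 1 : ℕ) : ℝ≥0∞) := by
    rw [← Nat.cast_succ, Real.enorm_natCast]
  rw [coeff_pderiv, enorm_mul, h, mul_assoc, mul_assoc]
  gcongr _ * ?_
  exact succ_mul_expWeight_inv_pow_le hp s i β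

theorem hasDerivAt_sumAt_update [DecidableEq σ] (hp : ∀ i, (p i).Prime) {s : ℕ}
    {f : MvPowerSeries σ ℝ} (hf : wNorm (expWeight p) s f ≠ ∞) {x : σ → ℝ}
    (hx : x ∈ polydisc p (s + 1)) {i : σ} (hxi : ‖x i‖ < ((p i : ℝ)⁻¹) ^ (s + 1)) :
    HasDerivAt (fun t => sumAt (Function.update x i t) f) (sumAt x (pderiv ℝ i f)) (x i) := by
  let g' : (σ →₀ ℕ) → ℝ → ℝ := fun α t =>
    coeff α f * (α i * ∏ j, Function.update x i t j ^ (α - Finsupp.single i 1 : σ →₀ ℕ) j)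
  let u : (σ →₀ ℕ) → ℝ≥0∞ := fun α =>
    ‖coeff α f‖ₑ * ((expWeight p α : ℝ≥0∞)⁻¹) ^ s * (p i : ℝ≥0∞) ^ s
  have hu : ∑' α, u α ≠ ∞ := by
    rw [ENNReal.tsum_mul_right]
    exact ENNReal.mul_ne_top hf (ENNReal.pow_ne_top (ENNReal.natCast_ne_top _))
  have hprod : ∀ (α : σ →₀ ℕ) t, ∏ j, Function.update x i t j ^ α j =
      t ^ α i * ∏ j ∈ Finset.univ.erase i, x j ^ α j := fun α t => by
    rw [← Finset.mul_prod_erase _ _ (Finset.mem_univ i), Function.update_self]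
    congr 1
    refine Finset.prod_congr rfl fun j hj => ?_
    rw [Function.update_of_ne (Finset.ne_of_mem_erase hj)]
  have hg : ∀ α t, HasDerivAt (fun t => coeff α f * ∏ j, Function.update x i t j ^ α j)
      (g' α t) t := fun α t => by
    simp only [g', hprod]
    have h1 : ∏ j ∈ Finset.univ.erase i, x j ^ (α - Finsupp.single i 1 : σ →₀ ℕ) j =
        ∏ j ∈ Finset.univ.erase i, x j ^ α j := Finset.prod_congr rfl fun j hj => by
      rw [Finsupp.tsub_apply, Finsupp.single_eq_of_ne (Finset.ne_of_mem_erase hj), tsub_zero]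
    rw [h1, ← mul_assoc (α i : ℝ), Finsupp.tsub_apply, Finsupp.single_eq_same]
    exact ((hasDerivAt_pow (α i) t).mul_const _).const_mul _
  have hball : ∀ t ∈ Metric.ball (0 : ℝ) (((p i : ℝ)⁻¹) ^ (s + 1)),
      Function.update x i t ∈ polydisc p (s + 1) := fun t ht j => by
    rcases eq_or_ne j i with rfl | hj
    · rw [Function.update_self]
      rw [mem_ball_zero_iff] at ht
      rw [← ofReal_norm]
      refine (ENNReal.ofReal_le_ofReal ht.le).trans_eq ?_
      rw [ENNReal.ofReal_pow (by positivity),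
        ENNReal.ofReal_inv_of_pos (by exact_mod_cast (hp j).pos), ENNReal.ofReal_natCast]
    · rw [Function.update_of_ne hj]
      exact hx j
  have hg' : ∀ α, ∀ t ∈ Metric.ball (0 : ℝ) (((p i : ℝ)⁻¹) ^ (s + 1)),
      ‖g' α t‖ ≤ (u α).toReal := fun α t ht => by
    rw [← toReal_enorm]
    refine ENNReal.toReal_mono (ENNReal.ne_top_of_tsum_ne_top hu α) ?_
    rcases Nat.eq_zero_or_pos (α i) with h0 | h0
    · simp [g', h0]
    · obtain ⟨β, rfl⟩ : ∃ β, α = β + Finsupp.single i 1 :=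
        ⟨_, (tsub_add_cancel_of_le (Finsupp.single_le_iff.2 h0)).symm⟩
      simp only [g', u, add_tsub_cancel_right, enorm_mul, Real.enorm_natCast]
      rw [mul_assoc]
      gcongr _ * ?_
      refine le_trans ?_ (succ_mul_expWeight_inv_pow_le hp s i β)
      rw [Finsupp.add_apply, Finsupp.single_eq_same]
      gcongr
      exact enorm_prod_pow_le (hball t ht) β
  have hmem : x i ∈ Metric.ball (0 : ℝ) (((p i : ℝ)⁻¹) ^ (s + 1)) := by
    rwa [mem_ball_zero_iff]
  have key := hasDerivAt_tsum_of_isPreconnected (ENNReal.summable_toReal hu) Metric.isOpen_ball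
    (convex_ball (0 : ℝ) (((p i : ℝ)⁻¹) ^ (s + 1))).isPreconnected (fun α t _ => hg α t) hg' hmem
    ?_ hmem
  · convert! key using 1
    have hinj := add_left_injective (G := σ →₀ ℕ) (Finsupp.single i 1)
    rw [sumAt, ← hinj.tsum_eq (f := fun α => g' α (x i))]
    · refine tsum_congr fun β => ?_
      simp only [g', coeff_pderiv, Function.update_eq_self, add_tsub_cancel_right,
        Finsupp.add_apply, Finsupp.single_eq_same]
      push_cast
      ring
    · intro α hα
      have h0 : α i ≠ 0 := fun h0 => hα (by simp [g', h0])
      exact ⟨_, tsub_add_cancel_of_le (Finsupp.single_le_iff.2 (Nat.pos_of_ne_zero h0))⟩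
  · simp only [Function.update_eq_self]
    exact (summable_norm_coeff_mul hx
      (ne_top_of_le_ne_top hf (wNorm_anti (expWeight_pos hp) s.le_succ f))).of_norm

end Evaluation

end MvPowerSeries

end SumOfSeries

section ConvergentGerms

open scoped ENNReal Topology

namespace MvPowerSeries

section Germ

variable {σ : Type*} [Fintype σ] {p : σ → ℕ}

/-- The pairs consisting of a convergent power series and a function which coincides with its sum
near the origin. -/
def germGraph (p : σ → ℕ) (hp : ∀ i, (p i).Prime) :
    Subalgebra ℝ (MvPowerSeries σ ℝ × ((σ → ℝ) → ℝ)) where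
  carrier := {z | z.1 ∈ convergent (expWeight p) expWeight_add (expWeight_pos hp) ∧
    z.2 =ᶠ[𝓝 0] fun x => sumAt x z.1}
  add_mem' := by
    rintro ⟨f, F⟩ ⟨g, G⟩ ⟨⟨s, hs⟩, hF⟩ ⟨⟨t, ht⟩, hG⟩
    refine ⟨add_mem (⟨s, hs⟩ : f ∈ convergent _ _ _) ⟨t, ht⟩, ?_⟩
    filter_upwards [hF, hG, polydisc_mem_nhds p (max s t)] with x hFx hGx hx
    exact (congr_arg₂ (· + ·) hFx hGx).trans (sumAt_add hx
      (ne_top_of_le_ne_top hs (wNorm_anti (expWeight_pos hp) (le_max_left s t) f))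
      (ne_top_of_le_ne_top ht (wNorm_anti (expWeight_pos hp) (le_max_right s t) g))).symm
  mul_mem' := by
    rintro ⟨f, F⟩ ⟨g, G⟩ ⟨⟨s, hs⟩, hF⟩ ⟨⟨t, ht⟩, hG⟩
    refine ⟨mul_mem (⟨s, hs⟩ : f ∈ convergent _ _ _) ⟨t, ht⟩, ?_⟩
    filter_upwards [hF, hG, polydisc_mem_nhds p (max s t)] with x hFx hGx hx
    exact (congr_arg₂ (· * ·) hFx hGx).trans (sumAt_mul hx
      (ne_top_of_le_ne_top hs (wNorm_anti (expWeight_pos hp) (le_max_left s t) f))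
      (ne_top_of_le_ne_top ht (wNorm_anti (expWeight_pos hp) (le_max_right s t) g))).symm
  algebraMap_mem' c := by
    refine ⟨(convergent _ _ _).algebraMap_mem c, Filter.Eventually.of_forall fun x => ?_⟩
    change c = sumAt x (monomial 0 c)
    rw [sumAt_monomial]
    simp

variable {hp : ∀ i, (p i).Prime}

theorem X_mem_germGraph (i : σ) :
    ((X i : MvPowerSeries σ ℝ), fun x : σ → ℝ => x i) ∈ germGraph p hp := by
  classical
  refine ⟨monomial_mem_convergent _ _ _ _, Filter.Eventually.of_forall fun x => ?_⟩
  change x i = sumAt x (monomial (Finsupp.single i 1) 1)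
  rw [sumAt_monomial, one_mul, Finset.prod_eq_single i]
  · simp
  · intro j _ hj
    rw [Finsupp.single_eq_of_ne hj, pow_zero]
  · simp

theorem eq_zero_of_mem_germGraph (hinj : Function.Injective p) {f : MvPowerSeries σ ℝ}
    (h : (f, 0) ∈ germGraph p hp) : f = 0 := by
  obtain ⟨hf, h0⟩ := h
  by_contra hne
  obtain ⟨γ, hγ, hmin⟩ := exists_forall_le_of_ne_zero (expWeight p) hne
  have hm := monomial_mem_convergent expWeight_add (expWeight_pos hp) γ (coeff γ f)
  obtain ⟨s₀, hs₀⟩ := sub_mem hf hm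
  obtain ⟨s₁, hs₁⟩ := exists_forall_wNorm_le (expWeight_pos hp)
    (e := f - monomial γ (coeff γ f)) (α := γ) (ε := ‖coeff γ f‖ₑ / 2) (fun β hβ => by
      rcases eq_or_ne β γ with rfl | hne
      · simp at hβ
      · rw [map_sub, coeff_monomial_ne hne, sub_zero] at hβ
        exact (hmin β hβ).lt_of_ne ((expWeight_injective hp hinj).ne hne.symm)) hs₀
    (by simpa using hγ)
  have hlim : Filter.Tendsto (fun (s : ℕ) (i : σ) => ((p i : ℝ)⁻¹) ^ s) Filter.atTop (𝓝 0) :=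
    tendsto_pi_nhds.2 fun i => tendsto_pow_atTop_nhds_zero_of_lt_one (by positivity)
      (inv_lt_one_of_one_lt₀ (by exact_mod_cast (hp i).one_lt))
  obtain ⟨s, hs, hsx⟩ := ((Filter.eventually_ge_atTop (max s₀ s₁)).and
    (hlim.eventually h0)).exists
  set x : σ → ℝ := fun i => ((p i : ℝ)⁻¹) ^ s
  have hx' : ∀ i, ‖x i‖ₑ = ((p i : ℝ≥0∞)⁻¹) ^ s := fun i => by
    rw [Real.enorm_of_nonneg (by positivity), ENNReal.ofReal_pow (by positivity),
      ENNReal.ofReal_inv_of_pos (by exact_mod_cast (hp i).pos), ENNReal.ofReal_natCast]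
  have hx : x ∈ polydisc p s := fun i => (hx' i).le
  have he : wNorm (expWeight p) s (f - monomial γ (coeff γ f)) ≠ ∞ :=
    ne_top_of_le_ne_top hs₀ (wNorm_anti (expWeight_pos hp) ((le_max_left _ _).trans hs) _)
  have hW : ((expWeight p γ : ℝ≥0∞)⁻¹) ^ s ≠ 0 :=
    pow_ne_zero _ (ENNReal.inv_ne_zero.2 (ENNReal.natCast_ne_top _))
  have hW' : ((expWeight p γ : ℝ≥0∞)⁻¹) ^ s ≠ ∞ :=
    ENNReal.pow_ne_top (ENNReal.inv_ne_top.2 (by exact_mod_cast (expWeight_pos hp γ).ne'))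
  have hc : ‖coeff γ f‖ₑ ≠ 0 := by simpa using hγ
  have hc' : ‖coeff γ f‖ₑ ≠ ∞ := enorm_ne_top
  have hmx : ‖sumAt x (monomial γ (coeff γ f))‖ₑ =
      ‖coeff γ f‖ₑ * ((expWeight p γ : ℝ≥0∞)⁻¹) ^ s := by
    have h1 : ∏ i, x i ^ γ i = ((expWeight p γ : ℝ)⁻¹) ^ s := by
      simp only [x, expWeight, Nat.cast_prod, Nat.cast_pow, ← Finset.prod_inv_distrib,
        ← Finset.prod_pow]
      refine Finset.prod_congr rfl fun i _ => ?_
      rw [← inv_pow, ← pow_mul, ← pow_mul, mul_comm]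
    rw [sumAt_monomial, enorm_mul, h1,
      Real.enorm_of_nonneg (pow_nonneg (inv_nonneg.2 (Nat.cast_nonneg _)) s),
      ENNReal.ofReal_pow (by positivity),
      ENNReal.ofReal_inv_of_pos (by exact_mod_cast expWeight_pos hp γ), ENNReal.ofReal_natCast]
  have hsum : sumAt x f = sumAt x (f - monomial γ (coeff γ f)) +
      sumAt x (monomial γ (coeff γ f)) := by
    rw [← sumAt_add hx he, sub_add_cancel]
    rw [wNorm_monomial]
    exact ENNReal.mul_ne_top hc' hW'
  have hle := enorm_sumAt_le hx (f - monomial γ (coeff γ f))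
  rw [show sumAt x f = 0 from hsx.symm] at hsum
  rw [eq_neg_of_add_eq_zero_left hsum.symm, enorm_neg, hmx] at hle
  have hle2 := hle.trans (hs₁ s ((le_max_right _ _).trans hs))
  have hlt : ‖coeff γ f‖ₑ / 2 * ((expWeight p γ : ℝ≥0∞)⁻¹) ^ s <
      ‖coeff γ f‖ₑ * ((expWeight p γ : ℝ≥0∞)⁻¹) ^ s :=
    ENNReal.mul_lt_mul_left hW hW' (ENNReal.half_lt_self hc hc')
  exact hlt.not_ge hle2

theorem pderiv_mem_germGraph [DecidableEq σ] {f : MvPowerSeries σ ℝ} {F G : (σ → ℝ) → ℝ}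
    (h : (f, F) ∈ germGraph p hp) {i : σ}
    (hG : ∀ᶠ x in 𝓝 0, HasDerivAt (fun t => F (Function.update x i t)) (G x) (x i)) :
    (pderiv ℝ i f, G) ∈ germGraph p hp := by
  obtain ⟨⟨s, hs⟩, hF⟩ := h
  refine ⟨⟨s + 1, ne_top_of_le_ne_top (ENNReal.mul_ne_top hs
    (ENNReal.pow_ne_top (ENNReal.natCast_ne_top _))) (wNorm_pderiv_le hp s i f)⟩, ?_⟩
  have hxi : ∀ᶠ x : σ → ℝ in 𝓝 0, ‖x i‖ < ((p i : ℝ)⁻¹) ^ (s + 1) := by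
    have h1 : Filter.Tendsto (fun x : σ → ℝ => ‖x i‖) (𝓝 0) (𝓝 ‖(0 : σ → ℝ) i‖) :=
      ((continuous_apply i).norm).tendsto 0
    refine h1.eventually_lt_const ?_
    have := (hp i).pos
    simp only [Pi.zero_apply, norm_zero]
    positivity
  filter_upwards [hG, hF.eventually_nhds, polydisc_mem_nhds p (s + 1), hxi] with x hGx hFx hx hxi
  refine hGx.unique ((hasDerivAt_sumAt_update hp hs hx hxi).congr_of_eventuallyEq ?_)
  have hc : Filter.Tendsto (fun t => Function.update x i t) (𝓝 (x i)) (𝓝 x) := by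
    have h1 : Continuous fun t => Function.update x i t := continuous_const.update i continuous_id
    simpa using h1.tendsto (x i)
  exact hc.eventually hFx

end Germ

end MvPowerSeries

end ConvergentGerms

section AnalyticGerms

open scoped ENNReal Topology NNReal

namespace MvPowerSeries

section Existence

variable {σ : Type*}

/-- The exponent of the monomial which is the product of the letters of a word. -/
noncomputable def wordExponent (w : Σ n, Fin n → σ) : σ →₀ ℕ := ∑ k, Finsupp.single (w.2 k) 1

variable [Fintype σ]

theorem prod_pow_wordExponent {M : Type*} [CommMonoid M] (y : σ → M) (w : Σ n, Fin n → σ) :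
    ∏ i, y i ^ wordExponent w i = ∏ k, y (w.2 k) := by
  classical
  simp only [wordExponent, Finsupp.finsetSum_apply, ← Finset.prod_pow_eq_pow_sum]
  rw [Finset.prod_comm]
  refine Finset.prod_congr rfl fun k _ => ?_
  rw [Finset.prod_eq_single (w.2 k)]
  · simp
  · intro j _ hj
    rw [Finsupp.single_eq_of_ne hj, pow_zero]
  · simp

variable {p : σ → ℕ}

theorem expWeight_wordExponent_inv_pow_le (hp : ∀ i, (p i).Prime) (s : ℕ) (w : Σ n, Fin n → σ) :
    ((expWeight p (wordExponent w) : ℝ≥0∞)⁻¹) ^ s ≤ ((2⁻¹ : ℝ≥0∞) ^ s) ^ w.1 := by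
  have h : 2 ^ w.1 ≤ expWeight p (wordExponent w) := by
    rw [expWeight, prod_pow_wordExponent]
    calc 2 ^ w.1 = ∏ _k : Fin w.1, 2 := by simp
      _ ≤ _ := Finset.prod_le_prod' fun k _ => (hp _).two_le
  rw [← pow_mul, mul_comm, pow_mul]
  refine pow_le_pow_left' ?_ s
  rw [← ENNReal.inv_pow]
  gcongr
  exact_mod_cast h

variable [DecidableEq σ]

/-- The coefficients of a scalar formal multilinear series on `σ → ℝ`. -/
noncomputable def wordCoeff (P : FormalMultilinearSeries ℝ (σ → ℝ) ℝ) (w : Σ n, Fin n → σ) : ℝ :=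
  P w.1 fun k => Pi.single (w.2 k) 1

theorem enorm_wordCoeff_le (P : FormalMultilinearSeries ℝ (σ → ℝ) ℝ) (w : Σ n, Fin n → σ) :
    ‖wordCoeff P w‖ₑ ≤ ‖P w.1‖ₑ := by
  rw [enorm_le_iff_norm_le]
  refine ((P w.1).le_opNorm _).trans_eq ?_
  rw [Finset.prod_eq_one fun k _ => ?_, mul_one]
  rw [Pi.norm_single, norm_one]

theorem sum_wordCoeff_mul (P : FormalMultilinearSeries ℝ (σ → ℝ) ℝ) (n : ℕ) (x : σ → ℝ) :
    ∑ v : Fin n → σ, wordCoeff P ⟨n, v⟩ * ∏ k, x (v k) = P n fun _ => x := by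
  have hx : (fun _ : Fin n => x) = fun _ => ∑ i, x i • (Pi.single i 1 : σ → ℝ) := by
    funext _
    simpa using pi_eq_sum_univ' x
  rw [hx]
  have := (P n).toMultilinearMap.map_sum (fun (_ : Fin n) i => x i • (Pi.single i 1 : σ → ℝ))
  simp only [ContinuousMultilinearMap.coe_coe] at this
  rw [this]
  refine Finset.sum_congr rfl fun v _ => ?_
  rw [(P n).map_smul_univ (fun k => x (v k)), smul_eq_mul, mul_comm]
  rfl

theorem exists_tsum_wordCoeff_ne_top (hp : ∀ i, (p i).Prime)
    {P : FormalMultilinearSeries ℝ (σ → ℝ) ℝ} (hP : 0 < P.radius) :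
    ∃ s, ∑' w, ‖wordCoeff P w‖ₑ * ((expWeight p (wordExponent w) : ℝ≥0∞)⁻¹) ^ s ≠ ∞ := by
  have hlim : Filter.Tendsto (fun s : ℕ => (Fintype.card σ : ℝ≥0∞) * 2⁻¹ ^ s) Filter.atTop
      (𝓝 0) := by
    have := ENNReal.Tendsto.const_mul (a := (Fintype.card σ : ℝ≥0∞))
      (ENNReal.tendsto_pow_atTop_nhds_zero_of_lt_one ENNReal.one_half_lt_one)
      (Or.inr (ENNReal.natCast_ne_top _))
    rwa [mul_zero] at this
  obtain ⟨s, hs⟩ := (hlim.eventually_lt_const hP).exists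
  refine ⟨s, ne_top_of_le_ne_top (b := ∑' n, ‖P n‖ₑ * (Fintype.card σ * 2⁻¹ ^ s) ^ n) ?_ ?_⟩
  · have h1 : ((Fintype.card σ * 2⁻¹ ^ s : ℝ≥0) : ℝ≥0∞) = (Fintype.card σ : ℝ≥0∞) * 2⁻¹ ^ s := by
      rw [ENNReal.coe_mul, ENNReal.coe_pow, ENNReal.coe_inv two_ne_zero]
      rfl
    rw [← h1] at hs ⊢
    have h2 := ENNReal.tsum_coe_ne_top_iff_summable.2 (P.summable_nnnorm_mul_pow hs)
    simpa [enorm_eq_nnnorm] using h2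
  · rw [ENNReal.tsum_sigma']
    refine ENNReal.tsum_le_tsum fun n => ?_
    rw [tsum_fintype]
    calc _ ≤ ∑ v : Fin n → σ, ‖P n‖ₑ * ((2⁻¹ : ℝ≥0∞) ^ s) ^ n :=
          Finset.sum_le_sum fun v _ => mul_le_mul' (enorm_wordCoeff_le P ⟨n, v⟩)
            (expWeight_wordExponent_inv_pow_le hp s ⟨n, v⟩)
      _ = _ := by
          rw [Finset.sum_const, Finset.card_univ, Fintype.card_fun, Fintype.card_fin, nsmul_eq_mul,
            mul_pow, Nat.cast_pow]
          ring

theorem exists_mem_germGraph {hp : ∀ i, (p i).Prime} {F : (σ → ℝ) → ℝ} (hF : AnalyticAt ℝ F 0) :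
    ∃ f, (f, F) ∈ germGraph p hp := by
  obtain ⟨P, r, hr⟩ := hF
  obtain ⟨s, hs⟩ := exists_tsum_wordCoeff_ne_top hp (hr.r_pos.trans_le hr.r_le)
  let T : (Σ n, Fin n → σ) → ℝ≥0∞ := fun w =>
    ‖wordCoeff P w‖ₑ * ((expWeight p (wordExponent w) : ℝ≥0∞)⁻¹) ^ s
  have hT : ∑' α, ∑' w : {w : Σ n, Fin n → σ // wordExponent w = α}, T w = ∑' w, T w := by
    rw [← (Equiv.sigmaFiberEquiv (wordExponent (σ := σ))).tsum_eq T, ENNReal.tsum_sigma']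
    rfl
  have hTf : ∀ α, ∑' w : {w : Σ n, Fin n → σ // wordExponent w = α}, T w =
      (∑' w : {w : Σ n, Fin n → σ // wordExponent w = α}, ‖wordCoeff P w‖ₑ) *
        ((expWeight p α : ℝ≥0∞)⁻¹) ^ s := fun α => by
    rw [← ENNReal.tsum_mul_right]
    exact tsum_congr fun w => by simp only [T, w.2]
  obtain ⟨f, hf⟩ : ∃ f : MvPowerSeries σ ℝ, ∀ α, coeff α f =
      ∑' w : {w : Σ n, Fin n → σ // wordExponent w = α}, wordCoeff P w := ⟨fun α => _, fun _ => rfl⟩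
  have hsum : ∀ α, Summable fun w : {w : Σ n, Fin n → σ // wordExponent w = α} =>
      wordCoeff P w := fun α => by
    refine Summable.of_enorm fun h => hs ?_
    rw [← hT]
    refine ENNReal.tsum_eq_top_of_eq_top ⟨α, ?_⟩
    rw [hTf, h, ENNReal.top_mul]
    exact pow_ne_zero _ (ENNReal.inv_ne_zero.2 (ENNReal.natCast_ne_top _))
  refine ⟨f, ⟨s, ne_top_of_le_ne_top hs ?_⟩, ?_⟩
  · rw [← hT]
    refine ENNReal.tsum_le_tsum fun α => ?_
    rw [hTf, hf]
    gcongr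
    exact enorm_tsum_le_tsum_enorm
  filter_upwards [polydisc_mem_nhds p s, Metric.eball_mem_nhds 0 hr.r_pos] with x hx hxr
  let t : (Σ n, Fin n → σ) → ℝ := fun w => wordCoeff P w * ∏ k, x (w.2 k)
  have ht : HasSum t (∑' w, t w) := by
    refine (Summable.of_enorm (ne_top_of_le_ne_top hs (ENNReal.tsum_le_tsum fun w => ?_))).hasSum
    simp only [t]
    rw [enorm_mul, ← prod_pow_wordExponent]
    gcongr
    exact enorm_prod_pow_le hx _
  have h1 : HasSum (fun n => P n fun _ => x) (∑' w, t w) := by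
    refine ht.sigma fun n => ?_
    rw [← sum_wordCoeff_mul]
    exact hasSum_fintype _
  have h2 : F x = ∑' w, t w := by
    have := hr.hasSum hxr
    rw [zero_add] at this
    exact this.unique h1
  have h3 : HasSum (fun α => coeff α f * ∏ i, x i ^ α i) (∑' w, t w) := by
    rw [← (Equiv.sigmaFiberEquiv (wordExponent (σ := σ))).hasSum_iff] at ht
    refine ht.sigma fun α => ?_
    rw [hf]
    convert! (hsum α).hasSum.mul_right (∏ i, x i ^ α i) using 2 with w
    simp only [t, Function.comp_apply, Equiv.sigmaFiberEquiv_apply]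
    rw [← prod_pow_wordExponent]
    exact congr_arg (fun β : σ →₀ ℕ => wordCoeff P w * ∏ i, x i ^ β i) w.2
  exact h2.trans h3.tsum_eq.symm

end Existence

end MvPowerSeries

end AnalyticGerms

section AnalyticRelations

open scoped ENNReal Topology

namespace MvPowerSeries

section Germ

variable {σ : Type*} [Fintype σ] {p : σ → ℕ} {hp : ∀ i, (p i).Prime}

theorem eq_of_mem_germGraph (hinj : Function.Injective p) {f g : MvPowerSeries σ ℝ}
    {F G : (σ → ℝ) → ℝ} (hf : (f, F) ∈ germGraph p hp) (hg : (g, G) ∈ germGraph p hp)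
    (hFG : F =ᶠ[𝓝 0] G) : f = g := by
  have h := sub_mem hf hg
  refine sub_eq_zero.1 (eq_zero_of_mem_germGraph (hp := hp) hinj ⟨h.1, ?_⟩)
  filter_upwards [h.2, hFG] with x hx hx'
  refine Eq.trans ?_ hx
  simp [hx']

theorem sum_mul_mem_germGraph {κ : Type*} [Fintype κ] {f g : κ → MvPowerSeries σ ℝ}
    {F G : κ → (σ → ℝ) → ℝ} (hf : ∀ l, (f l, F l) ∈ germGraph p hp)
    (hg : ∀ l, (g l, G l) ∈ germGraph p hp) :
    (∑ l, f l * g l, ∑ l, F l * G l) ∈ germGraph p hp := by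
  have h : ∑ l, (f l, F l) * (g l, G l) ∈ germGraph p hp :=
    sum_mem fun l _ => mul_mem (hf l) (hg l)
  have e : ∑ l, (f l, F l) * (g l, G l) = (∑ l, f l * g l, ∑ l, F l * G l) :=
    Prod.ext (Prod.fst_sum ..) (Prod.snd_sum ..)
  rwa [e] at h

theorem constantCoeff_eq_of_mem_germGraph {f : MvPowerSeries σ ℝ} {F : (σ → ℝ) → ℝ}
    (h : (f, F) ∈ germGraph p hp) : constantCoeff f = F 0 := by
  have h0 : F 0 = sumAt 0 f := h.2.self_of_nhds
  rw [h0, sumAt, tsum_eq_single 0]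
  · simp
  · intro α hα
    obtain ⟨i, hi⟩ := Finsupp.ne_iff.1 hα
    rw [Finset.prod_eq_zero (Finset.mem_univ i), mul_zero]
    exact zero_pow hi

theorem exists_pow_eq_sum_of_mem_germGraph {κ : Type*} [Fintype κ] (hinj : Function.Injective p)
    {z : MvPowerSeries σ ℝ} {Z : (σ → ℝ) → ℝ} {g : κ → MvPowerSeries σ ℝ}
    {G : κ → (σ → ℝ) → ℝ} (hz : (z, Z) ∈ germGraph p hp) (hg : ∀ l, (g l, G l) ∈ germGraph p hp)
    {N : ℕ} (h : z ^ N ∈ Ideal.span (Set.range g)) :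
    ∃ Q : κ → (σ → ℝ) → ℝ, ∀ᶠ y in 𝓝 0, Z y ^ N = ∑ l, Q l y * G l y := by
  have hZ := pow_mem hz N
  obtain ⟨q, hq⟩ := (Submodule.mem_span_range_iff_exists_fun _).1
    (mem_span_convergent expWeight_add (expWeight_pos hp) (expWeight_injective hp hinj)
      (fun l => (hg l).1) hZ.1 h)
  have hQ := sum_mul_mem_germGraph (hp := hp) (F := fun l y => sumAt y (q l).1)
    (fun l => ⟨(q l).2, Filter.EventuallyEq.rfl⟩) hg
  have hq' : ∑ l, (q l).1 * g l = z ^ N := hq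
  refine ⟨fun l y => sumAt y (q l).1, ?_⟩
  filter_upwards [hZ.2, hQ.2] with y h1 h2
  simp only [hq'] at h2
  simpa using h1.trans h2.symm

end Germ

end MvPowerSeries

open MvPowerSeries

theorem exists_injective_nat_prime (σ : Type*) [Finite σ] :
    ∃ p : σ → ℕ, (∀ i, (p i).Prime) ∧ Function.Injective p := by
  obtain ⟨n, ⟨e⟩⟩ := Finite.exists_equiv_fin σ
  exact ⟨fun i => Nat.nth Nat.Prime (e i), fun i => Nat.prime_nth_prime _,
    (Nat.nth_injective Nat.infinite_setOfPred_prime).comp (Fin.val_injective.comp e.injective)⟩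

theorem AnalyticAt.comp_sumInl {ι κ : Type*} [Fintype ι] [Fintype κ] {F : (ι → ℝ) → ℝ}
    (hF : AnalyticAt ℝ F 0) : AnalyticAt ℝ (fun y : ι ⊕ κ → ℝ => F fun i => y (Sum.inl i)) 0 := by
  have h : AnalyticAt ℝ (fun (y : ι ⊕ κ → ℝ) (i : ι) => y (Sum.inl i)) 0 :=
    (ContinuousLinearMap.pi fun i : ι => ContinuousLinearMap.proj (R := ℝ)
      (φ := fun _ : ι ⊕ κ => ℝ) (Sum.inl i)).analyticAt 0
  exact AnalyticAt.fun_comp (g := F) hF h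

theorem AnalyticAt.eventually_hasDerivAt_update_inl {ι κ : Type*} [Fintype ι] [Fintype κ]
    [DecidableEq ι] [DecidableEq κ] {F : (ι → ℝ) → ℝ} (hF : AnalyticAt ℝ F 0) (i : ι) :
    ∀ᶠ y : ι ⊕ κ → ℝ in 𝓝 0,
      HasDerivAt (fun t => F fun j => Function.update y (Sum.inl i) t (Sum.inl j))
        (fderiv ℝ F (fun j => y (Sum.inl j)) (Pi.single i 1)) (y (Sum.inl i)) := by
  have hc : Filter.Tendsto (fun (y : ι ⊕ κ → ℝ) (j : ι) => y (Sum.inl j)) (𝓝 0) (𝓝 0) :=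
    (continuous_pi fun j => continuous_apply (Sum.inl j)).tendsto 0
  filter_upwards [hc.eventually hF.eventually_analyticAt] with y hy
  have h1 : ∀ t, (fun j => Function.update y (Sum.inl i) t (Sum.inl j)) =
      Function.update (fun j => y (Sum.inl j)) i t := fun t => by
    funext j
    rcases eq_or_ne j i with rfl | hj
    · simp
    · rw [Function.update_of_ne hj, Function.update_of_ne (by simpa using hj)]
  simp only [h1]
  refine HasFDerivAt.comp_hasDerivAt (y (Sum.inl i)) ?_ (hasDerivAt_update _ i _)
  rw [Function.update_eq_self]
  exact hy.differentiableAt.hasFDerivAt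

theorem MvPowerSeries.pderiv_inr_eq_zero {ι κ : Type*} [Fintype ι] [Fintype κ] [DecidableEq ι]
    [DecidableEq κ] {p : ι ⊕ κ → ℕ} {hp : ∀ i, (p i).Prime} (hinj : Function.Injective p)
    {f : MvPowerSeries (ι ⊕ κ) ℝ} {F : (ι → ℝ) → ℝ}
    (h : (f, fun y : ι ⊕ κ → ℝ => F fun j => y (Sum.inl j)) ∈ germGraph p hp) (i : κ) :
    pderiv ℝ (Sum.inr i) f = 0 := by
  have h1 := pderiv_mem_germGraph (i := Sum.inr i) (G := 0) h (Filter.Eventually.of_forall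
    fun y => by simpa using hasDerivAt_const (y (Sum.inr i)) _)
  exact eq_zero_of_mem_germGraph hinj h1

theorem MvPowerSeries.mul_pderiv_eq_sum {ι κ : Type*} [Fintype ι] [Fintype κ]
    [DecidableEq ι] [DecidableEq κ] {p : ι ⊕ κ → ℕ} {hp : ∀ i, (p i).Prime}
    (hinj : Function.Injective p) {a₀ b₀ : (ι → ℝ) → ℝ} {a b : κ → (ι → ℝ) → ℝ}
    {A₀ B₀ : MvPowerSeries (ι ⊕ κ) ℝ} {A B : κ → MvPowerSeries (ι ⊕ κ) ℝ}
    (hb₀ : AnalyticAt ℝ b₀ 0) (hb : ∀ l, AnalyticAt ℝ (b l) 0)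
    (hA₀ : (A₀, fun y : ι ⊕ κ → ℝ => a₀ fun j => y (Sum.inl j)) ∈ germGraph p hp)
    (hB₀ : (B₀, fun y : ι ⊕ κ → ℝ => b₀ fun j => y (Sum.inl j)) ∈ germGraph p hp)
    (hA : ∀ l, (A l, fun y : ι ⊕ κ → ℝ => a l fun j => y (Sum.inl j)) ∈ germGraph p hp)
    (hB : ∀ l, (B l, fun y : ι ⊕ κ → ℝ => b l fun j => y (Sum.inl j)) ∈ germGraph p hp)
    (h : ∀ i, ∀ᶠ x in 𝓝 0, a₀ x * fderiv ℝ b₀ x (Pi.single i 1) =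
      ∑ l, a l x * fderiv ℝ (b l) x (Pi.single i 1)) (i : ι ⊕ κ) :
    A₀ * pderiv ℝ i B₀ = ∑ l, A l * pderiv ℝ i (B l) := by
  have hc : Filter.Tendsto (fun (y : ι ⊕ κ → ℝ) (j : ι) => y (Sum.inl j)) (𝓝 0) (𝓝 0) :=
    (continuous_pi fun j => continuous_apply (Sum.inl j)).tendsto 0
  obtain i | i := i
  · have h1 := mul_mem hA₀ (pderiv_mem_germGraph hB₀ (hb₀.eventually_hasDerivAt_update_inl i))
    have h2 := sum_mul_mem_germGraph hA
      fun l => pderiv_mem_germGraph (hB l) ((hb l).eventually_hasDerivAt_update_inl i)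
    refine eq_of_mem_germGraph hinj h1 h2 ?_
    filter_upwards [hc.eventually (h i)] with y hy
    simpa using hy
  · simp [MvPowerSeries.pderiv_inr_eq_zero hinj hB₀,
      fun l => MvPowerSeries.pderiv_inr_eq_zero hinj (hB l)]

theorem exists_abs_le_of_pow_eq_sum_mul_sub {ι κ : Type*} [Fintype ι] [Fintype κ]
    {Z : (ι → ℝ) → ℝ} {w : κ → (ι → ℝ) → ℝ} {Q : κ → (ι ⊕ κ → ℝ) → ℝ} {N : ℕ}
    (h : ∀ᶠ y : ι ⊕ κ → ℝ in 𝓝 0, Z (fun j => y (Sum.inl j)) ^ N =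
      ∑ l, Q l y * (Z (fun j => y (Sum.inl j)) * y (Sum.inr l) - w l fun j => y (Sum.inl j))) :
    ∃ C, ∀ᶠ x in 𝓝 0, |Z x| ≤ C * ∑ l, |w l x| := by
  obtain ⟨ε, hε, hball⟩ := Metric.eventually_nhds_iff_ball.1 h
  refine ⟨2 / ε, Filter.eventually_of_mem (Metric.ball_mem_nhds 0 hε) fun x hx => ?_⟩
  by_contra! hlt
  have hsum : 0 ≤ ∑ l, |w l x| := Finset.sum_nonneg fun l _ => abs_nonneg _
  have hZpos : 0 < |Z x| := lt_of_le_of_lt (by positivity) hlt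
  have hZ0 : Z x ≠ 0 := abs_pos.1 hZpos
  have hy : (Sum.elim x fun l => w l x / Z x) ∈ Metric.ball (0 : ι ⊕ κ → ℝ) ε := by
    rw [mem_ball_zero_iff, pi_norm_lt_iff hε]
    rintro (i | l)
    · exact (norm_le_pi_norm x i).trans_lt (mem_ball_zero_iff.1 hx)
    · rw [Sum.elim_inr, Real.norm_eq_abs, abs_div, div_lt_iff₀ hZpos]
      have h1 := Finset.single_le_sum (f := fun l => |w l x|) (fun l _ => abs_nonneg _)
        (Finset.mem_univ l)
      have h2 : ∑ l, |w l x| < |Z x| * ε / 2 := by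
        rw [div_mul_eq_mul_div, div_lt_iff₀ hε] at hlt
        linarith
      have h3 : 0 < |Z x| * ε := by positivity
      linarith
  refine hZ0 (eq_zero_of_pow_eq_zero (n := N) ((hball _ hy).trans ?_))
  simp only [Sum.elim_inl, Sum.elim_inr]
  refine Finset.sum_eq_zero fun l _ => ?_
  rw [mul_div_cancel₀ _ hZ0, sub_self, mul_zero]

/-- If `a₀ db₀ = ∑ aₗ dbₗ` near the origin for real analytic functions and `b₀` vanishes at the
origin, then `a₀ b₀` is bounded by the products `aₗ bₗ`. -/
theorem AnalyticAt.exists_abs_mul_le_of_mul_fderiv_eq {ι κ : Type*} [Fintype ι] [Fintype κ]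
    [DecidableEq ι] {a₀ b₀ : (ι → ℝ) → ℝ} {a b : κ → (ι → ℝ) → ℝ} (ha₀ : AnalyticAt ℝ a₀ 0)
    (hb₀ : AnalyticAt ℝ b₀ 0) (ha : ∀ l, AnalyticAt ℝ (a l) 0) (hb : ∀ l, AnalyticAt ℝ (b l) 0)
    (h0 : b₀ 0 = 0)
    (h : ∀ i, ∀ᶠ x in 𝓝 0, a₀ x * fderiv ℝ b₀ x (Pi.single i 1) =
      ∑ l, a l x * fderiv ℝ (b l) x (Pi.single i 1)) :
    ∃ C, ∀ᶠ x in 𝓝 0, |a₀ x * b₀ x| ≤ C * ∑ l, |a l x * b l x| := by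
  classical
  obtain ⟨p, hp, hinj⟩ := exists_injective_nat_prime (ι ⊕ κ)
  obtain ⟨A₀, hA₀⟩ := exists_mem_germGraph (hp := hp) (ha₀.comp_sumInl (κ := κ))
  obtain ⟨B₀, hB₀⟩ := exists_mem_germGraph (hp := hp) (hb₀.comp_sumInl (κ := κ))
  choose A hA using fun l => exists_mem_germGraph (hp := hp) ((ha l).comp_sumInl (κ := κ))
  choose B hB using fun l => exists_mem_germGraph (hp := hp) ((hb l).comp_sumInl (κ := κ))
  obtain ⟨N, hN⟩ := mul_mem_radical_of_mul_pderiv_eq (s := fun l => X (Sum.inr l))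
    (by rw [constantCoeff_eq_of_mem_germGraph hB₀]; exact h0) (fun l => constantCoeff_X _)
    (MvPowerSeries.mul_pderiv_eq_sum hinj hb₀ hb hA₀ hB₀ hA hB h)
  have hg l := sub_mem (mul_mem (mul_mem hA₀ hB₀) (X_mem_germGraph (Sum.inr l)))
    (mul_mem (hA l) (hB l))
  obtain ⟨Q, hQ⟩ := exists_pow_eq_sum_of_mem_germGraph hinj (mul_mem hA₀ hB₀) hg hN
  exact exists_abs_le_of_pow_eq_sum_mul_sub (Z := fun x => a₀ x * b₀ x)
    (w := fun l x => a l x * b l x) hQ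

end AnalyticRelations

section BorderedMinors

open scoped Matrix

namespace Matrix

variable {p n : ℕ}

open scoped Classical in
/-- The absolute value of the maximal minor of `J` on the columns `s`, for increasing `s`. -/
noncomputable def absMinor {q : ℕ} (J : Matrix (Fin q) (Fin n) ℝ) (s : Fin q → Fin n) : ℝ :=
  if StrictMono s then |(J.submatrix id s).det| else 0

theorem absMinor_of_strictMono {q : ℕ} (J : Matrix (Fin q) (Fin n) ℝ) {s : Fin q → Fin n}
    (hs : StrictMono s) : absMinor J s = |(J.submatrix id s).det| :=
  if_pos hs

theorem absMinor_nonneg {q : ℕ} (J : Matrix (Fin q) (Fin n) ℝ) (s : Fin q → Fin n) :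
    0 ≤ absMinor J s := by
  unfold absMinor
  split_ifs <;> positivity

theorem absMinor_le_sum {q : ℕ} (J : Matrix (Fin q) (Fin n) ℝ) (s : Fin q → Fin n) :
    absMinor J s ≤ ∑ t, absMinor J t :=
  Finset.single_le_sum (fun t _ => absMinor_nonneg J t) (Finset.mem_univ s)

/-- The matrix `J` with the additional last row `2 x`. -/
def bordered (J : Matrix (Fin p) (Fin n) ℝ) (x : Fin n → ℝ) : Matrix (Fin (p + 1)) (Fin n) ℝ :=
  fun j k => if h : (j : ℕ) < p then J ⟨j, h⟩ k else 2 * x k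

@[simp]
theorem bordered_castSucc (J : Matrix (Fin p) (Fin n) ℝ) (x : Fin n → ℝ) (j : Fin p) (k : Fin n) :
    bordered J x j.castSucc k = J j k := by
  simp [bordered]

@[simp]
theorem bordered_last (J : Matrix (Fin p) (Fin n) ℝ) (x : Fin n → ℝ) (k : Fin n) :
    bordered J x (Fin.last p) k = 2 * x k := by
  simp [bordered]

theorem absMinor_bordered_le (J : Matrix (Fin p) (Fin n) ℝ) {x : Fin n → ℝ} {R : ℝ}
    (hx : ∀ i, |x i| ≤ R) (s : Fin (p + 1) → Fin n) :
    absMinor (bordered J x) s ≤ 2 * (p + 1) * ∑ t, R * absMinor J t := by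
  have hsum : 0 ≤ ∑ t, |x (s 0)| * absMinor J t :=
    Finset.sum_nonneg fun t _ => mul_nonneg (abs_nonneg _) (absMinor_nonneg J t)
  by_cases hs : StrictMono s
  · rw [absMinor_of_strictMono _ hs, det_succ_row _ (Fin.last p)]
    refine (Finset.abs_sum_le_sum_abs _ _).trans ?_
    rw [← Finset.mul_sum]
    have h : ∀ k ∈ (Finset.univ : Finset (Fin (p + 1))), |(-1) ^ ((Fin.last p : ℕ) + (k : ℕ)) *
        ((bordered J x).submatrix id s) (Fin.last p) k *
        (((bordered J x).submatrix id s).submatrix (Fin.last p).succAbove k.succAbove).det| ≤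
        2 * (R * ∑ t, absMinor J t) := by
      intro k _
      have e : ((bordered J x).submatrix id s).submatrix (Fin.last p).succAbove k.succAbove =
          J.submatrix id (s ∘ k.succAbove) := by
        ext i j
        simp
      rw [e, abs_mul, ← absMinor_of_strictMono _ (hs.comp (Fin.strictMono_succAbove k)), abs_mul,
        abs_pow, abs_neg, abs_one, one_pow, one_mul, submatrix_apply, id, bordered_last, abs_mul,
        abs_two, mul_assoc]
      gcongr
      · exact absMinor_nonneg _ _
      · exact (abs_nonneg _).trans (hx (s k))
      · exact hx _
      · exact absMinor_le_sum _ _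
    refine (Finset.sum_le_card_nsmul _ _ _ h).trans_eq ?_
    simp
    ring
  · rw [absMinor, if_neg hs]
    have : 0 ≤ R := (abs_nonneg _).trans (hx (s 0))
    exact mul_nonneg (by positivity)
      (Finset.sum_nonneg fun t _ => mul_nonneg this (absMinor_nonneg J t))

theorem abs_det_bordered_submatrix_le (J : Matrix (Fin p) (Fin n) ℝ) (x : Fin n → ℝ)
    {g : Fin (p + 1) → Fin n} (hg : Function.Injective g) :
    |((bordered J x).submatrix id g).det| ≤ ∑ t, absMinor (bordered J x) t := by
  have hs : StrictMono (g ∘ Tuple.sort g) :=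
    (Tuple.monotone_sort g).strictMono_of_injective (hg.comp (Equiv.injective _))
  refine le_trans (le_of_eq ?_) (absMinor_le_sum _ (g ∘ Tuple.sort g))
  have h := det_permute' (Tuple.sort g) ((bordered J x).submatrix id g)
  rw [submatrix_submatrix, Function.id_comp] at h
  rw [absMinor_of_strictMono _ hs, h, abs_mul, ← Int.cast_abs,
    Int.isUnit_iff_abs_eq.1 (Units.isUnit _), Int.cast_one, one_mul]

/-- For a nonzero maximal minor, the failure of `x` to lie in the row space of `J` is controlled
by the maximal minors of the bordered matrix. -/
theorem two_mul_abs_sub_vecMul_cramer_le (J : Matrix (Fin p) (Fin n) ℝ) (x : Fin n → ℝ)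
    {s : Fin p → Fin n} (hs : Function.Injective s) (hdet : (J.submatrix id s).det ≠ 0)
    (i : Fin n) :
    2 * |(J.submatrix id s).det * x i - ∑ j, cramer (J.submatrix id s)ᵀ (x ∘ s) j * J j i| ≤
      ∑ t, absMinor (bordered J x) t := by
  set A := J.submatrix id s
  set μ := cramer Aᵀ (x ∘ s)
  have hμ : ∀ k, ∑ j, μ j * J j (s k) = A.det * x (s k) := fun k => by
    have h := congrFun (mulVec_cramer Aᵀ (x ∘ s)) k
    rw [det_transpose] at h
    simpa [mulVec, dotProduct, A, μ, mul_comm] using h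
  by_cases hi : i ∈ Set.range s
  · obtain ⟨k, rfl⟩ := hi
    rw [hμ, sub_self, abs_zero, mul_zero]
    exact Finset.sum_nonneg fun t _ => absMinor_nonneg _ t
  · have hg : Function.Injective (Fin.snoc (α := fun _ => Fin n) s i) :=
      Fin.snoc_injective_iff.2 ⟨hs, hi⟩
    refine le_trans (le_of_eq ?_) (abs_det_bordered_submatrix_le J x hg)
    let b : Matrix (Fin p) (Fin 1) ℝ := of fun j _ => J j i
    let v : Matrix (Fin 1) (Fin p) ℝ := of fun _ k => 2 * x (s k)
    let d : Matrix (Fin 1) (Fin 1) ℝ := of fun _ _ => 2 * x i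
    let u : Matrix (Fin 1) (Fin p) ℝ := of fun _ j => -2 * μ j
    let e : Matrix (Fin 1) (Fin 1) ℝ := of fun _ _ => A.det
    have hB : (((bordered J x).submatrix id (Fin.snoc (α := fun _ => Fin n) s i)).submatrix
        finSumFinEquiv finSumFinEquiv) = fromBlocks A b v d := by
      have hl : ∀ k : Fin p, finSumFinEquiv (Sum.inl k : Fin p ⊕ Fin 1) = k.castSucc :=
        fun _ => rfl
      have hr : ∀ k : Fin 1, finSumFinEquiv (Sum.inr k : Fin p ⊕ Fin 1) = Fin.last p :=
        fun k => by rw [Subsingleton.elim k 0]; rfl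
      ext (j | j) (k | k) <;> simp [hl, hr, A, b, v, d]
    have hmul : fromBlocks 1 0 u e * fromBlocks A b v d =
        fromBlocks A b 0 (of fun _ _ => 2 * (A.det * x i - ∑ j, μ j * J j i)) := by
      rw [fromBlocks_multiply]
      congr 1
      · simp
      · simp
      · ext _ k
        have := hμ k
        simp only [add_apply, mul_apply, of_apply, u, v, e, A, submatrix_apply, id, zero_apply,
          mul_assoc, ← Finset.mul_sum, this, Finset.univ_unique, Finset.sum_singleton]
        ring
      · ext
        simp [u, b, d, e, mul_apply, mul_assoc, ← Finset.mul_sum]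
        ring
    have h := congrArg det hmul
    rw [det_mul, det_fromBlocks_zero₁₂, det_fromBlocks_zero₂₁, det_one, one_mul,
      det_unique e, det_unique (of _)] at h
    have h' := mul_left_cancel₀ hdet h
    rw [← abs_two, ← abs_mul, ← det_submatrix_equiv_self finSumFinEquiv, hB, h', of_apply]

end Matrix

end BorderedMinors

section Comparison

open scoped Topology Matrix

theorem exists_sum_pow_add_pow_le {α β : Type*} [Fintype α] [Fintype β] {m : ℕ} (hm : 0 < m)
    (C : ℝ) : ∃ D > 0, ∀ (a : α → ℝ) (b : β → ℝ) (t : ℝ), (∀ i, 0 ≤ a i) → (∀ j, 0 ≤ b j) →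
      0 ≤ t → (∀ i, a i ≤ C * (∑ j, b j + t)) →
        ∑ i, a i ^ m + t ^ m ≤ D * (∑ j, b j ^ m + t ^ m) := by
  obtain ⟨k, rfl⟩ := Nat.exists_eq_add_one_of_ne_zero hm.ne'
  set N : ℝ := (Fintype.card (Option β) : ℝ)
  refine ⟨Fintype.card α * (|C| ^ (k + 1) * N ^ k) + 1, by positivity, fun a b t ha hb ht h => ?_⟩
  have hS : (∑ j, b j + t) ^ (k + 1) ≤ N ^ k * (∑ j, b j ^ (k + 1) + t ^ (k + 1)) := by
    have h1 := pow_sum_div_card_le_sum_pow (s := Finset.univ) (f := fun o : Option β => o.elim t b)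
      (by rintro (_ | j) _ <;> simp [ht, hb]) k
    rw [div_le_iff₀' (by simp; positivity), Finset.card_univ] at h1
    simpa [Fintype.sum_option, add_comm, N] using h1
  have hT : 0 ≤ ∑ j, b j ^ (k + 1) :=
    Finset.sum_nonneg fun j _ => pow_nonneg (hb j) _
  have h2 : ∀ i ∈ Finset.univ,
      a i ^ (k + 1) ≤ |C| ^ (k + 1) * (N ^ k * (∑ j, b j ^ (k + 1) + t ^ (k + 1))) := by
    intro i _
    have h3 : 0 ≤ ∑ j, b j + t := add_nonneg (Finset.sum_nonneg fun j _ => hb j) ht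
    refine (pow_le_pow_left₀ (ha i) ((h i).trans
      (mul_le_mul_of_nonneg_right (le_abs_self C) h3)) _).trans ?_
    rw [mul_pow]
    gcongr
  have h4 := Finset.sum_le_card_nsmul _ _ _ h2
  rw [Finset.card_univ, nsmul_eq_mul] at h4
  linarith

theorem AnalyticAt.matrix_det {𝕜 E ι : Type*} [NontriviallyNormedField 𝕜] [NormedAddCommGroup E]
    [NormedSpace 𝕜 E] [Fintype ι] [DecidableEq ι] {M : E → Matrix ι ι 𝕜} {x : E}
    (h : ∀ i j, AnalyticAt 𝕜 (fun y => M y i j) x) : AnalyticAt 𝕜 (fun y => (M y).det) x := by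
  simp only [Matrix.det_apply']
  exact Finset.analyticAt_fun_sum _ fun σ _ =>
    analyticAt_const.mul (Finset.analyticAt_fun_prod _ fun i _ => h _ _)

theorem EuclideanSpace.exists_abs_mul_le_of_mul_fderiv_eq {ι κ : Type*} [Fintype ι] [Fintype κ]
    [DecidableEq ι] {a₀ b₀ : EuclideanSpace ℝ ι → ℝ} {a b : κ → EuclideanSpace ℝ ι → ℝ}
    (ha₀ : AnalyticAt ℝ a₀ 0) (hb₀ : AnalyticAt ℝ b₀ 0) (ha : ∀ l, AnalyticAt ℝ (a l) 0)
    (hb : ∀ l, AnalyticAt ℝ (b l) 0) (h0 : b₀ 0 = 0)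
    (h : ∀ i, ∀ᶠ x in 𝓝 0, a₀ x * fderiv ℝ b₀ x (EuclideanSpace.single i 1) =
      ∑ l, a l x * fderiv ℝ (b l) x (EuclideanSpace.single i 1)) :
    ∃ C, ∀ᶠ x in 𝓝 0, |a₀ x * b₀ x| ≤ C * ∑ l, |a l x * b l x| := by
  let L : (ι → ℝ) ≃L[ℝ] EuclideanSpace ℝ ι := (EuclideanSpace.equiv ι ℝ).symm
  have hL : AnalyticAt ℝ L 0 := L.toContinuousLinearMap.analyticAt 0
  have hL0 : Filter.Tendsto L (𝓝 0) (𝓝 0) := by simpa using L.continuous.tendsto 0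
  have hcomp : ∀ {g : EuclideanSpace ℝ ι → ℝ}, AnalyticAt ℝ g 0 → AnalyticAt ℝ (g ∘ L) 0 :=
    fun hg => AnalyticAt.comp (by simpa using hg) hL
  have hd : ∀ (g : EuclideanSpace ℝ ι → ℝ) (x : ι → ℝ) (i : ι),
      fderiv ℝ (g ∘ L) x (Pi.single i 1) = fderiv ℝ g (L x) (EuclideanSpace.single i 1) := by
    intro g x i
    rw [L.comp_right_fderiv]
    rfl
  obtain ⟨C, hC⟩ := AnalyticAt.exists_abs_mul_le_of_mul_fderiv_eq (hcomp ha₀) (hcomp hb₀)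
    (fun l => hcomp (ha l)) (fun l => hcomp (hb l)) (by simpa using h0)
    (fun i => by simpa only [hd, Function.comp_apply] using hL0.eventually (h i))
  refine ⟨C, ?_⟩
  have hL1 : Filter.Tendsto L.symm (𝓝 0) (𝓝 0) := by simpa using L.symm.continuous.tendsto 0
  filter_upwards [hL1.eventually hC] with x hx
  simpa using hx

section Minors

variable {n p : ℕ} {f : EuclideanSpace ℝ (Fin n) → EuclideanSpace ℝ (Fin p)}

/-- The Jacobian matrix of `f` at `x`. -/
noncomputable def jacobianMatrix (f : EuclideanSpace ℝ (Fin n) → EuclideanSpace ℝ (Fin p))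
    (x : EuclideanSpace ℝ (Fin n)) : Matrix (Fin p) (Fin n) ℝ :=
  fun j k => fderiv ℝ f x (EuclideanSpace.single k 1) j

theorem kuoQ_eq {m : ℕ} (hm : 0 < m) (x : EuclideanSpace ℝ (Fin n)) :
    KuoQ n p m f x = ∑ s, (‖x‖ * (jacobianMatrix f x).absMinor s) ^ m + ‖f x‖ ^ m := by
  rw [KuoQ, Finset.mul_sum]
  congr 1
  refine Finset.sum_congr rfl fun s _ => ?_
  rw [mul_pow]
  congr 1
  unfold Matrix.absMinor
  split_ifs with hs
  · rfl
  · exact (zero_pow hm.ne').symm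

theorem thomQ_eq {m : ℕ} (hm : 0 < m) (x : EuclideanSpace ℝ (Fin n)) :
    ThomQ n p m f x =
      ∑ s, ((jacobianMatrix f x).bordered x).absMinor s ^ m + ‖f x‖ ^ m := by
  rw [ThomQ]
  congr 1
  refine Finset.sum_congr rfl fun s _ => ?_
  unfold Matrix.absMinor
  split_ifs with hs
  · rfl
  · exact (zero_pow hm.ne').symm

theorem analyticAt_jacobianMatrix (hf : AnalyticAt ℝ f 0) (j : Fin p) (k : Fin n) :
    AnalyticAt ℝ (fun x => jacobianMatrix f x j k) 0 :=
  (((EuclideanSpace.proj (𝕜 := ℝ) j).comp (ContinuousLinearMap.apply ℝ (EuclideanSpace ℝ (Fin p))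
    (EuclideanSpace.single k (1 : ℝ)))).analyticAt _).comp hf.fderiv

theorem fderiv_apply_single {x : EuclideanSpace ℝ (Fin n)}
    (hf : DifferentiableAt ℝ f x) (j : Fin p) (k : Fin n) :
    fderiv ℝ (fun y => f y j) x (EuclideanSpace.single k 1) = jacobianMatrix f x j k := by
  have h := (EuclideanSpace.proj (𝕜 := ℝ) j).hasFDerivAt.comp x hf.hasFDerivAt
  exact congrArg (fun L => L (EuclideanSpace.single k 1)) h.fderiv

theorem fderiv_norm_sq_single (x : EuclideanSpace ℝ (Fin n)) (k : Fin n) :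
    fderiv ℝ (fun y : EuclideanSpace ℝ (Fin n) => ‖y‖ ^ 2) x (EuclideanSpace.single k 1) =
      2 * x k := by
  have h := (hasStrictFDerivAt_norm_sq x).hasFDerivAt.fderiv
  rw [h]
  simp [EuclideanSpace.inner_single_right]

/-- The `j`-th coefficient of `x`, scaled by the minor, in the rows of the columns `s` of the
Jacobian matrix. -/
noncomputable def rowCoeff (f : EuclideanSpace ℝ (Fin n) → EuclideanSpace ℝ (Fin p))
    (s : Fin p → Fin n) (j : Fin p) (x : EuclideanSpace ℝ (Fin n)) : ℝ :=
  Matrix.cramer ((jacobianMatrix f x).submatrix id s)ᵀ (x ∘ s) j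

theorem analyticAt_det_jacobianMatrix (hf : AnalyticAt ℝ f 0) (s : Fin p → Fin n) :
    AnalyticAt ℝ (fun x => ((jacobianMatrix f x).submatrix id s).det) 0 :=
  AnalyticAt.matrix_det fun _ _ => analyticAt_jacobianMatrix hf _ _

theorem analyticAt_coord (i : Fin n) :
    AnalyticAt ℝ (fun x : EuclideanSpace ℝ (Fin n) => x i) 0 :=
  (EuclideanSpace.proj (𝕜 := ℝ) i).analyticAt 0

theorem analyticAt_rowCoeff (hf : AnalyticAt ℝ f 0) (s : Fin p → Fin n) (j : Fin p) :
    AnalyticAt ℝ (rowCoeff f s j) 0 := by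
  unfold rowCoeff
  simp only [Matrix.cramer_apply]
  refine AnalyticAt.matrix_det fun i k => ?_
  simp only [Matrix.updateCol_apply]
  split_ifs
  · exact analyticAt_coord _
  · exact analyticAt_jacobianMatrix hf _ _

theorem rowCoeff_zero (s : Fin p → Fin n) (j : Fin p) : rowCoeff f s j 0 = 0 := by
  have h : (WithLp.ofLp (0 : EuclideanSpace ℝ (Fin n)) ∘ s) = 0 := rfl
  rw [rowCoeff, h, map_zero, Pi.zero_apply]

theorem exists_norm_sq_mul_abs_det_le (hf : AnalyticAt ℝ f 0)
    (s : Fin p → Fin n) : ∃ C, ∀ᶠ x in 𝓝 0,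
      |((jacobianMatrix f x).submatrix id s).det * ‖x‖ ^ 2| ≤
        C * (∑ j, |2 * rowCoeff f s j x * f x j| +
          ∑ i, |2 * (((jacobianMatrix f x).submatrix id s).det * x i -
            ∑ j, rowCoeff f s j x * jacobianMatrix f x j i) * x i|) := by
  have hfj : ∀ j, AnalyticAt ℝ (fun x => f x j) 0 := fun j =>
    ((EuclideanSpace.proj (𝕜 := ℝ) j).analyticAt _).comp hf
  have h := EuclideanSpace.exists_abs_mul_le_of_mul_fderiv_eq (κ := Fin p ⊕ Fin n)
    (a₀ := fun x => ((jacobianMatrix f x).submatrix id s).det) (b₀ := fun x => ‖x‖ ^ 2)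
    (a := Sum.elim (fun j x => 2 * rowCoeff f s j x) fun i x =>
      2 * (((jacobianMatrix f x).submatrix id s).det * x i -
        ∑ j, rowCoeff f s j x * jacobianMatrix f x j i))
    (b := Sum.elim (fun j x => f x j) fun i x => x i)
    (analyticAt_det_jacobianMatrix hf s) ?_ ?_ ?_ (by simp) ?_
  · simpa only [Fintype.sum_sum_type, Sum.elim_inl, Sum.elim_inr] using h
  · simp only [EuclideanSpace.real_norm_sq_eq]
    exact Finset.analyticAt_fun_sum _ fun i _ => (analyticAt_coord i).pow 2
  · rintro (j | i)
    · exact analyticAt_const.mul (analyticAt_rowCoeff hf s j)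
    · exact analyticAt_const.mul (((analyticAt_det_jacobianMatrix hf s).mul
        (analyticAt_coord i)).sub (Finset.analyticAt_fun_sum _ fun j _ =>
          (analyticAt_rowCoeff hf s j).mul (analyticAt_jacobianMatrix hf j i)))
  · rintro (j | i)
    · exact hfj j
    · exact analyticAt_coord i
  · intro i
    filter_upwards [hf.eventually_analyticAt] with x hx
    have hcoord : ∀ k, fderiv ℝ (fun y : EuclideanSpace ℝ (Fin n) => y k) x
        (EuclideanSpace.single i 1) = if k = i then 1 else 0 := fun k => by
      have := (EuclideanSpace.proj (𝕜 := ℝ) k).hasFDerivAt (x := x) |>.fderiv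
      refine (congrArg (fun L => L (EuclideanSpace.single i 1)) this).trans ?_
      simp
    simp only [Fintype.sum_sum_type, Sum.elim_inl, Sum.elim_inr, fderiv_norm_sq_single,
      fderiv_apply_single hx.differentiableAt, hcoord, mul_ite, mul_one, mul_zero,
      Finset.sum_ite_eq', Finset.mem_univ, if_true, mul_assoc, ← Finset.mul_sum]
    ring

theorem exists_norm_mul_abs_det_le (hf : AnalyticAt ℝ f 0)
    {s : Fin p → Fin n} (hs : StrictMono s) : ∃ C, ∀ᶠ x in 𝓝 0,
      ‖x‖ * |((jacobianMatrix f x).submatrix id s).det| ≤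
        C * (∑ t, ((jacobianMatrix f x).bordered x).absMinor t + ‖f x‖) := by
  obtain ⟨C, hC⟩ := exists_norm_sq_mul_abs_det_le hf s
  have hO : ∀ j, ∃ B, ∀ᶠ x in 𝓝 0, |rowCoeff f s j x| ≤ B * ‖x‖ := fun j => by
    have h := (analyticAt_rowCoeff hf s j).differentiableAt.hasFDerivAt.isBigO_sub
    simp only [rowCoeff_zero, sub_zero] at h
    exact h.bound
  choose B hB using hO
  refine ⟨|C| * (2 * ∑ j, |B j| + n), ?_⟩
  filter_upwards [hC, Filter.eventually_all.2 hB] with x hx hBx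
  set M := ((jacobianMatrix f x).submatrix id s).det
  set T := ∑ t, ((jacobianMatrix f x).bordered x).absMinor t
  have hT : 0 ≤ T := Finset.sum_nonneg fun t _ => Matrix.absMinor_nonneg _ t
  have hB0 : 0 ≤ ∑ j, |B j| := Finset.sum_nonneg fun j _ => abs_nonneg _
  rcases eq_or_ne M 0 with hM | hM
  · rw [hM, abs_zero, mul_zero]
    positivity
  rcases eq_or_ne x 0 with rfl | hx0
  · rw [norm_zero, zero_mul]
    positivity
  have hpos : 0 < ‖x‖ := norm_pos_iff.2 hx0
  refine le_of_mul_le_mul_left ?_ hpos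
  have h1 : ∑ j, |2 * rowCoeff f s j x * f x j| ≤ ‖x‖ * (2 * (∑ j, |B j|) * ‖f x‖) := by
    rw [Finset.mul_sum, Finset.sum_mul, Finset.mul_sum]
    refine Finset.sum_le_sum fun j _ => ?_
    rw [abs_mul, abs_mul, abs_two]
    have h2 : |rowCoeff f s j x| ≤ |B j| * ‖x‖ :=
      (hBx j).trans (mul_le_mul_of_nonneg_right (le_abs_self _) hpos.le)
    have h3 : |f x j| ≤ ‖f x‖ := PiLp.norm_apply_le (f x) j
    calc 2 * |rowCoeff f s j x| * |f x j| ≤ 2 * (|B j| * ‖x‖) * ‖f x‖ := by gcongr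
      _ = _ := by ring
  have h2 : ∑ i, |2 * (M * x i - ∑ j, rowCoeff f s j x * jacobianMatrix f x j i) * x i| ≤
      ‖x‖ * (n * T) := by
    have h3 : ∀ i ∈ Finset.univ,
        |2 * (M * x i - ∑ j, rowCoeff f s j x * jacobianMatrix f x j i) * x i| ≤ T * ‖x‖ := by
      intro i _
      rw [abs_mul, abs_mul, abs_two]
      exact mul_le_mul
        (Matrix.two_mul_abs_sub_vecMul_cramer_le (jacobianMatrix f x) x hs.injective hM i)
        (PiLp.norm_apply_le x i) (abs_nonneg _) hT
    refine (Finset.sum_le_card_nsmul _ _ _ h3).trans_eq ?_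
    simp
    ring
  calc ‖x‖ * (‖x‖ * |M|) = |M * ‖x‖ ^ 2| := by
        rw [abs_mul, abs_of_nonneg (sq_nonneg ‖x‖)]
        ring
    _ ≤ |C| * (‖x‖ * (2 * (∑ j, |B j|) * ‖f x‖) + ‖x‖ * (n * T)) := by
        refine hx.trans ((mul_le_mul_of_nonneg_right (le_abs_self C) ?_).trans ?_)
        · positivity
        · gcongr
    _ ≤ ‖x‖ * (|C| * (2 * ∑ j, |B j| + n) * (T + ‖f x‖)) := by
        have h5 : 0 ≤ ‖x‖ * |C| * (2 * (∑ j, |B j|) * T + n * ‖f x‖) := by positivity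
        linarith

theorem exists_norm_mul_absMinor_le (hf : AnalyticAt ℝ f 0) :
    ∃ C, ∀ᶠ x in 𝓝 0, ∀ s, ‖x‖ * (jacobianMatrix f x).absMinor s ≤
      C * (∑ t, ((jacobianMatrix f x).bordered x).absMinor t + ‖f x‖) := by
  have h : ∀ s : Fin p → Fin n, ∃ C, ∀ᶠ x in 𝓝 0, ‖x‖ * (jacobianMatrix f x).absMinor s ≤
      C * (∑ t, ((jacobianMatrix f x).bordered x).absMinor t + ‖f x‖) := fun s => by
    by_cases hs : StrictMono s
    · simpa only [Matrix.absMinor_of_strictMono _ hs] using exists_norm_mul_abs_det_le hf hs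
    · exact ⟨0, by simp [Matrix.absMinor, hs]⟩
  choose C hC using h
  refine ⟨∑ s, |C s|, ?_⟩
  filter_upwards [Filter.eventually_all.2 hC] with x hx s
  have hT : 0 ≤ ∑ t, ((jacobianMatrix f x).bordered x).absMinor t :=
    Finset.sum_nonneg fun t _ => Matrix.absMinor_nonneg _ t
  refine (hx s).trans (mul_le_mul_of_nonneg_right ((le_abs_self _).trans ?_) (by positivity))
  exact Finset.single_le_sum (f := fun s => |C s|) (fun _ _ => abs_nonneg _) (Finset.mem_univ s)

end Minors

theorem exists_thomQ_le (n p m : ℕ) (hm : 0 < m)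
    (f : EuclideanSpace ℝ (Fin n) → EuclideanSpace ℝ (Fin p)) :
    ∃ D > 0, ∀ x, ThomQ n p m f x ≤ D * KuoQ n p m f x := by
  obtain ⟨D, hD, h⟩ := exists_sum_pow_add_pow_le (α := Fin (p + 1) → Fin n)
    (β := Fin p → Fin n) hm (2 * (p + 1))
  refine ⟨D, hD, fun x => ?_⟩
  rw [kuoQ_eq hm, thomQ_eq hm]
  refine h _ _ _ (fun s => Matrix.absMinor_nonneg _ s)
    (fun t => mul_nonneg (norm_nonneg x) (Matrix.absMinor_nonneg _ t)) (norm_nonneg _) fun s =>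
    (Matrix.absMinor_bordered_le _ (fun i => PiLp.norm_apply_le x i) s).trans ?_
  gcongr
  exact le_add_of_nonneg_right (norm_nonneg _)

theorem exists_kuoQ_le {n p m : ℕ} (hm : 0 < m)
    {f : EuclideanSpace ℝ (Fin n) → EuclideanSpace ℝ (Fin p)} (hf : AnalyticAt ℝ f 0) :
    ∃ D > 0, ∀ᶠ x in 𝓝 0, KuoQ n p m f x ≤ D * ThomQ n p m f x := by
  obtain ⟨C, hC⟩ := exists_norm_mul_absMinor_le hf
  obtain ⟨D, hD, h⟩ := exists_sum_pow_add_pow_le (α := Fin p → Fin n)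
    (β := Fin (p + 1) → Fin n) hm C
  refine ⟨D, hD, ?_⟩
  filter_upwards [hC] with x hx
  rw [kuoQ_eq hm, thomQ_eq hm]
  exact h _ _ _ (fun t => mul_nonneg (norm_nonneg x) (Matrix.absMinor_nonneg _ t))
    (fun s => Matrix.absMinor_nonneg _ s) (norm_nonneg _) hx

theorem exists_mul_le_of_eventually_le {E : Type*} [SeminormedAddCommGroup E] {d P Q : E → ℝ}
    {D : ℝ} (hD : 0 < D) (hPQ : ∀ᶠ x in 𝓝 0, P x ≤ D * Q x)
    (h : ∃ c > (0 : ℝ), ∃ δ > (0 : ℝ), ∀ x, ‖x‖ < δ → c * d x ≤ P x) :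
    ∃ c > (0 : ℝ), ∃ δ > (0 : ℝ), ∀ x, ‖x‖ < δ → c * d x ≤ Q x := by
  obtain ⟨c, hc, δ, hδ, h⟩ := h
  obtain ⟨ε, hε, hball⟩ := Metric.eventually_nhds_iff_ball.1 hPQ
  refine ⟨c / D, by positivity, min δ ε, lt_min hδ hε, fun x hx => ?_⟩
  rw [div_mul_eq_mul_div, div_le_iff₀' hD]
  exact (h x (hx.trans_le (min_le_left _ _))).trans
    (hball x (mem_ball_zero_iff.2 (hx.trans_le (min_le_right _ _))))

end Comparison

theorem condIT_iff_condIK_analytic (n p : ℕ) (hp : 1 ≤ p) (hpn : p ≤ n) (r m : ℕ)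
    (hr : 0 < r) (hm : 0 < m)
    (S : Set (EuclideanSpace ℝ (Fin n))) (hS : IsClosed S)
    (h0S : (0 : EuclideanSpace ℝ (Fin n)) ∈ S)
    (f : EuclideanSpace ℝ (Fin n) → EuclideanSpace ℝ (Fin p))
    (U : Set (EuclideanSpace ℝ (Fin n))) (hU : U ∈ nhds 0)
    (hf : AnalyticOnNhd ℝ f U) (hf0 : f 0 = 0) :
    CondIT n p r m S f ↔ CondIK n p r m S f := by
  constructor
  · obtain ⟨D, hD, h⟩ := exists_thomQ_le n p m hm f
    exact exists_mul_le_of_eventually_le hD (Filter.Eventually.of_forall h)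
  · obtain ⟨D, hD, h⟩ := exists_kuoQ_le hm (hf 0 (mem_of_mem_nhds hU))
    exact exists_mul_le_of_eventually_le hD h
end

section
/- Let n > p ≥ 1, let Σ ⊆ ℝⁿ be a coherent closed set with 0 ∈ Σ, and let φ = (φ₁,…,φ_p) : ℝⁿ → ℝᵖ be a C^∞ map near 0 with φ(0)=0. Then the following are equivalent: (1) the ideal I_K(φ) is Σ-elliptic, i.e. there exist a neighbourhood U of 0, C^∞ coefficient functions on U, and constants C, α > 0 such that the corresponding combination F of the generators of I_K(φ) satisfies |F(x)| ≥ C·d(x,Σ)^α on U; (2) every C^∞ function h near 0 all of whose partial derivatives of every order vanish at all points of Σ in some neighbourhood of 0 belongs to I_K(φ), i.e. h equals, on some neighbourhood of 0, a finite combination of the generators of I_K(φ) with C^∞ coefficients. -/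
/-- The `p × p` Jacobian minor of `φ` with columns `ι` (a generator of `I_K(φ)`). -/
noncomputable def kGen (n p : ℕ) (φ : EuclideanSpace ℝ (Fin n) → EuclideanSpace ℝ (Fin p))
    (ι : Fin p → Fin n) (x : EuclideanSpace ℝ (Fin n)) : ℝ :=
  Matrix.det fun j k : Fin p => fderiv ℝ φ x (EuclideanSpace.single (ι k) 1) j

/-- The `(p+1) × (p+1)` Jacobian minor of `(φ, ρ)`, `ρ(x) = ‖x‖²`, with columns `ι`
(a generator of `I_T(φ)`). -/
noncomputable def tGen (n p : ℕ) (φ : EuclideanSpace ℝ (Fin n) → EuclideanSpace ℝ (Fin p))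
    (ι : Fin (p + 1) → Fin n) (x : EuclideanSpace ℝ (Fin n)) : ℝ :=
  Matrix.det fun j k : Fin (p + 1) =>
    if h : (j : ℕ) < p then fderiv ℝ φ x (EuclideanSpace.single (ι k) 1) ⟨j, h⟩
    else 2 * x (ι k)

open scoped Classical in
/-- `h` belongs to the ideal `I_K(φ)` of germs at `0` of `C^∞` functions: near `0`,
`h` is a combination with `C^∞` coefficients of `φ₁, …, φ_p` and the `p × p`
Jacobian minors of `φ`. -/
def MemIK (n p : ℕ) (φ : EuclideanSpace ℝ (Fin n) → EuclideanSpace ℝ (Fin p))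
    (h : EuclideanSpace ℝ (Fin n) → ℝ) : Prop :=
  ∃ U ∈ nhds (0 : EuclideanSpace ℝ (Fin n)),
    ∃ a : Fin p → EuclideanSpace ℝ (Fin n) → ℝ,
      ∃ b : (Fin p → Fin n) → EuclideanSpace ℝ (Fin n) → ℝ,
        (∀ j, ContDiffOn ℝ (⊤ : ℕ∞) (a j) U) ∧ (∀ ι, ContDiffOn ℝ (⊤ : ℕ∞) (b ι) U) ∧
          ∀ x ∈ U, h x = (∑ j, a j x * φ x j) +
            ∑ ι : Fin p → Fin n, if StrictMono ι then b ι x * kGen n p φ ι x else 0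

open scoped Classical in
/-- `h` belongs to the ideal `I_T(φ)` of germs at `0` of `C^∞` functions: near `0`,
`h` is a combination with `C^∞` coefficients of `φ₁, …, φ_p` and the
`(p+1) × (p+1)` Jacobian minors of `(φ, ρ)`, `ρ(x) = ‖x‖²`. -/
def MemIT (n p : ℕ) (φ : EuclideanSpace ℝ (Fin n) → EuclideanSpace ℝ (Fin p))
    (h : EuclideanSpace ℝ (Fin n) → ℝ) : Prop :=
  ∃ U ∈ nhds (0 : EuclideanSpace ℝ (Fin n)),
    ∃ a : Fin p → EuclideanSpace ℝ (Fin n) → ℝ,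
      ∃ b : (Fin (p + 1) → Fin n) → EuclideanSpace ℝ (Fin n) → ℝ,
        (∀ j, ContDiffOn ℝ (⊤ : ℕ∞) (a j) U) ∧ (∀ ι, ContDiffOn ℝ (⊤ : ℕ∞) (b ι) U) ∧
          ∀ x ∈ U, h x = (∑ j, a j x * φ x j) +
            ∑ ι : Fin (p + 1) → Fin n, if StrictMono ι then b ι x * tGen n p φ ι x else 0

/-- `h` belongs to `m_Σ^∞`: `h` is `C^∞` near `0` and all its partial derivatives of
every order vanish at all points of `S` near `0`. -/
def FlatOnSet (n : ℕ) (S : Set (EuclideanSpace ℝ (Fin n)))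
    (h : EuclideanSpace ℝ (Fin n) → ℝ) : Prop :=
  ∃ U ∈ nhds (0 : EuclideanSpace ℝ (Fin n)), ContDiffOn ℝ (⊤ : ℕ∞) h U ∧
    ∀ k : ℕ, ∀ x ∈ S ∩ U, iteratedFDeriv ℝ k h x = 0

/-- The closed set `S` is coherent: there are finitely many `C^∞` functions vanishing
on `S` near `0` such that every `C^∞` function vanishing on `S` near `0` is, near `0`,
a combination of them with `C^∞` coefficients. -/
def CoherentSet (n : ℕ) (S : Set (EuclideanSpace ℝ (Fin n))) : Prop :=
  ∃ N : ℕ, ∃ q : Fin N → EuclideanSpace ℝ (Fin n) → ℝ,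
    (∃ U ∈ nhds (0 : EuclideanSpace ℝ (Fin n)),
      (∀ i, ContDiffOn ℝ (⊤ : ℕ∞) (q i) U) ∧ ∀ i, ∀ x ∈ S ∩ U, q i x = 0) ∧
    ∀ h : EuclideanSpace ℝ (Fin n) → ℝ,
      (∃ V ∈ nhds (0 : EuclideanSpace ℝ (Fin n)),
        ContDiffOn ℝ (⊤ : ℕ∞) h V ∧ ∀ x ∈ S ∩ V, h x = 0) →
      ∃ W ∈ nhds (0 : EuclideanSpace ℝ (Fin n)),
        ∃ a : Fin N → EuclideanSpace ℝ (Fin n) → ℝ,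
          (∀ i, ContDiffOn ℝ (⊤ : ℕ∞) (a i) W) ∧ ∀ x ∈ W, h x = ∑ i, a i x * q i x

open scoped Classical in
/-- The ideal `I_K(φ)` is `Σ`-elliptic: some combination `F` of its generators with
`C^∞` coefficients satisfies `|F(x)| ≥ C · d(x, S)^α` near `0`. -/
def IKElliptic (n p : ℕ) (S : Set (EuclideanSpace ℝ (Fin n)))
    (φ : EuclideanSpace ℝ (Fin n) → EuclideanSpace ℝ (Fin p)) : Prop :=
  ∃ U ∈ nhds (0 : EuclideanSpace ℝ (Fin n)),
    ∃ a : Fin p → EuclideanSpace ℝ (Fin n) → ℝ,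
      ∃ b : (Fin p → Fin n) → EuclideanSpace ℝ (Fin n) → ℝ,
        (∀ j, ContDiffOn ℝ (⊤ : ℕ∞) (a j) U) ∧ (∀ ι, ContDiffOn ℝ (⊤ : ℕ∞) (b ι) U) ∧
          ∃ C > (0 : ℝ), ∃ α > (0 : ℝ), ∀ x ∈ U,
            C * Metric.infDist x S ^ α ≤
              |(∑ j, a j x * φ x j) +
                ∑ ι : Fin p → Fin n, if StrictMono ι then b ι x * kGen n p φ ι x else 0|

theorem eq_zero_of_iteratedFDeriv_zero_eq_zero {E G : Type*} [NormedAddCommGroup E]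
    [NormedSpace ℝ E] [NormedAddCommGroup G] [NormedSpace ℝ G] {h : E → G} {x : E}
    (hx : iteratedFDeriv ℝ 0 h x = 0) : h x = 0 := by
  rwa [← norm_eq_zero, norm_iteratedFDeriv_zero, norm_eq_zero] at hx

open Metric Topology in
/-- A smooth function flat along `S` is bounded near every point of `S` by every power of the
distance to the points of `S`. -/
theorem exists_norm_le_mul_dist_pow_of_flat.{u} {E : Type u} [NormedAddCommGroup E]
    [NormedSpace ℝ E] {S V : Set E} (hV : IsOpen V) {x₀ : E} (hx₀ : x₀ ∈ V) (N : ℕ) {G : Type u}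
    [NormedAddCommGroup G] [NormedSpace ℝ G] {h : E → G} (hh : ContDiffOn ℝ (⊤ : ℕ∞) h V)
    (hflat : ∀ k : ℕ, ∀ x ∈ S ∩ V, iteratedFDeriv ℝ k h x = 0) :
    ∃ r > 0, ∃ M ≥ 0, ball x₀ r ⊆ V ∧
      ∀ x ∈ ball x₀ r, ∀ s ∈ S ∩ ball x₀ r, ‖h x‖ ≤ M * dist x s ^ N := by
  induction N generalizing h G with
  | zero =>
    have hc : ContinuousAt h x₀ := hh.continuousOn.continuousAt (hV.mem_nhds hx₀)
    have hlt : ∀ᶠ x in 𝓝 x₀, ‖h x‖ < ‖h x₀‖ + 1 := hc.norm.eventually_lt_const (lt_add_one _)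
    obtain ⟨r, hr, hball⟩ := Metric.mem_nhds_iff.1 (Filter.inter_mem hlt (hV.mem_nhds hx₀))
    refine ⟨r, hr, ‖h x₀‖ + 1, by positivity, fun x hx => (hball hx).2, fun x hx s _ => ?_⟩
    simpa using (hball hx).1.le
  | succ N ih =>
    have hd : ContDiffOn ℝ (⊤ : ℕ∞) (fderiv ℝ h) V :=
      ((contDiffOn_infty_iff_fderiv_of_isOpen hV).1 hh).2
    obtain ⟨r, hr, M, hM, hrV, hbound⟩ := ih hd fun k x hx => by
      rw [← norm_eq_zero, norm_iteratedFDeriv_fderiv, hflat _ x hx, norm_zero]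
    refine ⟨r, hr, M, hM, hrV, fun x hx s hs => ?_⟩
    have hs0 : h s = 0 := eq_zero_of_iteratedFDeriv_zero_eq_zero (hflat 0 s ⟨hs.1, hrV hs.2⟩)
    have hseg : segment ℝ s x ⊆ ball x₀ r := (convex_ball x₀ r).segment_subset hs.2 hx
    have key := (convex_segment s x).norm_image_sub_le_of_norm_fderiv_le (𝕜 := ℝ) (f := h)
      (C := M * dist x s ^ N)
      (fun y hy => (hh.contDiffAt (hV.mem_nhds (hrV (hseg hy)))).differentiableAt (by simp))
      (fun y hy => (hbound y (hseg hy) s hs).trans <| by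
        gcongr
        have := segment_subset_closedBall_left s x hy
        rw [mem_closedBall] at this
        rwa [dist_comm x s])
      (left_mem_segment ℝ s x) (right_mem_segment ℝ s x)
    rw [hs0, sub_zero, ← dist_eq_norm] at key
    rwa [pow_succ, ← mul_assoc]

open Metric Topology in
/-- Dividing a smooth function flat along `S` by a power of a smooth function bounded below by a
power of the distance to `S` gives a differentiable function. -/
theorem hasFDerivAt_inv_pow_smul_of_flat.{u} {E : Type u} [NormedAddCommGroup E]
    [NormedSpace ℝ E] [ProperSpace E] {S V : Set E} (hS : IsClosed S) (hV : IsOpen V) {G : Type u}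
    [NormedAddCommGroup G] [NormedSpace ℝ G] {h : E → G} (hh : ContDiffOn ℝ (⊤ : ℕ∞) h V)
    (hflat : ∀ k : ℕ, ∀ x ∈ S ∩ V, iteratedFDeriv ℝ k h x = 0) {F : E → ℝ} {C : ℝ} (hC : 0 < C)
    {A : ℕ} (hF : ∀ x ∈ V, C * infDist x S ^ A ≤ |F x|) (j : ℕ) {x₀ : E} (hx₀ : x₀ ∈ S ∩ V) :
    HasFDerivAt (fun x => (F x)⁻¹ ^ j • h x) (0 : E →L[ℝ] G) x₀ := by
  have hzero : ∀ x ∈ S ∩ V, h x = 0 :=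
    fun x hx => eq_zero_of_iteratedFDeriv_zero_eq_zero (hflat 0 x hx)
  obtain ⟨r, hr, M, hM, hrV, hbound⟩ :=
    exists_norm_le_mul_dist_pow_of_flat hV hx₀.2 (A * j + 2) hh hflat
  have hne : S.Nonempty := ⟨x₀, hx₀.1⟩
  have hle : ∀ᶠ x in 𝓝 x₀,
      ‖(F x)⁻¹ ^ j • h x‖ ≤ (C⁻¹ ^ j * M) * ‖‖x - x₀‖ ^ 2‖ := by
    filter_upwards [ball_mem_nhds x₀ (half_pos hr)] with x hx
    have hxr : x ∈ ball x₀ r := ball_subset_ball (half_le_self hr.le) hx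
    have hdx : infDist x S ≤ dist x x₀ := infDist_le_dist_of_mem hx₀.1
    obtain ⟨s, hsS, hs⟩ := hS.exists_infDist_eq_dist hne x
    have hsr : s ∈ ball x₀ r := by
      rw [mem_ball] at hx ⊢
      calc dist s x₀ ≤ dist s x + dist x x₀ := dist_triangle _ _ _
        _ < r := by rw [dist_comm s x, ← hs]; linarith
    have hhx := hbound x hxr s ⟨hsS, hsr⟩
    rw [← hs] at hhx
    rcases (infDist_nonneg (x := x) (s := S)).eq_or_lt with h0 | hpos
    · have hxS : x ∈ S := (hS.mem_iff_infDist_zero hne).2 h0.symm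
      rw [hzero x ⟨hxS, hrV hxr⟩]
      simp only [smul_zero, norm_zero]
      positivity
    · set d := infDist x S
      have hFx := hF x (hrV hxr)
      have hinv : |F x|⁻¹ ≤ (C * d ^ A)⁻¹ := inv_anti₀ (by positivity) hFx
      calc ‖(F x)⁻¹ ^ j • h x‖ = |F x|⁻¹ ^ j * ‖h x‖ := by
            rw [norm_smul, norm_pow, norm_inv, Real.norm_eq_abs]
        _ ≤ (C * d ^ A)⁻¹ ^ j * (M * d ^ (A * j + 2)) := by gcongr
        _ = (C⁻¹ ^ j * M) * d ^ 2 := by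
            rw [pow_add, pow_mul, mul_inv, mul_pow]
            have : (d ^ A)⁻¹ ^ j * (d ^ A) ^ j = 1 := by
              rw [← mul_pow, inv_mul_cancel₀ (by positivity), one_pow]
            linear_combination C⁻¹ ^ j * M * d ^ 2 * this
        _ ≤ (C⁻¹ ^ j * M) * ‖‖x - x₀‖ ^ 2‖ := by
            rw [norm_pow, norm_norm, ← dist_eq_norm]
            gcongr
  have hO : (fun x => (F x)⁻¹ ^ j • h x) =O[𝓝 x₀] fun x => ‖x - x₀‖ ^ 2 :=
    Asymptotics.IsBigO.of_bound _ hle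
  have ho : (fun x => (F x)⁻¹ ^ j • h x) =o[𝓝 x₀] fun x => x - x₀ :=
    hO.trans_isLittleO <| by
      simpa [Function.comp_def] using
        (Asymptotics.isLittleO_norm_pow_id (E' := E) one_lt_two).comp_tendsto
          (tendsto_sub_nhds_zero_iff.2 (Filter.tendsto_id (x := 𝓝 x₀)))
  refine HasFDerivAt.of_isLittleO ?_
  simpa [hzero x₀ hx₀] using ho

open Metric Topology in
/-- Dividing a smooth function flat along `S` by a power of a smooth function bounded below by a
power of the distance to `S` gives a smooth function. -/
theorem contDiffOn_inv_pow_smul_of_flat.{u} {E : Type u} [NormedAddCommGroup E]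
    [NormedSpace ℝ E] [ProperSpace E] {S V : Set E} (hS : IsClosed S) (hne : S.Nonempty)
    (hV : IsOpen V) {F : E → ℝ} (hFs : ContDiffOn ℝ (⊤ : ℕ∞) F V) {C : ℝ} (hC : 0 < C) {A : ℕ}
    (hF : ∀ x ∈ V, C * infDist x S ^ A ≤ |F x|) (m j : ℕ) {G : Type u}
    [NormedAddCommGroup G] [NormedSpace ℝ G] {h : E → G} (hh : ContDiffOn ℝ (⊤ : ℕ∞) h V)
    (hflat : ∀ k : ℕ, ∀ x ∈ S ∩ V, iteratedFDeriv ℝ k h x = 0) :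
    ContDiffOn ℝ m (fun x => (F x)⁻¹ ^ j • h x) V := by
  have hF0 : ∀ x ∈ V, x ∉ S → F x ≠ 0 := fun x hx hxS h0 => by
    have hpos := (hS.notMem_iff_infDist_pos hne).1 hxS
    have := hF x hx
    rw [h0, abs_zero] at this
    exact absurd this (not_le.2 (by positivity))
  have hderiv {G : Type u} [NormedAddCommGroup G] [NormedSpace ℝ G] {h : E → G}
      (hh : ContDiffOn ℝ (⊤ : ℕ∞) h V)
      (hflat : ∀ k : ℕ, ∀ x ∈ S ∩ V, iteratedFDeriv ℝ k h x = 0) (j : ℕ) (x : E) (hx : x ∈ V) :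
      HasFDerivAt (fun x => (F x)⁻¹ ^ j • h x)
        ((F x)⁻¹ ^ j • fderiv ℝ h x -
          (j : ℝ) • (fderiv ℝ F x).smulRight ((F x)⁻¹ ^ (j + 1) • h x)) x := by
    by_cases hxS : x ∈ S
    · have h0 : h x = 0 := eq_zero_of_iteratedFDeriv_zero_eq_zero (hflat 0 x ⟨hxS, hx⟩)
      have h1 : fderiv ℝ h x = 0 := by
        rw [← norm_eq_zero, ← norm_iteratedFDeriv_one, hflat 1 x ⟨hxS, hx⟩, norm_zero]
      simpa [h0, h1] using hasFDerivAt_inv_pow_smul_of_flat hS hV hh hflat hC hF j ⟨hxS, hx⟩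
    · have hFd : HasFDerivAt F (fderiv ℝ F x) x :=
        ((hFs.contDiffAt (hV.mem_nhds hx)).differentiableAt (by simp)).hasFDerivAt
      have hhd : HasFDerivAt h (fderiv ℝ h x) x :=
        ((hh.contDiffAt (hV.mem_nhds hx)).differentiableAt (by simp)).hasFDerivAt
      have hinv := (hasDerivAt_inv (hF0 x hx hxS)).comp_hasFDerivAt x hFd
      refine ((hinv.pow j).smul hhd).congr_fderiv ?_
      ext v
      have hFx := hF0 x hx hxS
      rcases j with _ | j
      · simp
      · simp [smul_smul, sub_eq_add_neg]
        congr 1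
        field_simp
        ring
  induction m generalizing j h G with
  | zero =>
    rw [Nat.cast_zero, contDiffOn_zero]
    exact fun x hx => (hderiv hh hflat j x hx).continuousAt.continuousWithinAt
  | succ m ih =>
    rw [Nat.cast_succ, contDiffOn_succ_iff_fderiv_of_isOpen hV]
    refine ⟨fun x hx => (hderiv hh hflat j x hx).differentiableAt.differentiableWithinAt,
      fun h => absurd h (by simp), ?_⟩
    have hd : ContDiffOn ℝ (⊤ : ℕ∞) (fderiv ℝ h) V :=
      ((contDiffOn_infty_iff_fderiv_of_isOpen hV).1 hh).2
    have hFd : ContDiffOn ℝ m (fderiv ℝ F) V :=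
      ((contDiffOn_infty_iff_fderiv_of_isOpen hV).1 hFs).2.of_le (by exact_mod_cast le_top)
    have h1 := ih j hd fun k x hx => by
      rw [← norm_eq_zero, norm_iteratedFDeriv_fderiv, hflat _ x hx, norm_zero]
    have h2 := ih (j + 1) hh hflat
    exact (h1.sub ((hFd.smulRight h2).const_smul (j : ℝ))).congr
      fun x hx => (hderiv hh hflat j x hx).fderiv

open Metric Topology in
/-- Along a sequence of points off `S` converging fast enough, there is a smooth function flat
along `S` which is at least the `k`-th power of the distance to `S` at the `k`-th point. -/
theorem exists_flat_ge_infDist_pow {E : Type*} [NormedAddCommGroup E] [NormedSpace ℝ E]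
    [FiniteDimensional ℝ E] {S : Set E} {u : ℕ → E} (hpos : ∀ k, 0 < infDist (u k) S)
    (hle : ∀ k, infDist (u k) S ≤ (1 / 2) ^ k) :
    ∃ h : E → ℝ, ContDiff ℝ (⊤ : ℕ∞) h ∧ (∀ k : ℕ, ∀ x ∈ S, iteratedFDeriv ℝ k h x = 0) ∧
      ∀ k, infDist (u k) S ^ k ≤ h (u k) := by
  let ψ : ContDiffBump (0 : E) := ⟨1 / 4, 1 / 2, by norm_num, by norm_num⟩
  have hψ (m : ℕ∞) : ContDiff ℝ m ψ := ψ.contDiff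
  choose M hM using fun m : ℕ => (ψ.hasCompactSupport.iteratedFDeriv (𝕜 := ℝ) m
    ).exists_bound_of_continuous ((hψ m).continuous_iteratedFDeriv le_rfl)
  have hM0 (m : ℕ) : 0 ≤ M m := (norm_nonneg _).trans (hM m 0)
  set d : ℕ → ℝ := fun k => infDist (u k) S with hd
  let f : ℕ → E → ℝ := fun k x => d k ^ k • ψ ((d k)⁻¹ • (x - u k))
  have hf (k : ℕ) : ContDiff ℝ (⊤ : ℕ∞) (f k) :=
    ((hψ ⊤).comp ((contDiff_id.sub contDiff_const).const_smul _)).const_smul _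
  have hDf (m k : ℕ) (x : E) : iteratedFDeriv ℝ m (f k) x =
      d k ^ k • (d k)⁻¹ ^ m • iteratedFDeriv ℝ m ψ ((d k)⁻¹ • (x - u k)) := by
    have hc : ContDiff ℝ m fun x => ψ ((d k)⁻¹ • (x - u k)) :=
      (hψ m).comp ((contDiff_id.sub contDiff_const).const_smul _)
    rw [iteratedFDeriv_const_smul_apply' hc.contDiffAt,
      iteratedFDeriv_comp_sub (f := fun z => ψ ((d k)⁻¹ • z)),
      iteratedFDeriv_comp_const_smul _ (hψ m)]
  have hbd (m k : ℕ) (x : E) :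
      ‖iteratedFDeriv ℝ m (f k) x‖ ≤ d k ^ k * ((d k)⁻¹ ^ m * M m) := by
    have := (hpos k).le
    rw [hDf, norm_smul, norm_smul, norm_pow, norm_pow, norm_inv, Real.norm_of_nonneg this]
    gcongr
    exact hM m _
  have hsum (m : ℕ) : Summable fun k => d k ^ k * ((d k)⁻¹ ^ m * M m) := by
    refine Summable.of_norm_bounded_eventually_nat
      (g := fun k => (1 / 2 : ℝ) ^ k * M m) ((summable_geometric_two).mul_right _) ?_
    filter_upwards [Filter.eventually_gt_atTop m] with k hk
    obtain ⟨l, rfl⟩ := Nat.exists_eq_add_of_lt hk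
    have h0 := hpos (m + l + 1)
    have h1 := hle (m + l + 1)
    have h2 : d (m + l + 1) ≤ 1 := h1.trans (pow_le_one₀ (by norm_num) (by norm_num))
    have h3 := hM0 m
    rw [Real.norm_of_nonneg (by positivity)]
    calc d (m + l + 1) ^ (m + l + 1) * ((d (m + l + 1))⁻¹ ^ m * M m)
        = d (m + l + 1) ^ l * d (m + l + 1) * M m := by
          have : d (m + l + 1) ^ m * (d (m + l + 1))⁻¹ ^ m = 1 := by
            rw [← mul_pow, mul_inv_cancel₀ h0.ne', one_pow]
          linear_combination d (m + l + 1) ^ (l + 1) * M m * this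
      _ ≤ 1 * (1 / 2) ^ (m + l + 1) * M m := by
          gcongr
          exact pow_le_one₀ h0.le h2
      _ = _ := by ring
  refine ⟨fun x => ∑' k, f k x, contDiff_tsum hf (fun m _ => hsum m) fun m k x _ => hbd m k x,
    fun m x hx => ?_, fun k => ?_⟩
  · rw [iteratedFDeriv_tsum_apply hf (fun m _ => hsum m) (fun m k x _ => hbd m k x) le_top]
    refine (tsum_congr fun k => ?_).trans tsum_zero
    have hout : (d k)⁻¹ • (x - u k) ∉ tsupport ψ := by
      have : d k ≤ dist x (u k) := dist_comm x (u k) ▸ infDist_le_dist_of_mem hx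
      rw [ψ.tsupport_eq, mem_closedBall, dist_zero_right, norm_smul, norm_inv,
        Real.norm_of_nonneg (hpos k).le, ← dist_eq_norm, not_le]
      calc (1 / 2 : ℝ) < 1 := by norm_num
        _ = (d k)⁻¹ * d k := (inv_mul_cancel₀ (hpos k).ne').symm
        _ ≤ (d k)⁻¹ * dist x (u k) := by have := (hpos k).le; gcongr
    rw [hDf, Function.notMem_support.1 fun h => hout (support_iteratedFDeriv_subset m h),
      smul_zero, smul_zero]
  · have hnn (i : ℕ) : 0 ≤ f i (u k) := mul_nonneg (pow_nonneg (hpos i).le _) ψ.nonneg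
    have hsk : Summable fun i => f i (u k) :=
      Summable.of_norm_bounded (hsum 0) fun i => by
        simpa only [norm_iteratedFDeriv_zero] using hbd 0 i (u k)
    refine le_trans (le_of_eq ?_) (hsk.le_tsum k fun i _ => hnn i)
    have : ψ 0 = 1 := ψ.one_of_mem_closedBall (mem_closedBall_self ψ.rIn_pos.le)
    simp [f, hd, this]

/-- A Jacobian minor of a map smooth on an open set is smooth there. -/
theorem contDiffOn_kGen {n p : ℕ} {φ : EuclideanSpace ℝ (Fin n) → EuclideanSpace ℝ (Fin p)}
    {V : Set (EuclideanSpace ℝ (Fin n))} (hV : IsOpen V) (hφ : ContDiffOn ℝ (⊤ : ℕ∞) φ V)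
    (ι : Fin p → Fin n) : ContDiffOn ℝ (⊤ : ℕ∞) (kGen n p φ ι) V := by
  have hd := ((contDiffOn_infty_iff_fderiv_of_isOpen hV).1 hφ).2
  refine ContDiffOn.congr ?_ fun x _ => Matrix.det_apply' _
  exact ContDiffOn.sum fun σ _ => contDiffOn_const.mul <| contDiffOn_prod fun k _ =>
    contDiffOn_euclidean.1 (hd.clm_apply contDiffOn_const) _

open Metric Topology in
/-- If `I_K(φ)` is `Σ`-elliptic, then it contains every function flat along `Σ`. -/
theorem IKElliptic.memIK_of_flatOnSet {n p : ℕ} {S : Set (EuclideanSpace ℝ (Fin n))}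
    (hS : IsClosed S) (h0S : (0 : EuclideanSpace ℝ (Fin n)) ∈ S)
    {φ : EuclideanSpace ℝ (Fin n) → EuclideanSpace ℝ (Fin p)}
    {U : Set (EuclideanSpace ℝ (Fin n))} (hU : U ∈ 𝓝 0) (hφ : ContDiffOn ℝ (⊤ : ℕ∞) φ U)
    (hell : IKElliptic n p S φ) {h : EuclideanSpace ℝ (Fin n) → ℝ} (hh : FlatOnSet n S h) :
    MemIK n p φ h := by
  classical
  obtain ⟨W, hW, a, b, ha, hb, C, hC, α, hα, hbound⟩ := hell
  obtain ⟨W', hW', hhs, hflat⟩ := hh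
  obtain ⟨V, hVsub, hVo, h0V⟩ := _root_.mem_nhds_iff.1 <|
    Filter.inter_mem (Filter.inter_mem hU hW) (Filter.inter_mem hW' (ball_mem_nhds 0 one_pos))
  have hVU : V ⊆ U := fun x hx => (hVsub hx).1.1
  have hVW : V ⊆ W := fun x hx => (hVsub hx).1.2
  have hVW' : V ⊆ W' := fun x hx => (hVsub hx).2.1
  have hne : S.Nonempty := ⟨0, h0S⟩
  set F : EuclideanSpace ℝ (Fin n) → ℝ := fun x => (∑ j, a j x * φ x j) +
    ∑ ι : Fin p → Fin n, if StrictMono ι then b ι x * kGen n p φ ι x else 0 with hFdef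
  have hF : ContDiffOn ℝ (⊤ : ℕ∞) F V := by
    refine (ContDiffOn.sum fun j _ => ((ha j).mono hVW).mul
      (contDiffOn_euclidean.1 (hφ.mono hVU) j)).add (ContDiffOn.sum fun ι _ => ?_)
    split_ifs
    · exact ((hb ι).mono hVW).mul (contDiffOn_kGen hVo (hφ.mono hVU) ι)
    · exact contDiffOn_const
  have hFbound : ∀ x ∈ V, C * infDist x S ^ ⌈α⌉₊ ≤ |F x| := fun x hx => by
    refine le_trans ?_ (hbound x (hVW hx))
    have h1 : infDist x S ≤ 1 := (infDist_le_dist_of_mem h0S).trans (hVsub hx).2.2.le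
    rw [← Real.rpow_natCast]
    refine mul_le_mul_of_nonneg_left ?_ hC.le
    rcases (infDist_nonneg (x := x) (s := S)).eq_or_lt with h0 | hpos
    · rw [← h0, Real.zero_rpow hα.ne', Real.zero_rpow]
      exact_mod_cast (Nat.ceil_pos.2 hα).ne'
    · exact Real.rpow_le_rpow_of_exponent_ge hpos h1 (Nat.le_ceil α)
  have hflatV : ∀ k : ℕ, ∀ x ∈ S ∩ V, iteratedFDeriv ℝ k h x = 0 :=
    fun k x hx => hflat k x ⟨hx.1, hVW' hx.2⟩
  set q : EuclideanSpace ℝ (Fin n) → ℝ := fun x => (F x)⁻¹ ^ 1 • h x with hqdef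
  have hq : ContDiffOn ℝ (⊤ : ℕ∞) q V := contDiffOn_infty.2 fun m =>
    contDiffOn_inv_pow_smul_of_flat hS hne hVo hF hC hFbound m 1 (hhs.mono hVW') hflatV
  refine ⟨V, hVo.mem_nhds h0V, fun j x => q x * a j x, fun ι x => q x * b ι x,
    fun j => hq.mul ((ha j).mono hVW), fun ι => hq.mul ((hb ι).mono hVW), fun x hx => ?_⟩
  have hqF : h x = q x * F x := by
    by_cases hFx : F x = 0
    · have hle := hFbound x hx
      have hxS : x ∈ S := by
        by_contra hxS
        have := (hS.notMem_iff_infDist_pos hne).1 hxS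
        rw [hFx, abs_zero] at hle
        exact absurd hle (not_le.2 (by positivity))
      rw [hFx, mul_zero, eq_zero_of_iteratedFDeriv_zero_eq_zero (hflatV 0 x ⟨hxS, hx⟩)]
    · simp only [hqdef, pow_one, smul_eq_mul]
      field_simp
  rw [hqF, hFdef]
  simp only [mul_add, Finset.mul_sum, mul_ite, mul_zero, mul_assoc]

open Metric Topology Filter in
/-- If `I_K(φ)` contains every function flat along `Σ`, then it is `Σ`-elliptic: the sum of the
squares of its generators is bounded below by a power of the distance to `Σ`. -/
theorem ikElliptic_of_flat_subset {n p : ℕ} {S : Set (EuclideanSpace ℝ (Fin n))}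
    (h0S : (0 : EuclideanSpace ℝ (Fin n)) ∈ S)
    {φ : EuclideanSpace ℝ (Fin n) → EuclideanSpace ℝ (Fin p)}
    {U : Set (EuclideanSpace ℝ (Fin n))} (hU : U ∈ 𝓝 0) (hφ : ContDiffOn ℝ (⊤ : ℕ∞) φ U)
    (hsub : ∀ h, FlatOnSet n S h → MemIK n p φ h) : IKElliptic n p S φ := by
  classical
  by_contra hnot
  obtain ⟨V, hVU, hVo, h0V⟩ := _root_.mem_nhds_iff.1 hU
  set F : EuclideanSpace ℝ (Fin n) → ℝ := fun x => (∑ j, φ x j * φ x j) +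
    ∑ ι : Fin p → Fin n, if StrictMono ι then kGen n p φ ι x * kGen n p φ ι x else 0 with hFdef
  have hterm (x) (ι : Fin p → Fin n) :
      0 ≤ if StrictMono ι then kGen n p φ ι x * kGen n p φ ι x else 0 := by
    split_ifs
    exacts [mul_self_nonneg _, le_rfl]
  have hF1 (x) : 0 ≤ ∑ j, φ x j * φ x j := Finset.sum_nonneg fun j _ => mul_self_nonneg _
  have hF2 (x) : 0 ≤ ∑ ι : Fin p → Fin n,
      if StrictMono ι then kGen n p φ ι x * kGen n p φ ι x else 0 :=
    Finset.sum_nonneg fun ι _ => hterm x ι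
  have hseq (k : ℕ) : ∃ x ∈ ball (0 : EuclideanSpace ℝ (Fin n)) ((1 / 2) ^ k),
      F x < infDist x S ^ (4 * k + 4) := by
    by_contra! hk
    refine hnot ⟨V ∩ ball 0 ((1 / 2) ^ k), inter_mem (hVo.mem_nhds h0V)
      (ball_mem_nhds _ (by positivity)), fun j x => φ x j, fun ι => kGen n p φ ι,
      fun j => (contDiffOn_euclidean.1 (hφ.mono hVU) j).mono Set.inter_subset_left,
      fun ι => (contDiffOn_kGen hVo (hφ.mono hVU) ι).mono Set.inter_subset_left,
      1, one_pos, (4 * k + 4 : ℕ), by positivity, fun x hx => ?_⟩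
    rw [Real.rpow_natCast, one_mul]
    exact (hk x hx.2).trans (le_abs_self _)
  choose u hu hFu using hseq
  have hpos (k : ℕ) : 0 < infDist (u k) S := infDist_nonneg.lt_of_ne fun h0 => by
    have := hFu k
    rw [← h0, zero_pow (by omega)] at this
    exact absurd this (not_lt.2 (add_nonneg (hF1 _) (hF2 _)))
  have hle (k : ℕ) : infDist (u k) S ≤ (1 / 2) ^ k :=
    (infDist_le_dist_of_mem h0S).trans (hu k).le
  obtain ⟨h, hh, hflat, hge⟩ := exists_flat_ge_infDist_pow hpos hle
  obtain ⟨W, hW, a, b, ha, hb, hcomb⟩ :=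
    hsub h ⟨Set.univ, univ_mem, hh.contDiffOn, fun k x hx => hflat k x hx.1⟩
  have hpow : Tendsto (fun k : ℕ => ((1 / 2 : ℝ)) ^ k) atTop (𝓝 0) :=
    tendsto_pow_atTop_nhds_zero_of_lt_one (by norm_num) (by norm_num)
  have hulim : Tendsto u atTop (𝓝 0) := by
    refine tendsto_iff_dist_tendsto_zero.2 (squeeze_zero (fun _ => dist_nonneg)
      (fun k => (hu k).le) hpow)
  have hφu (k : ℕ) (j : Fin p) : |φ (u k) j| ≤ infDist (u k) S ^ (2 * k + 2) := by
    refine abs_le_of_sq_le_sq ?_ (pow_nonneg (hpos k).le _)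
    calc φ (u k) j ^ 2 = φ (u k) j * φ (u k) j := sq _
      _ ≤ ∑ j, φ (u k) j * φ (u k) j :=
        Finset.single_le_sum (f := fun j => φ (u k) j * φ (u k) j)
          (fun j _ => mul_self_nonneg _) (Finset.mem_univ j)
      _ ≤ F (u k) := le_add_of_nonneg_right (hF2 _)
      _ ≤ _ := (hFu k).le
      _ = _ := by ring
  have hku (k : ℕ) (ι : Fin p → Fin n) (hι : StrictMono ι) :
      |kGen n p φ ι (u k)| ≤ infDist (u k) S ^ (2 * k + 2) := by
    refine abs_le_of_sq_le_sq ?_ (pow_nonneg (hpos k).le _)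
    calc kGen n p φ ι (u k) ^ 2
        = if StrictMono ι then kGen n p φ ι (u k) * kGen n p φ ι (u k) else 0 := by
          rw [if_pos hι, sq]
      _ ≤ ∑ ι : Fin p → Fin n,
          if StrictMono ι then kGen n p φ ι (u k) * kGen n p φ ι (u k) else 0 :=
        Finset.single_le_sum (f := fun ι : Fin p → Fin n =>
          if StrictMono ι then kGen n p φ ι (u k) * kGen n p φ ι (u k) else 0)
          (fun ι _ => hterm _ ι) (Finset.mem_univ ι)
      _ ≤ F (u k) := le_add_of_nonneg_left (hF1 _)
      _ ≤ _ := (hFu k).le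
      _ = _ := by ring
  set B : EuclideanSpace ℝ (Fin n) → ℝ := fun x => (∑ j, |a j x|) + ∑ ι, |b ι x| with hBdef
  have hBc : ContinuousAt B 0 := by
    refine ContinuousAt.add (tendsto_finsetSum _ fun j _ => ?_) (tendsto_finsetSum _ fun ι _ => ?_)
    · exact ((ha j).continuousOn.continuousAt hW).abs
    · exact ((hb ι).continuousOn.continuousAt hW).abs
  have hlim : Tendsto (fun k => B (u k) * (1 / 2 : ℝ) ^ k) atTop (𝓝 0) := by
    simpa using (hBc.tendsto.comp hulim).mul hpow
  obtain ⟨k, hkW, hk⟩ := ((hulim.eventually hW).and (hlim.eventually_lt_const one_pos)).exists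
  set d := infDist (u k) S
  have hd : 0 < d := hpos k
  have hd1 : d ≤ 1 := (hle k).trans (pow_le_one₀ (by norm_num) (by norm_num))
  have hB0 : 0 ≤ B (u k) := by positivity
  have hupper : h (u k) ≤ B (u k) * d ^ (2 * k + 2) := by
    rw [hcomb _ hkW, hBdef]
    simp only [add_mul, Finset.sum_mul]
    refine add_le_add (Finset.sum_le_sum fun j _ => ?_) (Finset.sum_le_sum fun ι _ => ?_)
    · refine (le_abs_self _).trans ?_
      rw [abs_mul]
      exact mul_le_mul_of_nonneg_left (hφu k j) (abs_nonneg _)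
    · split_ifs with hι
      · refine (le_abs_self _).trans ?_
        rw [abs_mul]
        exact mul_le_mul_of_nonneg_left (hku k ι hι) (abs_nonneg _)
      · positivity
  have : d ^ k < d ^ k :=
    calc d ^ k ≤ h (u k) := hge k
      _ ≤ B (u k) * d ^ (2 * k + 2) := hupper
      _ = d ^ k * (B (u k) * (d * d ^ (k + 1))) := by ring
      _ ≤ d ^ k * (B (u k) * ((1 / 2) ^ k * 1)) := by
        gcongr
        · exact hle k
        · exact pow_le_one₀ hd.le hd1
      _ < d ^ k * 1 := by
        rw [mul_one ((1 / 2 : ℝ) ^ k)]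
        gcongr
      _ = d ^ k := mul_one _
  exact lt_irrefl _ this

theorem ikElliptic_iff_flat_subset_IK (n p : ℕ) (hp : 1 ≤ p) (hpn : p < n)
    (S : Set (EuclideanSpace ℝ (Fin n))) (hS : IsClosed S)
    (h0S : (0 : EuclideanSpace ℝ (Fin n)) ∈ S) (hcoh : CoherentSet n S)
    (φ : EuclideanSpace ℝ (Fin n) → EuclideanSpace ℝ (Fin p))
    (U : Set (EuclideanSpace ℝ (Fin n))) (hU : U ∈ nhds 0)
    (hφ : ContDiffOn ℝ (⊤ : ℕ∞) φ U) (hφ0 : φ 0 = 0) :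
    IKElliptic n p S φ ↔ ∀ h, FlatOnSet n S h → MemIK n p φ h :=
  ⟨fun hell _ hh => hell.memIK_of_flatOnSet hS h0S hU hφ hh,
    ikElliptic_of_flat_subset h0S hU hφ⟩
end
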